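/- arXiv:0709.2821 — 2 statements merged into one kernel-verified Lean document; each statement's English description precedes it below -/
import Mathlib

section
/- Let N ≥ 1 and m ≥ 1 be integers. There exists a constant k = k_{N,m} > 0, depending only on N and m, such that, with G_∞^+ the half-space kernel with constant k, the following holds: if u : {x ∈ ℝ^N : x₁ ≥ 0} → ℝ is C^{2m} on ℝ^N_+, u and all its partial derivatives of order ≤ 2m−1 extend continuously to {x₁ ≥ 0} and are bounded there, u satisfies the Dirichlet boundary conditions ∂^j u/∂x₁^j(0,x') = 0 for all x' ∈ ℝ^{N−1} and j = 0,1,…,m−1, and (−Δ)^m u(y) ≥ 0 for all y ∈ ℝ^N_+, then u(x) = ∫_{ℝ^N_+} G_∞^+(x,y) (−Δ)^m u(y) dy for every x ∈ ℝ^N_+. -/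
noncomputable def lap {N : ℕ} (f : EuclideanSpace ℝ (Fin N) → ℝ)
    (x : EuclideanSpace ℝ (Fin N)) : ℝ :=
  ∑ i : Fin N, iteratedDeriv 2 (fun t : ℝ => f (x + t • EuclideanSpace.single i (1 : ℝ))) 0

noncomputable def polyLap {N : ℕ} (m : ℕ) (f : EuclideanSpace ℝ (Fin N) → ℝ)
    (x : EuclideanSpace ℝ (Fin N)) : ℝ :=
  (-1 : ℝ) ^ m * (lap^[m] f x)

/-- The first coordinate vector `e₁ = (1,0,…,0)` of `ℝ^N`. -/
noncomputable def e1 (N : ℕ) [NeZero N] : EuclideanSpace ℝ (Fin N) :=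
  EuclideanSpace.single 0 1

/-- `ψ_∞(x,y) = 4x₁y₁/|x-y|²`. -/
noncomputable def psiInf {N : ℕ} [NeZero N] (x y : EuclideanSpace ℝ (Fin N)) : ℝ :=
  4 * x 0 * y 0 / ‖x - y‖ ^ 2

/-- The half-space Green kernel `G_∞^+` of `(-Δ)^m` on `ℝ^N_+` with constant `k`. -/
noncomputable def GreenHalf (N m : ℕ) [NeZero N] (k : ℝ)
    (x y : EuclideanSpace ℝ (Fin N)) : ℝ :=
  k / 2 * ‖x - y‖ ^ (2 * (m : ℝ) - N) *
    ∫ z in (0 : ℝ)..(psiInf x y), z ^ (m - 1) * (z + 1) ^ (-(N : ℝ) / 2)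

open MeasureTheory Set Filter Topology
open scoped ContDiff

theorem continuous_mul_of_continuousOn_of_tsupport_subset {X : Type*} [TopologicalSpace X]
    {U : Set X} (hU : IsOpen U) {a b : X → ℝ} (ha : ContinuousOn a U) (hb : Continuous b)
    (hbU : tsupport b ⊆ U) : Continuous fun x => a x * b x := by
  rw [continuous_iff_continuousAt]
  intro x
  by_cases hx : x ∈ tsupport b
  · exact (ha.continuousAt (hU.mem_nhds (hbU hx))).mul hb.continuousAt
  · have h0 : b =ᶠ[𝓝 x] 0 := notMem_tsupport_iff_eventuallyEq.1 hx
    have : (fun x => a x * b x) =ᶠ[𝓝 x] fun _ => (0 : ℝ) := by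
      filter_upwards [h0] with y hy
      simp [hy]
    exact continuousAt_const.congr this.symm

theorem contDiff_mul_of_contDiffOn_of_tsupport_subset {E : Type*} [NormedAddCommGroup E]
    [NormedSpace ℝ E] {n : WithTop ℕ∞}
    {U : Set E} (hU : IsOpen U) {a b : E → ℝ} (ha : ContDiffOn ℝ n a U) (hb : ContDiff ℝ n b)
    (hbU : tsupport b ⊆ U) : ContDiff ℝ n fun x => a x * b x := by
  rw [contDiff_iff_contDiffAt]
  intro x
  by_cases hx : x ∈ tsupport b
  · exact (ha.contDiffAt (hU.mem_nhds (hbU hx))).mul hb.contDiffAt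
  · have h0 : b =ᶠ[𝓝 x] 0 := notMem_tsupport_iff_eventuallyEq.1 hx
    have : (fun x => a x * b x) =ᶠ[𝓝 x] fun _ => (0 : ℝ) := by
      filter_upwards [h0] with y hy
      simp [hy]
    exact contDiffAt_const.congr_of_eventuallyEq this

section PartialDerivatives

variable {E : Type*} [NormedAddCommGroup E] [NormedSpace ℝ E]

/-- The derivative of `f` in the direction `v`. -/
noncomputable def dirDeriv (v : E) (f : E → ℝ) (x : E) : ℝ := fderiv ℝ f x v

theorem ContDiffOn.dirDeriv {v : E} {f : E → ℝ} {U : Set E} {n k : WithTop ℕ∞} (hU : IsOpen U)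
    (hf : ContDiffOn ℝ k f U) (hk : n + 1 ≤ k) : ContDiffOn ℝ n (dirDeriv v f) U :=
  (hf.fderiv_of_isOpen hU hk).clm_apply contDiffOn_const

theorem Filter.EventuallyEq.dirDeriv_eq {v : E} {f g : E → ℝ} {x : E} (h : f =ᶠ[𝓝 x] g) :
    dirDeriv v f x = dirDeriv v g x := by
  unfold dirDeriv; rw [h.fderiv_eq]

theorem dirDeriv_congr {v : E} {f g : E → ℝ} {U : Set E} (hU : IsOpen U) (h : EqOn f g U) :
    EqOn (dirDeriv v f) (dirDeriv v g) U := fun _ hx =>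
  (h.eventuallyEq_of_mem (hU.mem_nhds hx)).dirDeriv_eq

theorem dirDeriv_add {v : E} {f g : E → ℝ} {x : E} (hf : DifferentiableAt ℝ f x)
    (hg : DifferentiableAt ℝ g x) :
    dirDeriv v (fun y => f y + g y) x = dirDeriv v f x + dirDeriv v g x := by
  unfold dirDeriv; rw [fderiv_fun_add hf hg]; rfl

theorem dirDeriv_mul {v : E} {f g : E → ℝ} {x : E} (hf : DifferentiableAt ℝ f x)
    (hg : DifferentiableAt ℝ g x) :
    dirDeriv v (fun y => f y * g y) x = dirDeriv v f x * g x + f x * dirDeriv v g x := by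
  unfold dirDeriv; rw [fderiv_fun_mul hf hg]; simp; ring

theorem dirDeriv_const_mul {v : E} {f : E → ℝ} {x : E} (c : ℝ) :
    dirDeriv v (fun y => c * f y) x = c * dirDeriv v f x := by
  unfold dirDeriv
  have := fderiv_const_smul_field (𝕜 := ℝ) (f := f) c
  have h2 := congrFun this x
  simp only [Pi.smul_def, smul_eq_mul] at h2
  rw [h2]; rfl

theorem deriv_line_eq_dirDeriv {v : E} {f : E → ℝ} {x : E} {t : ℝ}
    (hf : DifferentiableAt ℝ f (x + t • v)) :
    deriv (fun t : ℝ => f (x + t • v)) t = dirDeriv v f (x + t • v) := by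
  have h1 : HasDerivAt (fun t : ℝ => x + t • v) v t := by
    simpa using ((hasDerivAt_id t).smul_const v).const_add x
  exact (hf.hasFDerivAt.comp_hasDerivAt t h1).deriv

theorem tsupport_dirDeriv_subset (v : E) (f : E → ℝ) : tsupport (dirDeriv v f) ⊆ tsupport f :=
  (closure_mono (fun x hx => by
    intro h
    apply hx
    simp [dirDeriv, h]) : _ ⊆ tsupport (fderiv ℝ f)).trans (tsupport_fderiv_subset ℝ)

end PartialDerivatives

section Laplacian

variable {N : ℕ} {f g : EuclideanSpace ℝ (Fin N) → ℝ} {U : Set (EuclideanSpace ℝ (Fin N))}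
  {x : EuclideanSpace ℝ (Fin N)}

/-- The `i`-th coordinate vector. -/
noncomputable abbrev coordVec {N : ℕ} (i : Fin N) : EuclideanSpace ℝ (Fin N) :=
  EuclideanSpace.single i 1

theorem lap_eq_of_eventuallyEq (h : f =ᶠ[𝓝 x] g) : lap f x = lap g x := by
  unfold lap
  refine Finset.sum_congr rfl fun i _ => ?_
  apply Filter.EventuallyEq.iteratedDeriv_eq
  have : Tendsto (fun t : ℝ => x + t • EuclideanSpace.single i (1 : ℝ)) (𝓝 0) (𝓝 x) := by
    have : Continuous (fun t : ℝ => x + t • EuclideanSpace.single i (1 : ℝ)) := by fun_prop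
    simpa using this.tendsto 0
  exact this.eventually h

theorem lap_congr (hU : IsOpen U) (h : EqOn f g U) : EqOn (lap f) (lap g) U := fun _ hx =>
  lap_eq_of_eventuallyEq (h.eventuallyEq_of_mem (hU.mem_nhds hx))

theorem iterate_lap_congr (hU : IsOpen U) (h : EqOn f g U) (j : ℕ) :
    EqOn (lap^[j] f) (lap^[j] g) U := by
  induction j generalizing f g with
  | zero => simpa using h
  | succ j ih => exact ih (lap_congr hU h)

theorem lap_eq_sum (hf : ContDiffAt ℝ 2 f x) :
    lap f x = ∑ i, dirDeriv (coordVec i) (dirDeriv (coordVec i) f) x := by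
  unfold lap
  refine Finset.sum_congr rfl fun i _ => ?_
  rw [iteratedDeriv_succ, iteratedDeriv_one]
  have hc : Tendsto (fun t : ℝ => x + t • coordVec i) (𝓝 0) (𝓝 x) := by
    have : Continuous (fun t : ℝ => x + t • coordVec i) := by fun_prop
    simpa using this.tendsto 0
  have hd : ∀ᶠ y in 𝓝 x, DifferentiableAt ℝ f y := by
    filter_upwards [hf.eventually (by simp)] with y hy
    exact hy.differentiableAt (by simp)
  have h1 : deriv (fun t : ℝ => f (x + t • coordVec i)) =ᶠ[𝓝 0]
      fun t => dirDeriv (coordVec i) f (x + t • coordVec i) := by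
    filter_upwards [hc.eventually hd] with t ht
    exact deriv_line_eq_dirDeriv ht
  rw [h1.deriv_eq, deriv_line_eq_dirDeriv]
  · simp
  · simp only [zero_smul, add_zero]
    have : ContDiffAt ℝ 1 (fderiv ℝ f) x := hf.fderiv_right (by norm_num)
    exact (this.differentiableAt (by simp)).clm_apply (differentiableAt_const _)

theorem ContDiffOn.lap {n k : WithTop ℕ∞} (hU : IsOpen U) (hf : ContDiffOn ℝ k f U)
    (hk : n + 2 ≤ k) : ContDiffOn ℝ n (lap f) U := by
  have hk2 : (2 : WithTop ℕ∞) ≤ k := le_trans (by simp) hk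
  have h : ∀ i : Fin N, ContDiffOn ℝ n (_root_.dirDeriv (coordVec i) (_root_.dirDeriv (coordVec i) f)) U := by
    intro i
    have h1 : ContDiffOn ℝ (n + 1) (_root_.dirDeriv (coordVec i) f) U :=
      hf.dirDeriv hU (by rw [add_assoc]; norm_num; exact hk)
    exact h1.dirDeriv hU le_rfl
  refine (ContDiffOn.sum (fun i _ => h i) : ContDiffOn ℝ n
    (fun x => ∑ i, _root_.dirDeriv (coordVec i) (_root_.dirDeriv (coordVec i) f) x) U).congr ?_
  intro x hx
  exact lap_eq_sum ((hf.contDiffAt (hU.mem_nhds hx)).of_le hk2)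

theorem ContDiffOn.iterate_lap {n : WithTop ℕ∞} {j : ℕ} (hU : IsOpen U)
    (hf : ContDiffOn ℝ (n + (2 * j : ℕ)) f U) : ContDiffOn ℝ n (_root_.lap^[j] f) U := by
  induction j generalizing f with
  | zero => simpa using hf
  | succ j ih =>
    refine ih (hf.lap hU ?_)
    rw [add_assoc]
    push_cast
    rw [mul_add, mul_one]

theorem ContDiffOn.iterate_lap_infty (j : ℕ) (hU : IsOpen U)
    (hf : ContDiffOn ℝ ∞ f U) : ContDiffOn ℝ ∞ (_root_.lap^[j] f) U := by
  induction j generalizing f with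
  | zero => simpa using hf
  | succ j ih => exact ih (hf.lap hU (by rfl))

theorem lap_add (hf : ContDiffAt ℝ 2 f x) (hg : ContDiffAt ℝ 2 g x) :
    lap (fun y => f y + g y) x = lap f x + lap g x := by
  rw [lap_eq_sum hf, lap_eq_sum hg, lap_eq_sum (hf.add hg), ← Finset.sum_add_distrib]
  refine Finset.sum_congr rfl fun i _ => ?_
  have hd : ∀ᶠ y in 𝓝 x, dirDeriv (coordVec i) (fun y => f y + g y) y =
      dirDeriv (coordVec i) f y + dirDeriv (coordVec i) g y := by
    filter_upwards [hf.eventually (by simp), hg.eventually (by simp)] with y hy hy'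
    exact dirDeriv_add (hy.differentiableAt (by simp)) (hy'.differentiableAt (by simp))
  rw [Filter.EventuallyEq.dirDeriv_eq hd]
  have key : ∀ h : EuclideanSpace ℝ (Fin N) → ℝ, ContDiffAt ℝ 2 h x →
      DifferentiableAt ℝ (dirDeriv (coordVec i) h) x := by
    intro h hh
    have : ContDiffAt ℝ 1 (fderiv ℝ h) x := hh.fderiv_right (by norm_num)
    exact (this.differentiableAt (by simp)).clm_apply (differentiableAt_const _)
  exact dirDeriv_add (key f hf) (key g hg)

theorem lap_const_mul (c : ℝ) : lap (fun y => c * f y) x = c * lap f x := by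
  unfold lap
  rw [Finset.mul_sum]
  refine Finset.sum_congr rfl fun i _ => ?_
  exact iteratedDeriv_const_mul_field c _

theorem lap_zero : lap (fun _ : EuclideanSpace ℝ (Fin N) => (0 : ℝ)) x = 0 := by
  simpa using lap_const_mul (f := fun _ => (0 : ℝ)) (x := x) 0

theorem lap_mul (hf : ContDiffAt ℝ 2 f x) (hg : ContDiffAt ℝ 2 g x) :
    lap (fun y => f y * g y) x = lap f x * g x + f x * lap g x +
      2 * ∑ i, dirDeriv (coordVec i) f x * dirDeriv (coordVec i) g x := by
  rw [lap_eq_sum hf, lap_eq_sum hg, lap_eq_sum (hf.mul hg), Finset.mul_sum, Finset.sum_mul,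
    Finset.mul_sum, ← Finset.sum_add_distrib, ← Finset.sum_add_distrib]
  refine Finset.sum_congr rfl fun i _ => ?_
  have hd : ∀ᶠ y in 𝓝 x, dirDeriv (coordVec i) (fun y => f y * g y) y =
      dirDeriv (coordVec i) f y * g y + f y * dirDeriv (coordVec i) g y := by
    filter_upwards [hf.eventually (by simp), hg.eventually (by simp)] with y hy hy'
    exact dirDeriv_mul (hy.differentiableAt (by simp)) (hy'.differentiableAt (by simp))
  rw [Filter.EventuallyEq.dirDeriv_eq hd]
  have key : ∀ h : EuclideanSpace ℝ (Fin N) → ℝ, ContDiffAt ℝ 2 h x →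
      DifferentiableAt ℝ (dirDeriv (coordVec i) h) x := by
    intro h hh
    have : ContDiffAt ℝ 1 (fderiv ℝ h) x := hh.fderiv_right (by norm_num)
    exact (this.differentiableAt (by simp)).clm_apply (differentiableAt_const _)
  have hf' := hf.differentiableAt (by simp)
  have hg' := hg.differentiableAt (by simp)
  rw [dirDeriv_add (f := fun y => dirDeriv (coordVec i) f y * g y)
    (g := fun y => f y * dirDeriv (coordVec i) g y)
    ((key f hf).mul hg') (hf'.mul (key g hg)), dirDeriv_mul (key f hf) hg',
    dirDeriv_mul hf' (key g hg)]
  ring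

theorem iterate_lap_add {j : ℕ} (hU : IsOpen U) (hf : ContDiffOn ℝ (2 * j : ℕ) f U)
    (hg : ContDiffOn ℝ (2 * j : ℕ) g U) :
    EqOn (lap^[j] (fun y => f y + g y)) (fun y => lap^[j] f y + lap^[j] g y) U := by
  induction j generalizing f g with
  | zero => intro y _; rfl
  | succ j ih =>
    intro y hy
    have h2 : ((2 * j : ℕ) : WithTop ℕ∞) + 2 ≤ (2 * (j + 1) : ℕ) := by
      rw [mul_add]; push_cast; simp
    have h1 : EqOn (lap (fun y => f y + g y)) (fun y => lap f y + lap g y) U := fun z hz =>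
      lap_add ((hf.contDiffAt (hU.mem_nhds hz)).of_le (le_trans (by simp) h2))
        ((hg.contDiffAt (hU.mem_nhds hz)).of_le (le_trans (by simp) h2))
    have := iterate_lap_congr hU h1 j hy
    simp only [Function.iterate_succ, Function.comp]
    rw [this]
    exact ih (hf.lap hU h2) (hg.lap hU h2) hy

theorem iterate_lap_const_mul (j : ℕ) (c : ℝ) :
    lap^[j] (fun y => c * f y) = fun y => c * lap^[j] f y := by
  induction j generalizing f with
  | zero => rfl
  | succ j ih =>
    have h : lap (fun y => c * f y) = fun y => c * lap f y := funext fun y => lap_const_mul c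
    simp only [Function.iterate_succ, Function.comp]
    rw [h, ih]

theorem tsupport_lap_subset (f : EuclideanSpace ℝ (Fin N) → ℝ) : tsupport (lap f) ⊆ tsupport f := by
  refine closure_minimal (fun x hx => ?_) (isClosed_tsupport f)
  by_contra hx'
  apply hx
  rw [lap_eq_of_eventuallyEq (notMem_tsupport_iff_eventuallyEq.1 hx')]
  exact lap_zero

theorem tsupport_iterate_lap_subset (j : ℕ) (f : EuclideanSpace ℝ (Fin N) → ℝ) :
    tsupport (lap^[j] f) ⊆ tsupport f := by
  induction j generalizing f with
  | zero => rfl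
  | succ j ih => exact (ih (lap f)).trans (tsupport_lap_subset f)

theorem integral_mul_lap {a b : EuclideanSpace ℝ (Fin N) → ℝ} (hU : IsOpen U)
    (ha : ContDiffOn ℝ 2 a U) (hb : ContDiff ℝ 2 b) (hbc : HasCompactSupport b)
    (hbU : tsupport b ⊆ U) :
    ∫ y, a y * lap b y = ∫ y, lap a y * b y := by
  have hintg : ∀ c d : EuclideanSpace ℝ (Fin N) → ℝ, ContinuousOn c U → Continuous d →
      tsupport d ⊆ tsupport b → Integrable (fun y => c y * d y) := by
    intro c d hc hd hdb
    refine (continuous_mul_of_continuousOn_of_tsupport_subset hU hc hd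
      (hdb.trans hbU)).integrable_of_hasCompactSupport ?_
    exact (hbc.mono' ((subset_tsupport d).trans hdb)).mul_left
  have ha1 : ∀ i : Fin N, ContDiffOn ℝ 1 (dirDeriv (coordVec i) a) U := fun i =>
    ha.dirDeriv hU (by norm_num)
  have ha2 : ∀ i : Fin N, ContDiffOn ℝ 0 (dirDeriv (coordVec i) (dirDeriv (coordVec i) a)) U :=
    fun i => (ha1 i).dirDeriv hU (by norm_num)
  have hb1 : ∀ i : Fin N, ContDiff ℝ 1 (dirDeriv (coordVec i) b) := fun i =>
    contDiffOn_univ.1 (hb.contDiffOn.dirDeriv isOpen_univ (by norm_num))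
  have hb2 : ∀ i : Fin N, ContDiff ℝ 0 (dirDeriv (coordVec i) (dirDeriv (coordVec i) b)) :=
    fun i => contDiffOn_univ.1 ((hb1 i).contDiffOn.dirDeriv isOpen_univ (by norm_num))
  have ht1 : ∀ i : Fin N, tsupport (dirDeriv (coordVec i) b) ⊆ tsupport b := fun i =>
    tsupport_dirDeriv_subset _ _
  have ht2 : ∀ i : Fin N, tsupport (dirDeriv (coordVec i) (dirDeriv (coordVec i) b)) ⊆
    tsupport b := fun i => (tsupport_dirDeriv_subset _ _).trans (ht1 i)
  have hlb : ∀ y, a y * lap b y =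
      ∑ i, a y * dirDeriv (coordVec i) (dirDeriv (coordVec i) b) y := fun y => by
    rw [lap_eq_sum hb.contDiffAt, Finset.mul_sum]
  have hla : ∀ y, lap a y * b y =
      ∑ i, dirDeriv (coordVec i) (dirDeriv (coordVec i) a) y * b y := fun y => by
    by_cases hy : y ∈ tsupport b
    · rw [lap_eq_sum (ha.contDiffAt (hU.mem_nhds (hbU hy))), Finset.sum_mul]
    · simp [image_eq_zero_of_notMem_tsupport hy]
  simp_rw [hlb, hla]
  rw [integral_finsetSum _ fun i _ => hintg _ _ ha.continuousOn (hb2 i).continuous (ht2 i),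
    integral_finsetSum _ fun i _ => hintg _ _ (ha2 i).continuousOn hb.continuous le_rfl]
  refine Finset.sum_congr rfl fun i _ => ?_
  have e1 : ∫ y, a y * dirDeriv (coordVec i) (dirDeriv (coordVec i) b) y =
      - ∫ y, dirDeriv (coordVec i) a y * dirDeriv (coordVec i) b y :=
    integral_mul_fderiv_eq_neg_fderiv_mul_of_integrable
      (hintg _ _ (ha1 i).continuousOn (hb1 i).continuous (ht1 i))
      (hintg _ _ ha.continuousOn (hb2 i).continuous (ht2 i))
      (hintg _ _ ha.continuousOn (hb1 i).continuous (ht1 i))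
      (fun y hy => (ha.contDiffAt (hU.mem_nhds (hbU (ht1 i hy)))).differentiableAt (by simp))
      (fun y _ => (hb1 i).differentiable (by simp) y)
  have e2 : ∫ y, dirDeriv (coordVec i) a y * dirDeriv (coordVec i) b y =
      - ∫ y, dirDeriv (coordVec i) (dirDeriv (coordVec i) a) y * b y :=
    integral_mul_fderiv_eq_neg_fderiv_mul_of_integrable
      (hintg _ _ (ha2 i).continuousOn hb.continuous le_rfl)
      (hintg _ _ (ha1 i).continuousOn (hb1 i).continuous (ht1 i))
      (hintg _ _ (ha1 i).continuousOn hb.continuous le_rfl)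
      (fun y hy => ((ha1 i).contDiffAt (hU.mem_nhds (hbU hy))).differentiableAt (by simp))
      (fun y _ => hb.differentiable (by simp) y)
  rw [e1, e2, neg_neg]

theorem integral_mul_iterate_lap {a b : EuclideanSpace ℝ (Fin N) → ℝ} {j : ℕ} (hU : IsOpen U)
    (ha : ContDiffOn ℝ (2 * j : ℕ) a U) (hb : ContDiff ℝ (2 * j : ℕ) b) (hbc : HasCompactSupport b)
    (hbU : tsupport b ⊆ U) :
    ∫ y, a y * lap^[j] b y = ∫ y, lap^[j] a y * b y := by
  induction j generalizing a with
  | zero => rfl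
  | succ j ih =>
    have h2 : ((2 * j : ℕ) : WithTop ℕ∞) + 2 ≤ (2 * (j + 1) : ℕ) := by
      rw [mul_add]; push_cast; simp
    have h3 : (2 : WithTop ℕ∞) + (2 * j : ℕ) ≤ (2 * (j + 1) : ℕ) := by
      rw [add_comm]; exact h2
    have hlb : ContDiff ℝ 2 (lap^[j] b) :=
      contDiffOn_univ.1 ((hb.of_le h3).contDiffOn.iterate_lap isOpen_univ)
    have hts := tsupport_iterate_lap_subset j b
    simp only [Function.iterate_succ_apply']
    rw [integral_mul_lap hU (ha.of_le (le_trans (by simp) h2)) hlb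
      (hbc.mono' ((subset_tsupport _).trans hts)) (hts.trans hbU)]
    rw [ih (ha.lap hU h2) (hb.of_le (le_trans (by simp) h2))]
    rw [← Function.iterate_succ_apply lap, Function.iterate_succ_apply']

end Laplacian

section KernelIntegral

/-- The integral `∫₀¹ t^j (a + t b)^(-s) dt` as a function of `z = (a, b)`. -/
noncomputable def kerInt (j : ℕ) (s : ℝ) (z : ℝ × ℝ) : ℝ :=
  ∫ t in (0 : ℝ)..1, t ^ j * (z.1 + t * z.2) ^ (-s)

/-- The set of `(a, b)` for which `a + t b > 0` for all `t ∈ [0, 1]`. -/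
def kerDom : Set (ℝ × ℝ) := {z | 0 < z.1 ∧ 0 < z.1 + z.2}

theorem isOpen_kerDom : IsOpen kerDom :=
  (isOpen_lt continuous_const continuous_fst).inter
    (isOpen_lt continuous_const (continuous_fst.add continuous_snd))

theorem lt_add_mul_of_mem_Icc {c a b t : ℝ} (ha : c < a) (hab : c < a + b) (ht : t ∈ Icc (0 : ℝ) 1) :
    c < a + t * b := by
  obtain ⟨h0, h1⟩ := ht
  rcases h0.eq_or_lt with rfl | h0
  · simpa using ha
  · nlinarith [mul_pos h0 (sub_pos.2 hab), mul_nonneg (sub_nonneg.2 h1) (sub_pos.2 ha).le]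

theorem continuousOn_kerInt_integrand {j : ℕ} {s : ℝ} {z : ℝ × ℝ} (hz : z ∈ kerDom) :
    ContinuousOn (fun t : ℝ => t ^ j * (z.1 + t * z.2) ^ (-s)) (Icc 0 1) := by
  refine ContinuousOn.mul (by fun_prop) (ContinuousOn.rpow_const (by fun_prop) ?_)
  intro t ht
  exact Or.inl (lt_add_mul_of_mem_Icc hz.1 hz.2 ht).ne'

theorem intervalIntegrable_kerInt_integrand {j : ℕ} {s : ℝ} {z : ℝ × ℝ} (hz : z ∈ kerDom) :
    IntervalIntegrable (fun t : ℝ => t ^ j * (z.1 + t * z.2) ^ (-s)) volume 0 1 :=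
  ContinuousOn.intervalIntegrable_of_Icc zero_le_one (continuousOn_kerInt_integrand hz)

/-- The linear form `(a, b) ↦ p a + q b` on `ℝ × ℝ`. -/
noncomputable def prodForm (p q : ℝ) : ℝ × ℝ →L[ℝ] ℝ :=
  p • ContinuousLinearMap.fst ℝ ℝ ℝ + q • ContinuousLinearMap.snd ℝ ℝ ℝ

@[simp]
theorem prodForm_apply (p q : ℝ) (z : ℝ × ℝ) : prodForm p q z = p * z.1 + q * z.2 := by
  simp [prodForm]

theorem hasFDerivAt_kerInt {j : ℕ} {s : ℝ} (hs : 0 ≤ s) {z : ℝ × ℝ} (hz : z ∈ kerDom) :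
    HasFDerivAt (kerInt j s)
      (prodForm (-s * kerInt j (s + 1) z) (-s * kerInt (j + 1) (s + 1) z)) z := by
  obtain ⟨hz1, hz2⟩ := hz
  obtain ⟨c, hc0, hc1, hc2⟩ : ∃ c : ℝ, 0 < c ∧ c < z.1 ∧ c < z.1 + z.2 := by
    refine ⟨min z.1 (z.1 + z.2) / 2, by positivity, ?_, ?_⟩
    · have := min_le_left z.1 (z.1 + z.2); linarith
    · have := min_le_right z.1 (z.1 + z.2); linarith
  have key : HasFDerivAt (fun z : ℝ × ℝ => ∫ t in (0 : ℝ)..1, t ^ j * (z.1 + t * z.2) ^ (-s))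
      (∫ t in (0 : ℝ)..1, prodForm (-s * (t ^ j * (z.1 + t * z.2) ^ (-(s + 1))))
        (-s * (t ^ (j + 1) * (z.1 + t * z.2) ^ (-(s + 1))))) z := by
    refine intervalIntegral.hasFDerivAt_integral_of_dominated_of_fderiv_le
      (s := {w : ℝ × ℝ | c < w.1} ∩ {w | c < w.1 + w.2})
      (F' := fun w t => prodForm (-s * (t ^ j * (w.1 + t * w.2) ^ (-(s + 1))))
        (-s * (t ^ (j + 1) * (w.1 + t * w.2) ^ (-(s + 1)))))
      (bound := fun _ => s * c ^ (-(s + 1)) + s * c ^ (-(s + 1))) ?_ ?_ ?_ ?_ ?_ ?_ ?_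
    · exact ((isOpen_lt continuous_const continuous_fst).inter
        (isOpen_lt continuous_const (continuous_fst.add continuous_snd))).mem_nhds ⟨hc1, hc2⟩
    · filter_upwards [isOpen_kerDom.mem_nhds ⟨hz1, hz2⟩] with w hw
      exact IntervalIntegrable.aestronglyMeasurable_restrict_uIoc (intervalIntegrable_kerInt_integrand hw)
    · exact intervalIntegrable_kerInt_integrand ⟨hz1, hz2⟩
    · have h1 := IntervalIntegrable.aestronglyMeasurable_restrict_uIoc
        (intervalIntegrable_kerInt_integrand (j := j) (s := s + 1) ⟨hz1, hz2⟩)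
      have h2 := IntervalIntegrable.aestronglyMeasurable_restrict_uIoc
        (intervalIntegrable_kerInt_integrand (j := j + 1) (s := s + 1) ⟨hz1, hz2⟩)
      exact ((h1.const_mul (-s)).smul_const _).add ((h2.const_mul (-s)).smul_const _)
    · refine Eventually.of_forall fun t ht w hw => ?_
      rw [uIoc_of_le zero_le_one] at ht
      have hlt := lt_add_mul_of_mem_Icc hw.1 hw.2 ⟨ht.1.le, ht.2⟩
      have hb : (w.1 + t * w.2) ^ (-(s + 1)) ≤ c ^ (-(s + 1)) :=
        Real.rpow_le_rpow_of_nonpos hc0 hlt.le (by linarith)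
      have hnn : 0 ≤ (w.1 + t * w.2) ^ (-(s + 1)) := Real.rpow_nonneg (hc0.trans hlt).le _
      have hk : ∀ k : ℕ, |-s * (t ^ k * (w.1 + t * w.2) ^ (-(s + 1)))| ≤ s * c ^ (-(s + 1)) := by
        intro k
        rw [abs_mul, abs_neg, abs_of_nonneg hs]
        refine mul_le_mul_of_nonneg_left ?_ hs
        rw [abs_of_nonneg (mul_nonneg (pow_nonneg ht.1.le _) hnn)]
        calc _ ≤ 1 * (w.1 + t * w.2) ^ (-(s + 1)) :=
              mul_le_mul_of_nonneg_right (pow_le_one₀ ht.1.le ht.2) hnn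
          _ ≤ _ := by rw [one_mul]; exact hb
      refine (norm_add_le _ _).trans (add_le_add ?_ ?_)
      · rw [norm_smul]
        calc _ ≤ _ * (1 : ℝ) := mul_le_mul_of_nonneg_left (ContinuousLinearMap.norm_fst_le ℝ ℝ ℝ)
              (norm_nonneg _)
          _ ≤ _ := by rw [mul_one]; exact hk j
      · rw [norm_smul]
        calc _ ≤ _ * (1 : ℝ) := mul_le_mul_of_nonneg_left (ContinuousLinearMap.norm_snd_le ℝ ℝ ℝ)
              (norm_nonneg _)
          _ ≤ _ := by rw [mul_one]; exact hk (j + 1)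
    · exact intervalIntegrable_const
    · refine Eventually.of_forall fun t ht w hw => ?_
      rw [uIoc_of_le zero_le_one] at ht
      have hlt := hc0.trans (lt_add_mul_of_mem_Icc hw.1 hw.2 ⟨ht.1.le, ht.2⟩)
      have h1 : HasFDerivAt (fun w : ℝ × ℝ => w.1 + t * w.2) (prodForm 1 t) w := by
        have := (hasFDerivAt_fst (𝕜 := ℝ) (p := w)).add
          ((hasFDerivAt_snd (𝕜 := ℝ) (p := w)).const_mul t)
        refine this.congr_fderiv ?_
        simp [prodForm]
      have h2 := (h1.rpow_const (p := -s) (Or.inl hlt.ne')).const_mul (t ^ j)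
      refine h2.congr_fderiv ?_
      rw [show -s - 1 = -(s + 1) by ring]
      ext <;> simp [prodForm] <;> ring
  refine key.congr_fderiv ?_
  have i1 := (intervalIntegrable_kerInt_integrand (j := j) (s := s + 1)
        ⟨hz1, hz2⟩)
  have i2 := (intervalIntegrable_kerInt_integrand (j := j + 1) (s := s + 1)
        ⟨hz1, hz2⟩)
  have hsc : ∀ (g : ℝ → ℝ) (c : ℝ × ℝ →L[ℝ] ℝ), IntervalIntegrable g volume 0 1 →
      IntervalIntegrable (fun t => g t • c) volume 0 1 := fun g c hg =>
    intervalIntegrable_iff.2 (Integrable.smul_const (intervalIntegrable_iff.1 hg) c)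
  unfold prodForm kerInt
  rw [intervalIntegral.integral_add
    (hsc _ (ContinuousLinearMap.fst ℝ ℝ ℝ) (i1.const_mul (-s)))
    (hsc _ (ContinuousLinearMap.snd ℝ ℝ ℝ) (i2.const_mul (-s))),
    intervalIntegral.integral_smul_const,
    intervalIntegral.integral_smul_const, intervalIntegral.integral_const_mul,
    intervalIntegral.integral_const_mul]

theorem contDiffOn_nat_kerInt (n : ℕ) (j : ℕ) {s : ℝ} (hs : 0 ≤ s) :
    ContDiffOn ℝ n (kerInt j s) kerDom := by
  induction n generalizing j s with
  | zero =>
    exact contDiffOn_zero.2 fun z hz => (hasFDerivAt_kerInt hs hz).continuousAt.continuousWithinAt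
  | succ n ih =>
    push_cast
    rw [contDiffOn_succ_iff_fderiv_of_isOpen isOpen_kerDom]
    refine ⟨fun z hz => (hasFDerivAt_kerInt hs hz).differentiableAt.differentiableWithinAt,
      by simp, ?_⟩
    have : ContDiffOn ℝ n (fun z => prodForm (-s * kerInt j (s + 1) z)
        (-s * kerInt (j + 1) (s + 1) z)) kerDom :=
      ((contDiffOn_const.mul (ih j (by linarith))).smul contDiffOn_const).add
        ((contDiffOn_const.mul (ih (j + 1) (by linarith))).smul contDiffOn_const)
    exact this.congr fun z hz => (hasFDerivAt_kerInt hs hz).fderiv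

theorem contDiffOn_kerInt (j : ℕ) {s : ℝ} (hs : 0 ≤ s) :
    ContDiffOn ℝ ∞ (kerInt j s) kerDom :=
  contDiffOn_infty.2 fun n => contDiffOn_nat_kerInt n j hs

theorem kerInt_nonneg {j : ℕ} {s : ℝ} {z : ℝ × ℝ} (hz : z ∈ kerDom) : 0 ≤ kerInt j s z := by
  refine intervalIntegral.integral_nonneg zero_le_one fun t ht => ?_
  exact mul_nonneg (pow_nonneg ht.1 _) (Real.rpow_nonneg (lt_add_mul_of_mem_Icc hz.1 hz.2 ht).le _)

theorem kerInt_euler {j : ℕ} {s : ℝ} {z : ℝ × ℝ} (hz : z ∈ kerDom) :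
    z.1 * kerInt j (s + 1) z + z.2 * kerInt (j + 1) (s + 1) z = kerInt j s z := by
  unfold kerInt
  rw [← intervalIntegral.integral_const_mul, ← intervalIntegral.integral_const_mul,
    ← intervalIntegral.integral_add
      ((intervalIntegrable_kerInt_integrand hz).const_mul _)
      ((intervalIntegrable_kerInt_integrand hz).const_mul _)]
  refine intervalIntegral.integral_congr fun t ht => ?_
  rw [uIcc_of_le zero_le_one] at ht
  have hpos := lt_add_mul_of_mem_Icc hz.1 hz.2 ht
  have : (z.1 + t * z.2) ^ (-s) = (z.1 + t * z.2) ^ (-(s + 1)) * (z.1 + t * z.2) := by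
    rw [← Real.rpow_add_one hpos.ne']; congr 1; ring
  simp only [this]
  ring

theorem kerInt_parts_aux {j : ℕ} {s : ℝ} {z : ℝ × ℝ} (hz : z ∈ kerDom) :
    (∫ t in (0 : ℝ)..1, (j * t ^ (j - 1)) * (z.1 + t * z.2) ^ (-s)) - s * z.2 * kerInt j (s + 1) z =
      (z.1 + z.2) ^ (-s) - 0 ^ j * z.1 ^ (-s) := by
  have hd : ∀ t ∈ uIcc (0 : ℝ) 1, HasDerivAt (fun t : ℝ => t ^ j * (z.1 + t * z.2) ^ (-s))
      ((j * t ^ (j - 1)) * (z.1 + t * z.2) ^ (-s) -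
        s * z.2 * (t ^ j * (z.1 + t * z.2) ^ (-(s + 1)))) t := by
    intro t ht
    rw [uIcc_of_le zero_le_one] at ht
    have hpos := lt_add_mul_of_mem_Icc hz.1 hz.2 ht
    have h1 : HasDerivAt (fun t : ℝ => z.1 + t * z.2) z.2 t := by
      simpa using ((hasDerivAt_id t).mul_const z.2).const_add z.1
    have h2 := (hasDerivAt_pow j t).mul (h1.rpow_const (p := -s) (Or.inl hpos.ne'))
    refine h2.congr_deriv ?_
    rw [show -s - 1 = -(s + 1) by ring]
    ring
  have hc : ContinuousOn (fun t : ℝ => (j * t ^ (j - 1)) * (z.1 + t * z.2) ^ (-s)) (Icc 0 1) := by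
    refine ContinuousOn.mul (by fun_prop) (ContinuousOn.rpow_const (by fun_prop) ?_)
    intro t ht
    exact Or.inl (lt_add_mul_of_mem_Icc hz.1 hz.2 ht).ne'
  have i1 : IntervalIntegrable (fun t : ℝ => (j * t ^ (j - 1)) * (z.1 + t * z.2) ^ (-s))
      volume 0 1 := ContinuousOn.intervalIntegrable_of_Icc zero_le_one hc
  have i2 := (intervalIntegrable_kerInt_integrand (j := j) (s := s + 1) hz).const_mul (s * z.2)
  have := intervalIntegral.integral_eq_sub_of_hasDerivAt hd (i1.sub i2)
  rw [intervalIntegral.integral_sub i1 i2, intervalIntegral.integral_const_mul] at this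
  simpa [kerInt] using this

theorem kerInt_parts_zero {s : ℝ} {z : ℝ × ℝ} (hz : z ∈ kerDom) :
    s * z.2 * kerInt 0 (s + 1) z = z.1 ^ (-s) - (z.1 + z.2) ^ (-s) := by
  have := kerInt_parts_aux (j := 0) (s := s) hz
  simp at this
  linarith

theorem kerInt_parts_succ {j : ℕ} {s : ℝ} {z : ℝ × ℝ} (hz : z ∈ kerDom) :
    s * z.2 * kerInt (j + 1) (s + 1) z = (j + 1) * kerInt j s z - (z.1 + z.2) ^ (-s) := by
  have := kerInt_parts_aux (j := j + 1) (s := s) hz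
  simp only [mul_assoc, intervalIntegral.integral_const_mul] at this
  simp at this
  unfold kerInt at *
  linarith

theorem kerInt_le_of_fst_le {j : ℕ} {s : ℝ} (hs : 0 ≤ s) {a a' b : ℝ} (ha : 0 < a) (haa : a ≤ a')
    (hb : 0 ≤ b) : kerInt j s (a', b) ≤ kerInt j s (a, b) := by
  refine intervalIntegral.integral_mono_on zero_le_one
    (intervalIntegrable_kerInt_integrand ⟨by simp; linarith, by simp; linarith⟩)
    (intervalIntegrable_kerInt_integrand ⟨by simp; linarith, by simp; linarith⟩) fun t ht => ?_
  refine mul_le_mul_of_nonneg_left ?_ (pow_nonneg ht.1 _)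
  have := mul_nonneg ht.1 hb
  exact Real.rpow_le_rpow_of_nonpos (by simp; linarith) (by simp; linarith) (by linarith)

theorem mul_kerInt_succ_le {j : ℕ} {s : ℝ} {a b d : ℝ} (ha : 0 < a) (hb : 0 ≤ b) (hda : d ≤ a) :
    d * kerInt j (s + 1) (a, b) ≤ kerInt j s (a, b) := by
  have hz : (a, b) ∈ kerDom := ⟨ha, by simp; linarith⟩
  have h1 := kerInt_euler (j := j) (s := s) hz
  have h2 := kerInt_nonneg (j := j) (s := s + 1) hz
  have h3 := kerInt_nonneg (j := j + 1) (s := s + 1) hz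
  simp only at h1
  nlinarith [mul_nonneg hb h3, mul_nonneg (sub_nonneg.2 hda) h2]

theorem mul_kerInt_succ_succ_le {j : ℕ} {s : ℝ} {a b : ℝ} (ha : 0 < a) (hb : 0 ≤ b) :
    b * kerInt (j + 1) (s + 1) (a, b) ≤ kerInt j s (a, b) := by
  have hz : (a, b) ∈ kerDom := ⟨ha, by simp; linarith⟩
  have h1 := kerInt_euler (j := j) (s := s) hz
  have h2 := kerInt_nonneg (j := j) (s := s + 1) hz
  simp only at h1
  nlinarith [mul_nonneg ha.le h2]

theorem kerInt_le_rpow {j : ℕ} {s : ℝ} (hs : 1 / 2 ≤ s) {a b : ℝ} (ha : 0 < a) (hb : 0 < b) :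
    kerInt j s (a, b) ≤ 2 * a ^ (1 / 2 - s) * b ^ (-(1 / 2) : ℝ) := by
  have hz : (a, b) ∈ kerDom := ⟨ha, by simp; linarith⟩
  have hi : IntervalIntegrable (fun t : ℝ => t ^ (-(1 / 2) : ℝ)) volume 0 1 :=
    intervalIntegral.intervalIntegrable_rpow' (by norm_num)
  have hv : ∫ t in (0 : ℝ)..1, t ^ (-(1 / 2) : ℝ) = 2 := by
    rw [integral_rpow (Or.inl (by norm_num))]; norm_num
  calc kerInt j s (a, b) ≤
      ∫ t in (0 : ℝ)..1, a ^ (1 / 2 - s) * b ^ (-(1 / 2) : ℝ) * t ^ (-(1 / 2) : ℝ) := by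
        refine intervalIntegral.integral_mono_on_of_le_Ioo zero_le_one
          (intervalIntegrable_kerInt_integrand hz) (hi.const_mul _) fun t ht => ?_
        have htb := mul_pos ht.1 hb
        have h1 : (a + t * b) ^ (-s) = (a + t * b) ^ (1 / 2 - s) * (a + t * b) ^ (-(1 / 2) : ℝ) := by
          rw [← Real.rpow_add (by linarith)]; congr 1; ring
        have h2 : (a + t * b) ^ (1 / 2 - s) ≤ a ^ (1 / 2 - s) :=
          Real.rpow_le_rpow_of_nonpos ha (by linarith) (by linarith)
        have h3 : (a + t * b) ^ (-(1 / 2) : ℝ) ≤ (t * b) ^ (-(1 / 2) : ℝ) :=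
          Real.rpow_le_rpow_of_nonpos htb (by linarith) (by norm_num)
        calc t ^ j * (a + t * b) ^ (-s) ≤ 1 * (a + t * b) ^ (-s) :=
              mul_le_mul_of_nonneg_right (pow_le_one₀ ht.1.le ht.2.le)
                (Real.rpow_nonneg (by linarith) _)
          _ ≤ a ^ (1 / 2 - s) * (t * b) ^ (-(1 / 2) : ℝ) := by
            rw [one_mul, h1]
            exact mul_le_mul h2 h3 (Real.rpow_nonneg (by linarith) _) (Real.rpow_nonneg ha.le _)
          _ = _ := by rw [Real.mul_rpow ht.1.le hb.le]; ring
    _ = _ := by rw [intervalIntegral.integral_const_mul, hv]; ring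

end KernelIntegral

theorem inner_coordVec {N : ℕ} (x : EuclideanSpace ℝ (Fin N)) (i : Fin N) :
    inner ℝ x (coordVec i) = x i := by
  simp [coordVec, EuclideanSpace.inner_single_right]

theorem norm_coordVec {N : ℕ} (i : Fin N) : ‖coordVec i‖ = 1 := by
  simp [coordVec]

theorem norm_sub_smul_coordVec_sq {N : ℕ} (w : EuclideanSpace ℝ (Fin N)) (t : ℝ) (i : Fin N) :
    ‖w - t • coordVec i‖ ^ 2 = ‖w‖ ^ 2 - 2 * t * w i + t ^ 2 := by
  rw [norm_sub_sq_real, inner_smul_right, inner_coordVec, norm_smul, norm_coordVec, mul_one,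
    Real.norm_eq_abs, sq_abs]
  ring

section HalfSpaceVariables

variable {N : ℕ} [NeZero N]

/-- The pair `(|x - y|² + d, 4 x₁ y₁)`. -/
noncomputable def zmap (x : EuclideanSpace ℝ (Fin N)) (d : ℝ) (y : EuclideanSpace ℝ (Fin N)) :
    ℝ × ℝ := (‖x - y‖ ^ 2 + d, 4 * x 0 * y 0)

/-- The reflection of `x` in the hyperplane `x₁ = 0`. -/
noncomputable def refl0 (x : EuclideanSpace ℝ (Fin N)) : EuclideanSpace ℝ (Fin N) :=
  x - (2 * x 0) • coordVec 0

theorem norm_refl0_sub_sq (x y : EuclideanSpace ℝ (Fin N)) :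
    ‖refl0 x - y‖ ^ 2 = ‖x - y‖ ^ 2 + 4 * x 0 * y 0 := by
  have : refl0 x - y = (x - y) - (2 * x 0) • coordVec 0 := by
    unfold refl0; abel
  rw [this, norm_sub_smul_coordVec_sq]
  simp
  ring

theorem refl0_apply_zero (x : EuclideanSpace ℝ (Fin N)) : refl0 x 0 = - x 0 := by
  simp [refl0, coordVec]; ring

theorem zmap_fst_add_snd (x y : EuclideanSpace ℝ (Fin N)) (d : ℝ) :
    (zmap x d y).1 + (zmap x d y).2 = ‖refl0 x - y‖ ^ 2 + d := by
  rw [norm_refl0_sub_sq]; simp [zmap]; ring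

theorem zmap_mem_kerDom_of_pos (x y : EuclideanSpace ℝ (Fin N)) {d : ℝ} (hd : 0 < d) :
    zmap x d y ∈ kerDom := by
  refine ⟨?_, ?_⟩
  · simp only [zmap]; positivity
  · rw [zmap_fst_add_snd]; positivity

theorem zmap_mem_kerDom_of_ne {x y : EuclideanSpace ℝ (Fin N)} {d : ℝ} (hd : 0 ≤ d) (h1 : y ≠ x)
    (h2 : y ≠ refl0 x) : zmap x d y ∈ kerDom := by
  have e1 : 0 < ‖x - y‖ := norm_pos_iff.2 (sub_ne_zero.2 h1.symm)
  have e2 : 0 < ‖refl0 x - y‖ := norm_pos_iff.2 (sub_ne_zero.2 h2.symm)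
  refine ⟨?_, ?_⟩
  · simp only [zmap]; positivity
  · rw [zmap_fst_add_snd]; positivity

theorem ne_refl0 {x y : EuclideanSpace ℝ (Fin N)} (hx : 0 < x 0) (hy : 0 ≤ y 0) :
    y ≠ refl0 x := by
  rintro rfl
  rw [refl0_apply_zero] at hy
  linarith

theorem contDiff_zmap (x : EuclideanSpace ℝ (Fin N)) (d : ℝ) {n : WithTop ℕ∞} :
    ContDiff ℝ n (zmap x d) := by
  have h1 : ContDiff ℝ n fun y : EuclideanSpace ℝ (Fin N) => ‖x - y‖ ^ 2 :=
    (contDiff_const.sub contDiff_id).norm_sq ℝ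
  have h2 : ContDiff ℝ n fun y : EuclideanSpace ℝ (Fin N) => y 0 := by fun_prop
  exact (h1.add contDiff_const).prodMk (contDiff_const.mul h2)

theorem hasDerivAt_zmap_line (x y : EuclideanSpace ℝ (Fin N)) (d : ℝ) (i : Fin N) (t : ℝ) :
    HasDerivAt (fun t : ℝ => zmap x d (y + t • coordVec i))
      (2 * (y i - x i) + 2 * t, 4 * x 0 * (coordVec i : EuclideanSpace ℝ (Fin N)) 0) t := by
  have e1 : ∀ t : ℝ, zmap x d (y + t • coordVec i) =
      (‖x - y‖ ^ 2 - 2 * t * (x i - y i) + t ^ 2 + d,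
        4 * x 0 * (y 0 + t * (coordVec i : EuclideanSpace ℝ (Fin N)) 0)) := by
    intro t
    have : x - (y + t • coordVec i) = (x - y) - t • coordVec i := by abel
    simp [zmap, this, norm_sub_smul_coordVec_sq]
  simp_rw [e1]
  refine HasDerivAt.prodMk ?_ ?_
  · have h1 : HasDerivAt (fun t : ℝ => 2 * t * (x i - y i)) (2 * (x i - y i)) t := by
      simpa using ((hasDerivAt_id t).const_mul 2).mul_const (x i - y i)
    have h2 := (((h1.const_sub (‖x - y‖ ^ 2)).add (hasDerivAt_pow 2 t)).add_const d)
    refine h2.congr_deriv ?_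
    simp; ring
  · have h1 : HasDerivAt (fun t : ℝ => t * (coordVec i : EuclideanSpace ℝ (Fin N)) 0)
        ((coordVec i : EuclideanSpace ℝ (Fin N)) 0) t := by
      simpa using (hasDerivAt_id t).mul_const ((coordVec i : EuclideanSpace ℝ (Fin N)) 0)
    exact (h1.const_add (y 0)).const_mul (4 * x 0)

theorem lap_comp_zmap {Ψ Ψa Ψb : ℝ × ℝ → ℝ} {D : Set (ℝ × ℝ)} (hD : IsOpen D)
    (hΨ : ∀ z ∈ D, HasFDerivAt Ψ (prodForm (Ψa z) (Ψb z)) z) {x y : EuclideanSpace ℝ (Fin N)}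
    {d : ℝ} (hy : zmap x d y ∈ D) {Aaa Aab Aba Abb : ℝ}
    (hΨa : HasFDerivAt Ψa (prodForm Aaa Aab) (zmap x d y))
    (hΨb : HasFDerivAt Ψb (prodForm Aba Abb) (zmap x d y)) :
    lap (fun y => Ψ (zmap x d y)) y = 4 * ‖x - y‖ ^ 2 * Aaa + 2 * N * Ψa (zmap x d y) +
      8 * x 0 * (y 0 - x 0) * (Aab + Aba) + 16 * x 0 ^ 2 * Abb := by
  have hterm : ∀ i : Fin N,
      iteratedDeriv 2 (fun t : ℝ => Ψ (zmap x d (y + t • coordVec i))) 0 =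
      (Aaa * (2 * (y i - x i)) +
        Aab * (4 * x 0 * (coordVec i : EuclideanSpace ℝ (Fin N)) 0)) * (2 * (y i - x i))
        + 2 * Ψa (zmap x d y) + (Aba * (2 * (y i - x i)) +
        Abb * (4 * x 0 * (coordVec i : EuclideanSpace ℝ (Fin N)) 0)) *
          (4 * x 0 * (coordVec i : EuclideanSpace ℝ (Fin N)) 0) := by
    intro i
    set c : ℝ := 4 * x 0 * (coordVec i : EuclideanSpace ℝ (Fin N)) 0 with hc
    have hcont : ContinuousAt (fun t : ℝ => zmap x d (y + t • coordVec i)) 0 :=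
      (hasDerivAt_zmap_line x y d i 0).continuousAt
    have hmem : ∀ᶠ t : ℝ in 𝓝 0, zmap x d (y + t • coordVec i) ∈ D :=
      hcont.eventually_mem (hD.mem_nhds (by simpa using hy))
    have hd1 : deriv (fun t : ℝ => Ψ (zmap x d (y + t • coordVec i))) =ᶠ[𝓝 0] fun t =>
        Ψa (zmap x d (y + t • coordVec i)) * (2 * (y i - x i) + 2 * t) +
          Ψb (zmap x d (y + t • coordVec i)) * c := by
      filter_upwards [hmem] with t ht
      have := (hΨ _ ht).comp_hasDerivAt t (hasDerivAt_zmap_line x y d i t)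
      rw [prodForm_apply] at this
      exact this.deriv
    rw [iteratedDeriv_succ, iteratedDeriv_one, hd1.deriv_eq]
    have e0 : zmap x d (y + (0 : ℝ) • coordVec i) = zmap x d y := by simp
    have ha : HasDerivAt (fun t : ℝ => Ψa (zmap x d (y + t • coordVec i)))
        (Aaa * (2 * (y i - x i)) + Aab * c) 0 := by
      have := HasFDerivAt.comp_hasDerivAt (0 : ℝ) (l := Ψa) (by rw [e0]; exact hΨa)
        (hasDerivAt_zmap_line x y d i 0)
      refine this.congr_deriv ?_
      simp [hc]
    have hb : HasDerivAt (fun t : ℝ => Ψb (zmap x d (y + t • coordVec i)))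
        (Aba * (2 * (y i - x i)) + Abb * c) 0 := by
      have := HasFDerivAt.comp_hasDerivAt (0 : ℝ) (l := Ψb) (by rw [e0]; exact hΨb)
        (hasDerivAt_zmap_line x y d i 0)
      refine this.congr_deriv ?_
      simp [hc]
    have hl : HasDerivAt (fun t : ℝ => 2 * (y i - x i) + 2 * t) 2 0 := by
      simpa using ((hasDerivAt_id (0 : ℝ)).const_mul 2).const_add (2 * (y i - x i))
    refine ((ha.mul hl).add (hb.mul_const c)).deriv.trans ?_
    simp
    ring
  unfold lap
  simp_rw [hterm]
  have hsq : ‖x - y‖ ^ 2 = ∑ i, (y i - x i) ^ 2 := by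
    rw [EuclideanSpace.real_norm_sq_eq]
    refine Finset.sum_congr rfl fun i _ => ?_
    simp; ring
  have hsplit : ∀ i : Fin N, (Aaa * (2 * (y i - x i)) +
        Aab * (4 * x 0 * (coordVec i : EuclideanSpace ℝ (Fin N)) 0)) * (2 * (y i - x i))
        + 2 * Ψa (zmap x d y) + (Aba * (2 * (y i - x i)) +
        Abb * (4 * x 0 * (coordVec i : EuclideanSpace ℝ (Fin N)) 0)) *
          (4 * x 0 * (coordVec i : EuclideanSpace ℝ (Fin N)) 0) =
      4 * Aaa * (y i - x i) ^ 2 + 2 * Ψa (zmap x d y) +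
        (if i = 0 then 8 * x 0 * (y i - x i) * (Aab + Aba) + 16 * x 0 ^ 2 * Abb else 0) := by
    intro i
    by_cases hi : i = 0
    · subst hi; simp [coordVec]; ring
    · simp [coordVec, hi, Ne.symm hi]; ring
  simp_rw [hsplit]
  rw [Finset.sum_add_distrib, Finset.sum_add_distrib, ← Finset.mul_sum, ← hsq,
    Finset.sum_ite_eq' Finset.univ (0 : Fin N)]
  simp
  ring

end HalfSpaceVariables

section GreenProfile

/-- The function `b^(n+1) ∫₀¹ t^n (a + t b)^(-s) dt` of `z = (a, b)`. -/
noncomputable def greenProf (n : ℕ) (s : ℝ) (z : ℝ × ℝ) : ℝ := z.2 ^ (n + 1) * kerInt n s z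

theorem hasFDerivAt_add_rpow {s : ℝ} {z : ℝ × ℝ} (hz : z ∈ kerDom) :
    HasFDerivAt (fun z : ℝ × ℝ => (z.1 + z.2) ^ (-s))
      (prodForm (-s * (z.1 + z.2) ^ (-(s + 1))) (-s * (z.1 + z.2) ^ (-(s + 1)))) z := by
  have h1 : HasFDerivAt (fun z : ℝ × ℝ => z.1 + z.2)
      (ContinuousLinearMap.fst ℝ ℝ ℝ + ContinuousLinearMap.snd ℝ ℝ ℝ) z :=
    hasFDerivAt_fst.add hasFDerivAt_snd
  refine (h1.rpow_const (p := -s) (Or.inl hz.2.ne')).congr_fderiv ?_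
  have : -s - 1 = -(s + 1) := by ring
  ext <;> simp [prodForm, this]

theorem hasFDerivAt_greenProf {n : ℕ} {s : ℝ} (hs : 0 ≤ s) {z : ℝ × ℝ} (hz : z ∈ kerDom) :
    HasFDerivAt (greenProf n s)
      (prodForm (-s * greenProf n (s + 1) z) (z.2 ^ n * (z.1 + z.2) ^ (-s))) z := by
  have h1 : HasFDerivAt (fun z : ℝ × ℝ => z.2 ^ (n + 1))
      (prodForm 0 ((n + 1) * z.2 ^ n)) z := by
    refine (hasFDerivAt_snd.pow (n + 1)).congr_fderiv ?_
    ext <;> simp [prodForm]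
  refine (h1.mul (hasFDerivAt_kerInt hs hz)).congr_fderiv ?_
  have h2 := kerInt_parts_succ (j := n) (s := s) hz
  ext
  · simp [prodForm, greenProf]; ring
  · simp only [prodForm, greenProf]
    simp
    linear_combination (-z.2 ^ n) * h2

theorem contDiffOn_greenProf (n : ℕ) {s : ℝ} (hs : 0 ≤ s) :
    ContDiffOn ℝ ∞ (greenProf n s) kerDom :=
  (contDiff_snd.pow _).contDiffOn.mul (contDiffOn_kerInt n hs)

theorem greenProf_euler {n : ℕ} {s : ℝ} {z : ℝ × ℝ} (hz : z ∈ kerDom) :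
    z.1 * (-s * greenProf n (s + 1) z) + z.2 * (z.2 ^ n * (z.1 + z.2) ^ (-s)) =
      (n + 1 - s) * greenProf n s z := by
  have h1 := kerInt_euler (j := n) (s := s) hz
  have h2 := kerInt_parts_succ (j := n) (s := s) hz
  unfold greenProf
  linear_combination (-s * z.2 ^ (n + 1)) * h1 + z.2 ^ (n + 1) * h2

theorem mul_greenProf_zero {s : ℝ} {z : ℝ × ℝ} (hz : z ∈ kerDom) :
    s * greenProf 0 (s + 1) z = z.1 ^ (-s) - (z.1 + z.2) ^ (-s) := by
  rw [← kerInt_parts_zero hz]; simp [greenProf]; ring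

theorem mul_greenProf_succ {n : ℕ} {s : ℝ} {z : ℝ × ℝ} (hz : z ∈ kerDom) :
    s * greenProf (n + 1) (s + 1) z =
      (n + 1) * greenProf n s z - z.2 ^ (n + 1) * (z.1 + z.2) ^ (-s) := by
  have := kerInt_parts_succ (j := n) (s := s) hz
  unfold greenProf
  linear_combination (z.2 ^ (n + 1)) * this

variable {N : ℕ} [NeZero N]

theorem lap_greenProf_zmap (n : ℕ) {x y : EuclideanSpace ℝ (Fin N)} {d : ℝ}
    (hz : zmap x d y ∈ kerDom) :
    lap (fun y => greenProf n (N / 2) (zmap x d y)) y =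
      4 * n * (-(N / 2 : ℝ) * greenProf n (N / 2 + 1) (zmap x d y)) +
      16 * x 0 ^ 2 * (n * (zmap x d y).2 ^ (n - 1) *
        ((zmap x d y).1 + (zmap x d y).2) ^ (-(N / 2 : ℝ))) -
      4 * d * ((N / 2 : ℝ) * (N / 2 + 1) * greenProf n (N / 2 + 2) (zmap x d y)) := by
  obtain ⟨s, hs⟩ : ∃ s : ℝ, s = N / 2 := ⟨_, rfl⟩
  have hN : (N : ℝ) = 2 * s := by rw [hs]; ring
  rw [← hs]
  have hs0 : 0 ≤ s := by rw [hs]; positivity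
  set z := zmap x d y with hzdef
  have ha : HasFDerivAt (fun z => -s * greenProf n (s + 1) z)
      (prodForm (-s * (-(s + 1) * greenProf n (s + 1 + 1) z))
        (-s * (z.2 ^ n * (z.1 + z.2) ^ (-(s + 1))))) z := by
    refine ((hasFDerivAt_greenProf (n := n) (by linarith : 0 ≤ s + 1) hz).const_mul (-s)).congr_fderiv
      ?_
    ext <;> simp [prodForm]
  have hb : HasFDerivAt (fun z : ℝ × ℝ => z.2 ^ n * (z.1 + z.2) ^ (-s))
      (prodForm (z.2 ^ n * (-s * (z.1 + z.2) ^ (-(s + 1))))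
        (n * z.2 ^ (n - 1) * (z.1 + z.2) ^ (-s) +
          z.2 ^ n * (-s * (z.1 + z.2) ^ (-(s + 1))))) z := by
    refine ((hasFDerivAt_snd.pow n).mul (hasFDerivAt_add_rpow hz)).congr_fderiv ?_
    ext
    · simp [prodForm]
    · simp [prodForm]; ring
  rw [lap_comp_zmap isOpen_kerDom (fun z hz => hasFDerivAt_greenProf hs0 hz) hz ha hb, hN]
  have he := greenProf_euler (n := n) (s := s + 1) hz
  have e1 : ‖x - y‖ ^ 2 = z.1 - d := by simp [hzdef, zmap]
  have e2 : z.2 = 4 * x 0 * y 0 := rfl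
  have e3 : s + 1 + 1 = s + 2 := by ring
  rw [e1, ← hzdef]
  rw [e3] at he ⊢
  linear_combination (-4 * s) * he + (-4 * s * z.2 ^ n * (z.1 + z.2) ^ (-(s + 1))) * (-e2)

theorem lap_greenProf_zmap_succ (n : ℕ) {x y : EuclideanSpace ℝ (Fin N)} {d : ℝ}
    (hz : zmap x d y ∈ kerDom) :
    lap (fun y => greenProf (n + 1) (N / 2) (zmap x d y)) y =
      -4 * (n + 1) ^ 2 * greenProf n (N / 2) (zmap x d y) +
      4 * (n + 1) * ((zmap x d y).2 ^ n * (((zmap x d y).2 + 4 * x 0 ^ 2) *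
        ((zmap x d y).1 + (zmap x d y).2) ^ (-(N / 2 : ℝ)))) -
      4 * d * ((N / 2 : ℝ) * (N / 2 + 1) * greenProf (n + 1) (N / 2 + 2) (zmap x d y)) := by
  rw [lap_greenProf_zmap (n + 1) hz]
  have h := mul_greenProf_succ (n := n) (s := N / 2) hz
  push_cast
  linear_combination (-4 * (n + 1 : ℝ)) * h

theorem lap_greenProf_zmap_zero {x y : EuclideanSpace ℝ (Fin N)} {d : ℝ}
    (hz : zmap x d y ∈ kerDom) :
    lap (fun y => greenProf 0 (N / 2) (zmap x d y)) y =
      -(4 * (N / 2 : ℝ) * d * ((zmap x d y).1 ^ (-(N / 2 + 1 : ℝ)) -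
        ((zmap x d y).1 + (zmap x d y).2) ^ (-(N / 2 + 1 : ℝ)))) := by
  rw [lap_greenProf_zmap 0 hz]
  have h := mul_greenProf_zero (s := N / 2 + 1) hz
  rw [show (N / 2 + 1 + 1 : ℝ) = N / 2 + 2 by ring] at h
  push_cast
  linear_combination (-4 * d * (N / 2 : ℝ)) * h

/-- The function `(p + 4 x₁²) |x* - y|^(-N)` with `p = 4 x₁ y₁`, harmonic off the reflected
point. -/
noncomputable def reflPoisson (x y : EuclideanSpace ℝ (Fin N)) : ℝ :=
  (4 * x 0 * y 0 + 4 * x 0 ^ 2) * (‖refl0 x - y‖ ^ 2) ^ (-(N / 2 : ℝ))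

theorem contDiffOn_reflPoisson (x : EuclideanSpace ℝ (Fin N)) :
    ContDiffOn ℝ ∞ (reflPoisson x) {refl0 x}ᶜ := by
  have h2 : ContDiff ℝ ∞ fun y : EuclideanSpace ℝ (Fin N) => y 0 := by fun_prop
  have h1 : ContDiff ℝ ∞ fun y : EuclideanSpace ℝ (Fin N) => ‖refl0 x - y‖ ^ 2 :=
    (contDiff_const.sub contDiff_id).norm_sq ℝ
  refine ContDiffOn.mul ((contDiff_const.mul h2).add contDiff_const).contDiffOn ?_
  refine h1.contDiffOn.rpow_const_of_ne fun y hy => ?_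
  have : 0 < ‖refl0 x - y‖ := norm_pos_iff.2 (sub_ne_zero.2 (Ne.symm hy))
  positivity

theorem lap_reflPoisson {x y : EuclideanSpace ℝ (Fin N)} (hy : y ≠ refl0 x) :
    lap (reflPoisson x) y = 0 := by
  obtain ⟨s, hs⟩ : ∃ s : ℝ, s = N / 2 := ⟨_, rfl⟩
  have hN : (N : ℝ) = 2 * s := by rw [hs]; ring
  set c : ℝ := 4 * x 0 ^ 2 with hc
  let D : Set (ℝ × ℝ) := {z | 0 < z.1 + z.2}
  have hD : IsOpen D := isOpen_lt continuous_const (continuous_fst.add continuous_snd)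
  have hfun : reflPoisson x = fun y => (fun z : ℝ × ℝ => (z.2 + c) * (z.1 + z.2) ^ (-s))
      (zmap x 0 y) := by
    funext y
    rw [reflPoisson, ← hs]
    simp only [zmap_fst_add_snd, add_zero]
    rfl
  have hw : ∀ (r : ℝ) {z : ℝ × ℝ}, z ∈ D → HasFDerivAt (fun z : ℝ × ℝ => (z.1 + z.2) ^ (-r))
      (prodForm (-r * (z.1 + z.2) ^ (-(r + 1))) (-r * (z.1 + z.2) ^ (-(r + 1)))) z := by
    intro r z hz
    have h1 : HasFDerivAt (fun z : ℝ × ℝ => z.1 + z.2)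
        (ContinuousLinearMap.fst ℝ ℝ ℝ + ContinuousLinearMap.snd ℝ ℝ ℝ) z :=
      hasFDerivAt_fst.add hasFDerivAt_snd
    refine (h1.rpow_const (p := -r) (Or.inl (ne_of_gt hz))).congr_fderiv ?_
    have : -r - 1 = -(r + 1) := by ring
    ext <;> simp [prodForm, this]
  have hbc : ∀ (r : ℝ) {z : ℝ × ℝ}, z ∈ D →
      HasFDerivAt (fun z : ℝ × ℝ => (z.2 + c) * (z.1 + z.2) ^ (-r))
      (prodForm (-r * ((z.2 + c) * (z.1 + z.2) ^ (-(r + 1))))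
        ((z.1 + z.2) ^ (-r) + -r * ((z.2 + c) * (z.1 + z.2) ^ (-(r + 1))))) z := by
    intro r z hz
    have h1 : HasFDerivAt (fun z : ℝ × ℝ => z.2 + c) (ContinuousLinearMap.snd ℝ ℝ ℝ) z :=
      hasFDerivAt_snd.add_const c
    refine (h1.mul (hw r hz)).congr_fderiv ?_
    ext
    · simp [prodForm]; ring
    · simp [prodForm]; ring
  have hzy : zmap x 0 y ∈ D := by
    change 0 < (zmap x 0 y).1 + (zmap x 0 y).2
    rw [zmap_fst_add_snd]
    have : 0 < ‖refl0 x - y‖ := norm_pos_iff.2 (sub_ne_zero.2 (Ne.symm hy))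
    positivity
  set z := zmap x 0 y with hz
  have ha := (hbc (s + 1) hzy).const_mul (-s)
  have hb := (hw s hzy).add ha
  have h2 : ∀ p q : ℝ, -s • prodForm p q = prodForm (-s * p) (-s * q) := by
    intro p q; ext <;> simp [prodForm]
  have h3 : ∀ p q p' q' : ℝ, prodForm p q + prodForm p' q' = prodForm (p + p') (q + q') := by
    intro p q p' q'; ext <;> simp [prodForm]
  have ha' := ha.congr_fderiv (h2 _ _)
  have hb' := (hw s hzy).add ha'
  have hb'' := hb'.congr_fderiv (h3 _ _ _ _)
  rw [hfun, lap_comp_zmap hD (fun z hz => hbc s hz) hzy ha' hb'', hN]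
  have e1 : ‖x - y‖ ^ 2 = z.1 := by simp [hz, zmap]
  have e2 : z.2 = 4 * x 0 * y 0 := rfl
  have e4 : (z.1 + z.2) ^ (-(s + 1)) = (z.1 + z.2) ^ (-(s + 1 + 1)) * (z.1 + z.2) := by
    rw [← Real.rpow_add_one (ne_of_gt hzy)]
    congr 1; ring
  rw [e1, ← hz, e4]
  have e5 : 16 * x 0 ^ 2 = 4 * c := by rw [hc]; ring
  have e6 : 8 * x 0 * (y 0 - x 0) = 2 * z.2 - 2 * c := by rw [hc, e2]; ring
  rw [e5, e6]
  ring

end GreenProfile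

theorem natCast_le_infty (n : ℕ) : (n : WithTop ℕ∞) ≤ ∞ := by
  exact_mod_cast (le_top : (n : ℕ∞) ≤ ⊤)

theorem dirDeriv_comm {E : Type*} [NormedAddCommGroup E] [NormedSpace ℝ E] {v w : E} {f : E → ℝ}
    {x : E} (hf : ContDiffAt ℝ 2 f x) :
    dirDeriv v (dirDeriv w f) x = dirDeriv w (dirDeriv v f) x := by
  have hd : DifferentiableAt ℝ (fderiv ℝ f) x :=
    (hf.fderiv_right (m := 1) (by norm_num)).differentiableAt (by norm_num)
  have h : ∀ v w : E, dirDeriv v (dirDeriv w f) x = fderiv ℝ (fderiv ℝ f) x v w := by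
    intro v w
    have : HasFDerivAt (dirDeriv w f) _ x := hd.hasFDerivAt.clm_apply (hasFDerivAt_const w x)
    rw [dirDeriv, this.fderiv]
    simp
  rw [h, h]
  exact hf.isSymmSndFDerivAt (by simp) v w

section HarmonicPolynomial

variable {N : ℕ} {U : Set (EuclideanSpace ℝ (Fin N))}

theorem lap_dirDeriv {f : EuclideanSpace ℝ (Fin N) → ℝ} (hU : IsOpen U) (hf : ContDiffOn ℝ ∞ f U)
    (v : EuclideanSpace ℝ (Fin N)) : EqOn (lap (dirDeriv v f)) (dirDeriv v (lap f)) U := by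
  intro x hx
  have hsm : ∀ {g : EuclideanSpace ℝ (Fin N) → ℝ} {y}, ContDiffOn ℝ ∞ g U → y ∈ U →
      ContDiffAt ℝ 2 g y := fun hg hy => (hg.contDiffAt (hU.mem_nhds hy)).of_le (natCast_le_infty 2)
  have hD : ∀ {g : EuclideanSpace ℝ (Fin N) → ℝ} (v), ContDiffOn ℝ ∞ g U →
      ContDiffOn ℝ ∞ (dirDeriv v g) U := fun v hg => hg.dirDeriv hU (by rfl)
  rw [lap_eq_sum (hsm (hD v hf) hx)]
  have hE : EqOn (lap f) (fun y => ∑ i, dirDeriv (coordVec i) (dirDeriv (coordVec i) f) y) U :=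
    fun y hy => lap_eq_sum (hsm hf hy)
  rw [dirDeriv_congr hU hE hx]
  have : dirDeriv v (fun y => ∑ i, dirDeriv (coordVec i) (dirDeriv (coordVec i) f) y) x =
      ∑ i, dirDeriv v (dirDeriv (coordVec i) (dirDeriv (coordVec i) f)) x := by
    rw [dirDeriv, fderiv_fun_sum fun i _ => ((hsm (hD _ (hD _ hf)) hx).differentiableAt (by norm_num))]
    simp [dirDeriv]
  rw [this]
  refine Finset.sum_congr rfl fun i _ => ?_
  have hc : EqOn (dirDeriv (coordVec i) (dirDeriv v f)) (dirDeriv v (dirDeriv (coordVec i) f)) U :=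
    fun y hy => dirDeriv_comm (hsm hf hy)
  exact (dirDeriv_congr hU hc hx).trans (dirDeriv_comm (hsm (hD _ hf) hx))

variable [NeZero N]

theorem dirDeriv_coord_pow (i : Fin N) (j : ℕ) (y : EuclideanSpace ℝ (Fin N)) :
    dirDeriv (coordVec i) (fun y : EuclideanSpace ℝ (Fin N) => y 0 ^ j) y =
      if i = 0 then j * y 0 ^ (j - 1) else 0 := by
  have h1 : HasFDerivAt (fun y : EuclideanSpace ℝ (Fin N) => y 0)
      (EuclideanSpace.proj (𝕜 := ℝ) (0 : Fin N)) y :=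
    (EuclideanSpace.proj (𝕜 := ℝ) (0 : Fin N)).hasFDerivAt
  rw [dirDeriv, (h1.pow j).fderiv]
  by_cases hi : i = 0
  · subst hi; simp [coordVec]
  · simp [coordVec, hi, Ne.symm hi]

theorem contDiff_coord_pow (j : ℕ) {n : WithTop ℕ∞} :
    ContDiff ℝ n (fun y : EuclideanSpace ℝ (Fin N) => y 0 ^ j) := by fun_prop

theorem lap_coord_pow (j : ℕ) (y : EuclideanSpace ℝ (Fin N)) :
    lap (fun y : EuclideanSpace ℝ (Fin N) => y 0 ^ j) y = j * (j - 1) * y 0 ^ (j - 2) := by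
  rw [lap_eq_sum (contDiff_coord_pow j).contDiffAt]
  have : ∀ i : Fin N, dirDeriv (coordVec i)
      (dirDeriv (coordVec i) fun y : EuclideanSpace ℝ (Fin N) => y 0 ^ j) y =
      if i = 0 then j * (j - 1) * y 0 ^ (j - 2) else 0 := by
    intro i
    rw [funext (dirDeriv_coord_pow i j)]
    by_cases hi : i = 0
    · simp only [if_pos hi]
      rw [dirDeriv_const_mul, dirDeriv_coord_pow i (j - 1), if_pos hi]
      rcases j with _ | j
      · simp
      · rw [Nat.add_sub_cancel, show j + 1 - 2 = j - 1 by omega]; push_cast; ring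
    · simp [hi, dirDeriv]
  simp_rw [this]
  rw [Finset.sum_ite_eq' Finset.univ (0 : Fin N)]
  simp

theorem lap_coord_pow_mul {h : EuclideanSpace ℝ (Fin N) → ℝ} (hU : IsOpen U)
    (hh : ContDiffOn ℝ ∞ h U) (j : ℕ) {y} (hy : y ∈ U) :
    lap (fun y => y 0 ^ j * h y) y = j * (j - 1) * (y 0 ^ (j - 2) * h y) + y 0 ^ j * lap h y +
      2 * j * (y 0 ^ (j - 1) * dirDeriv (coordVec 0) h y) := by
  have h2 : ContDiffAt ℝ 2 h y := (hh.contDiffAt (hU.mem_nhds hy)).of_le (natCast_le_infty 2)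
  rw [lap_mul (contDiff_coord_pow j).contDiffAt h2, lap_coord_pow]
  simp_rw [dirDeriv_coord_pow, ite_mul, zero_mul]
  rw [Finset.sum_ite_eq' Finset.univ (0 : Fin N)]
  simp
  ring

theorem iterate_lap_coord_pow_mul_eq_zero {h : EuclideanSpace ℝ (Fin N) → ℝ} (hU : IsOpen U)
    (hh : ContDiffOn ℝ ∞ h U) (hl : EqOn (lap h) 0 U) (j : ℕ) :
    EqOn (lap^[j + 1] (fun y => y 0 ^ j * h y)) 0 U := by
  induction j using Nat.strong_induction_on generalizing h with
  | _ j ih =>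
    intro y hy
    have hd : ContDiffOn ℝ ∞ (dirDeriv (coordVec 0) h) U := hh.dirDeriv hU (by rfl)
    have hdl : EqOn (lap (dirDeriv (coordVec 0) h)) 0 U := by
      intro z hz
      rw [lap_dirDeriv hU hh _ hz, dirDeriv_congr hU hl hz]
      simp [dirDeriv]
    have h1 : EqOn (lap (fun y => y 0 ^ j * h y)) (fun y =>
        (j * (j - 1)) * (y 0 ^ (j - 2) * h y) +
          (2 * j) * (y 0 ^ (j - 1) * dirDeriv (coordVec 0) h y)) U := by
      intro z hz
      rw [lap_coord_pow_mul hU hh j hz, hl hz]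
      simp
    rw [Function.iterate_succ_apply, iterate_lap_congr hU h1 j hy]
    have hc1 : ContDiffOn ℝ ∞ (fun y => (j * (j - 1) : ℝ) * (y 0 ^ (j - 2) * h y)) U :=
      contDiffOn_const.mul ((contDiff_coord_pow _).contDiffOn.mul hh)
    have hc2 : ContDiffOn ℝ ∞
        (fun y => (2 * j : ℝ) * (y 0 ^ (j - 1) * dirDeriv (coordVec 0) h y)) U :=
      contDiffOn_const.mul ((contDiff_coord_pow _).contDiffOn.mul hd)
    have hle : ((2 * j : ℕ) : WithTop ℕ∞) ≤ ∞ := natCast_le_infty _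
    rw [iterate_lap_add hU (hc1.of_le hle) (hc2.of_le hle) hy, iterate_lap_const_mul,
      iterate_lap_const_mul]
    have key : ∀ z ∈ U, j * (j - 1) * lap^[j] (fun y => y 0 ^ (j - 2) * h y) z = 0 := by
      intro z hz
      rcases lt_or_ge j 2 with hj | hj
      · interval_cases j <;> simp
      · obtain ⟨i, rfl⟩ := Nat.exists_eq_add_of_le' hj
        have := iterate_lap_congr hU (ih i (by omega) hh hl) 1 hz
        simp only [Nat.add_sub_cancel, Function.iterate_one, ← Function.iterate_succ_apply' lap] at this ⊢
        rw [this]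
        simp [Pi.zero_def, lap_zero]
    have key2 : ∀ z ∈ U, (2 * j : ℝ) *
        lap^[j] (fun y => y 0 ^ (j - 1) * dirDeriv (coordVec 0) h y) z = 0 := by
      intro z hz
      rcases j with _ | i
      · simp
      · rw [Nat.add_sub_cancel, ih i (by omega) hd hdl hz]; simp
    simp only [key y hy, key2 y hy, Pi.zero_apply, add_zero]

/-- The source term in the recursion for the Laplacians of the Green profile is polyharmonic. -/
theorem iterate_lap_pow_mul_reflPoisson (n : ℕ) {x y : EuclideanSpace ℝ (Fin N)}
    (hy : y ≠ refl0 x) :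
    lap^[n + 1] (fun y => (4 * x 0 * y 0) ^ n * reflPoisson x y) y = 0 := by
  have h1 : (fun y : EuclideanSpace ℝ (Fin N) => (4 * x 0 * y 0) ^ n * reflPoisson x y) =
      fun y => (4 * x 0) ^ n * (y 0 ^ n * reflPoisson x y) := by
    funext y; rw [mul_pow]; ring
  rw [h1, iterate_lap_const_mul]
  have := iterate_lap_coord_pow_mul_eq_zero isOpen_compl_singleton (contDiffOn_reflPoisson x)
    (fun z hz => lap_reflPoisson hz) n hy
  simp only [this, Pi.zero_apply, mul_zero]

end HarmonicPolynomial

section GreenFunction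

/-- The open half-space `{y | 0 < y₁}`. -/
def openHalf (N : ℕ) [NeZero N] : Set (EuclideanSpace ℝ (Fin N)) := {y | 0 < y 0}

variable {N : ℕ} [NeZero N] {x : EuclideanSpace ℝ (Fin N)}

theorem isOpen_openHalf : IsOpen (openHalf N) :=
  isOpen_lt continuous_const (by fun_prop)

/-- The unnormalized Green function of `(-Δ)^(n+1)` on the half-space. -/
noncomputable def greenFun (n : ℕ) (x y : EuclideanSpace ℝ (Fin N)) : ℝ :=
  greenProf n (N / 2) (zmap x 0 y)

theorem greenFun_nonneg (n : ℕ) {y : EuclideanSpace ℝ (Fin N)} (hx : 0 < x 0) (hy : 0 ≤ y 0) :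
    0 ≤ greenFun n x y := by
  have hp : 0 ≤ (zmap x 0 y).2 := by simp only [zmap]; positivity
  have ha : 0 ≤ (zmap x 0 y).1 := by simp only [zmap]; positivity
  refine mul_nonneg (pow_nonneg hp _) ?_
  refine intervalIntegral.integral_nonneg zero_le_one fun t ht => ?_
  have ht0 := ht.1
  positivity

theorem contDiffOn_greenFun (n : ℕ) (x : EuclideanSpace ℝ (Fin N)) :
    ContDiffOn ℝ ∞ (greenFun n x) ({x}ᶜ ∩ {refl0 x}ᶜ) :=
  (contDiffOn_greenProf n (by positivity)).comp (contDiff_zmap x 0).contDiffOn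
    fun _ hy => zmap_mem_kerDom_of_ne le_rfl hy.1 hy.2

theorem contDiff_greenProf_zmap (n : ℕ) {s : ℝ} (hs : 0 ≤ s) (x : EuclideanSpace ℝ (Fin N)) {d : ℝ}
    (hd : 0 < d) : ContDiff ℝ ∞ fun y => greenProf n s (zmap x d y) := by
  rw [← contDiffOn_univ]
  exact (contDiffOn_greenProf n hs).comp (contDiff_zmap x d).contDiffOn
    fun y _ => zmap_mem_kerDom_of_pos x y hd

theorem zmap_mem_kerDom_of_mem_openHalf {y : EuclideanSpace ℝ (Fin N)} {d : ℝ} (hd : 0 ≤ d)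
    (hx : 0 < x 0) (hy : 0 < y 0) (hne : y ≠ x) : zmap x d y ∈ kerDom :=
  zmap_mem_kerDom_of_ne hd hne (ne_refl0 hx hy.le)

theorem greenProf_nonneg {n : ℕ} {s : ℝ} {z : ℝ × ℝ} (hz : z ∈ kerDom) (hz2 : 0 ≤ z.2) :
    0 ≤ greenProf n s z := mul_nonneg (pow_nonneg hz2 _) (kerInt_nonneg hz)

theorem greenProf_zmap_le (n : ℕ) {y : EuclideanSpace ℝ (Fin N)} {d : ℝ} (hd : 0 ≤ d)
    (hx : 0 < x 0) (hy : 0 < y 0) (hne : y ≠ x) :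
    greenProf n (N / 2) (zmap x d y) ≤ greenFun n x y := by
  have e1 : 0 < ‖x - y‖ := norm_pos_iff.2 (sub_ne_zero.2 hne.symm)
  refine mul_le_mul_of_nonneg_left ?_ (by simp only [zmap]; positivity)
  exact kerInt_le_of_fst_le (by positivity) (by positivity) (by linarith) (by positivity)

theorem mul_greenProf_zmap_le (n : ℕ) {y : EuclideanSpace ℝ (Fin N)} {d : ℝ} (hd : 0 ≤ d)
    (hx : 0 < x 0) (hy : 0 < y 0) (hne : y ≠ x) :
    d * greenProf (n + 1) (N / 2 + 2) (zmap x d y) ≤ greenFun n x y := by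
  refine le_trans ?_ (greenProf_zmap_le n hd hx hy hne)
  have e1 : 0 < ‖x - y‖ := norm_pos_iff.2 (sub_ne_zero.2 hne.symm)
  have ha : 0 < ‖x - y‖ ^ 2 + d := by positivity
  have hb : 0 ≤ 4 * x 0 * y 0 := by positivity
  have h1 := mul_kerInt_succ_succ_le (j := n) (s := N / 2 + 1) ha hb
  have h2 := mul_kerInt_succ_le (j := n) (s := N / 2) (d := d) ha hb (by nlinarith)
  rw [show (N / 2 + 1 + 1 : ℝ) = N / 2 + 2 by ring] at h1
  simp only [greenProf, zmap]
  calc d * ((4 * x 0 * y 0) ^ (n + 1 + 1) * kerInt (n + 1) (N / 2 + 2) (‖x - y‖ ^ 2 + d, 4 * x 0 * y 0))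
      = (4 * x 0 * y 0) ^ (n + 1) * (d * (4 * x 0 * y 0 *
          kerInt (n + 1) (N / 2 + 2) (‖x - y‖ ^ 2 + d, 4 * x 0 * y 0))) := by ring
    _ ≤ _ := by
      refine mul_le_mul_of_nonneg_left ?_ (by positivity)
      exact (mul_le_mul_of_nonneg_left h1 hd).trans h2

theorem one_le_cast_of_neZero : (1 : ℝ) ≤ N := by
  exact_mod_cast NeZero.one_le

theorem greenFun_le (n : ℕ) {y : EuclideanSpace ℝ (Fin N)} (hx : 0 < x 0) (hy : 0 < y 0)
    (hne : y ≠ x) :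
    greenFun n x y ≤ 2 * (4 * x 0 * y 0) ^ ((n : ℝ) + 1 / 2) * ‖y - x‖ ^ (1 - N : ℝ) := by
  have e1 : 0 < ‖x - y‖ := norm_pos_iff.2 (sub_ne_zero.2 hne.symm)
  have hp : 0 < 4 * x 0 * y 0 := by positivity
  have hN : (1 : ℝ) ≤ N := one_le_cast_of_neZero
  have h := kerInt_le_rpow (j := n) (s := N / 2) (by linarith) (a := ‖x - y‖ ^ 2) (by positivity) hp
  have e2 : (‖x - y‖ ^ 2) ^ (1 / 2 - N / 2 : ℝ) = ‖y - x‖ ^ (1 - N : ℝ) := by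
    rw [norm_sub_rev y x, ← Real.rpow_natCast, ← Real.rpow_mul e1.le]
    congr 1; push_cast; ring
  have e3 : (4 * x 0 * y 0) ^ ((n : ℝ) + 1 / 2) =
      (4 * x 0 * y 0) ^ (n + 1) * (4 * x 0 * y 0) ^ (-(1 / 2) : ℝ) := by
    rw [← Real.rpow_natCast, ← Real.rpow_add hp]
    congr 1; push_cast; ring
  rw [e2] at h
  rw [e3]
  simp only [greenFun, greenProf, zmap, add_zero]
  refine (mul_le_mul_of_nonneg_left h (by positivity)).trans (le_of_eq ?_)
  ring

theorem integrableOn_norm_sub_rpow (x : EuclideanSpace ℝ (Fin N)) (r : ℝ) :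
    IntegrableOn (fun y : EuclideanSpace ℝ (Fin N) => ‖y - x‖ ^ (1 - N : ℝ)) (Metric.ball x r) := by
  have hN : 1 ≤ N := NeZero.one_le
  have h0 : IntegrableOn (fun y : EuclideanSpace ℝ (Fin N) => ‖y‖ ^ (1 - N : ℝ))
      (Metric.ball 0 r) := by
    refine (integrableOn_fun_norm_addHaar volume (f := fun t : ℝ => t ^ (1 - N : ℝ))).2 ?_
    have : IntegrableOn (fun _ : ℝ => (1 : ℝ)) (Ioo 0 r) := by simp
    refine this.congr_fun (fun t ht => ?_) measurableSet_Ioo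
    have ht0 : 0 < t := ht.1
    simp only [finrank_euclideanSpace, Fintype.card_fin, smul_eq_mul]
    rw [← Real.rpow_natCast, ← Real.rpow_add ht0]
    push_cast [hN]
    simp
  have h1 := (measurePreserving_sub_right (volume : Measure (EuclideanSpace ℝ (Fin N))) x)
  have h2 := (h1.integrableOn_comp_preimage (MeasurableEquiv.subRight x).measurableEmbedding
    (f := fun y : EuclideanSpace ℝ (Fin N) => ‖y‖ ^ (1 - N : ℝ)) (s := Metric.ball 0 r)).2 h0
  have h3 : (fun y => y - x) ⁻¹' Metric.ball (0 : EuclideanSpace ℝ (Fin N)) r =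
      Metric.ball x r := by
    ext y; simp [dist_eq_norm]
  rw [h3] at h2
  exact h2

theorem ae_ne (x : EuclideanSpace ℝ (Fin N)) : ∀ᵐ y : EuclideanSpace ℝ (Fin N), y ≠ x := by
  have : (volume : Measure (EuclideanSpace ℝ (Fin N))) {x} = 0 := measure_singleton x
  exact compl_mem_ae_iff.2 this

theorem integrable_greenFun_mul (n : ℕ) (hx : 0 < x 0) {b : EuclideanSpace ℝ (Fin N) → ℝ}
    (hb : Continuous b) (hbc : HasCompactSupport b) (hbU : tsupport b ⊆ openHalf N) :
    Integrable fun y => greenFun n x y * b y := by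
  obtain ⟨r, hr⟩ := (hbc.isCompact.isBounded).subset_ball x
  have hq : 0 ≤ (n : ℝ) + 1 / 2 := by positivity
  have hcont : Continuous fun y : EuclideanSpace ℝ (Fin N) =>
      2 * |4 * x 0 * y 0| ^ ((n : ℝ) + 1 / 2) * |b y| := by
    have h2 : Continuous fun y : EuclideanSpace ℝ (Fin N) => y 0 := by fun_prop
    exact (continuous_const.mul ((continuous_const.mul h2).abs.rpow_const fun y => Or.inr hq)).mul
      hb.abs
  obtain ⟨C, hC0, hC⟩ : ∃ C : ℝ, 0 ≤ C ∧ ∀ y ∈ tsupport b,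
      ‖2 * |4 * x 0 * y 0| ^ ((n : ℝ) + 1 / 2) * |b y|‖ ≤ C := by
    obtain ⟨C, hC⟩ := hbc.isCompact.exists_bound_of_continuousOn hcont.continuousOn
    exact ⟨|C|, abs_nonneg C, fun y hy => (hC y hy).trans (le_abs_self C)⟩
  have hdom : Integrable ((Metric.ball x r).indicator
      fun y : EuclideanSpace ℝ (Fin N) => C * ‖y - x‖ ^ (1 - N : ℝ)) :=
    (integrable_indicator_iff measurableSet_ball).2 ((integrableOn_norm_sub_rpow x r).const_mul C)
  have hmeas : AEStronglyMeasurable (fun y => greenFun n x y * b y) := by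
    have hc : ContinuousOn (fun y => greenFun n x y * b y) {x}ᶜ := by
      intro y hy
      by_cases hyb : y ∈ tsupport b
      · have h1 : y ∈ ({x}ᶜ ∩ {refl0 x}ᶜ : Set (EuclideanSpace ℝ (Fin N))) :=
          ⟨hy, ne_refl0 hx (le_of_lt (hbU hyb))⟩
        have h2 := (contDiffOn_greenFun n x).continuousOn.continuousAt
          ((isOpen_compl_singleton.inter isOpen_compl_singleton).mem_nhds h1)
        exact (h2.mul hb.continuousAt).continuousWithinAt
      · have h1 : (fun y => greenFun n x y * b y) =ᶠ[𝓝 y] fun _ => 0 := by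
          filter_upwards [notMem_tsupport_iff_eventuallyEq.1 hyb] with z hz
          simp [hz]
        exact (continuousAt_const.congr h1.symm).continuousWithinAt
    have := hc.aestronglyMeasurable (μ := volume) (measurableSet_singleton x).compl
    rwa [Measure.restrict_eq_self_of_ae_mem] at this
    exact ae_ne x
  refine hdom.mono' hmeas ?_
  filter_upwards [ae_ne x] with y hy
  by_cases hyb : y ∈ tsupport b
  · have hyH : 0 < y 0 := hbU hyb
    rw [indicator_of_mem (hr hyb), norm_mul, Real.norm_of_nonneg (greenFun_nonneg n hx hyH.le)]
    have h1 := greenFun_le n hx hyH hy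
    have h2 := hC y hyb
    have hp : 0 < 4 * x 0 * y 0 := by positivity
    rw [Real.norm_of_nonneg (by positivity), abs_of_pos hp] at h2
    have h3 : 0 ≤ ‖y - x‖ ^ (1 - N : ℝ) := by positivity
    calc greenFun n x y * ‖b y‖
        ≤ 2 * (4 * x 0 * y 0) ^ ((n : ℝ) + 1 / 2) * ‖y - x‖ ^ (1 - N : ℝ) * ‖b y‖ := by gcongr
      _ = (2 * (4 * x 0 * y 0) ^ ((n : ℝ) + 1 / 2) * |b y|) * ‖y - x‖ ^ (1 - N : ℝ) := by
        rw [Real.norm_eq_abs]; ring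
      _ ≤ _ := by gcongr
  · rw [image_eq_zero_of_notMem_tsupport hyb, mul_zero, norm_zero]
    by_cases hyr : y ∈ Metric.ball x r
    · rw [indicator_of_mem hyr]
      positivity
    · rw [indicator_of_notMem hyr]

end GreenFunction

theorem integral_concentrated_kernel {N : ℕ} (x : EuclideanSpace ℝ (Fin N))
    (b : EuclideanSpace ℝ (Fin N) → ℝ) {δ : ℝ} (hδ : 0 < δ) :
    ∫ y, δ ^ 2 * (‖x - y‖ ^ 2 + δ ^ 2) ^ (-(N / 2 + 1 : ℝ)) * b y =
      ∫ z, (1 + ‖z‖ ^ 2) ^ (-(N / 2 + 1 : ℝ)) * b (x + δ • z) := by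
  rw [← integral_add_left_eq_self _ x]
  have h := Measure.integral_comp_smul (volume : Measure (EuclideanSpace ℝ (Fin N)))
    (fun y => δ ^ 2 * (‖x - (x + y)‖ ^ 2 + δ ^ 2) ^ (-(N / 2 + 1 : ℝ)) * b (x + y)) δ
  rw [finrank_euclideanSpace, Fintype.card_fin, abs_of_pos (by positivity), smul_eq_mul,
    eq_inv_mul_iff_mul_eq₀ (by positivity)] at h
  rw [← h, ← integral_const_mul]
  refine integral_congr_ae (Eventually.of_forall fun z => ?_)
  simp only
  have e1 : ‖x - (x + δ • z)‖ ^ 2 + δ ^ 2 = δ ^ 2 * (1 + ‖z‖ ^ 2) := by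
    rw [sub_add_cancel_left, norm_neg, norm_smul, Real.norm_of_nonneg hδ.le]; ring
  have e2 : δ ^ N * δ ^ 2 * (δ ^ 2) ^ (-(N / 2 + 1 : ℝ)) = 1 := by
    rw [← Real.rpow_natCast δ 2, ← Real.rpow_mul hδ.le, ← Real.rpow_natCast δ N,
      ← Real.rpow_add hδ, ← Real.rpow_add hδ]
    rw [show (N + (2 : ℕ) + (2 : ℕ) * -(N / 2 + 1) : ℝ) = 0 by push_cast; ring, Real.rpow_zero]
  rw [e1, Real.mul_rpow (by positivity) (by positivity)]
  linear_combination (1 + ‖z‖ ^ 2) ^ (-(N / 2 + 1 : ℝ)) * b (x + δ • z) * e2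

/-- The total mass of the kernel `2 N (1 + |z|²)^(-N/2-1)`. -/
noncomputable def massConst (N : ℕ) : ℝ :=
  4 * (N / 2 : ℝ) * ∫ z : EuclideanSpace ℝ (Fin N), (1 + ‖z‖ ^ 2) ^ (-(N / 2 + 1 : ℝ))

theorem integrable_mass_kernel (N : ℕ) :
    Integrable fun z : EuclideanSpace ℝ (Fin N) => (1 + ‖z‖ ^ 2) ^ (-(N / 2 + 1 : ℝ)) := by
  have := integrable_rpow_neg_one_add_norm_sq (μ := (volume : Measure (EuclideanSpace ℝ (Fin N))))
    (r := N + 2) (by simp)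
  rwa [show (-(N + 2) / 2 : ℝ) = -(N / 2 + 1) by ring] at this

theorem tendsto_integral_concentrated_kernel {N : ℕ} (x : EuclideanSpace ℝ (Fin N))
    {b : EuclideanSpace ℝ (Fin N) → ℝ} (hb : Continuous b) (hbc : HasCompactSupport b) :
    Tendsto (fun δ : ℝ => ∫ y, δ ^ 2 * (‖x - y‖ ^ 2 + δ ^ 2) ^ (-(N / 2 + 1 : ℝ)) * b y) (𝓝[>] 0)
      (𝓝 ((∫ z : EuclideanSpace ℝ (Fin N), (1 + ‖z‖ ^ 2) ^ (-(N / 2 + 1 : ℝ))) * b x)) := by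
  have h0 : ∀ᶠ δ : ℝ in 𝓝[>] 0,
      ∫ z, (1 + ‖z‖ ^ 2) ^ (-(N / 2 + 1 : ℝ)) * b (x + δ • z) =
      ∫ y, δ ^ 2 * (‖x - y‖ ^ 2 + δ ^ 2) ^ (-(N / 2 + 1 : ℝ)) * b y := by
    filter_upwards [self_mem_nhdsWithin] with δ hδ
    exact (integral_concentrated_kernel x b hδ).symm
  refine Tendsto.congr' h0 ?_
  rw [← integral_mul_const]
  obtain ⟨C, hC⟩ := hb.bounded_above_of_compact_support hbc
  have hk : Continuous fun z : EuclideanSpace ℝ (Fin N) => (1 + ‖z‖ ^ 2) ^ (-(N / 2 + 1 : ℝ)) :=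
    (by fun_prop : Continuous fun z : EuclideanSpace ℝ (Fin N) => 1 + ‖z‖ ^ 2).rpow_const
      fun z => Or.inl (by positivity)
  refine tendsto_integral_filter_of_dominated_convergence
    (fun z => (1 + ‖z‖ ^ 2) ^ (-(N / 2 + 1 : ℝ)) * C) ?_ ?_
    ((integrable_mass_kernel N).mul_const C) ?_
  · refine Eventually.of_forall fun δ => Continuous.aestronglyMeasurable ?_
    fun_prop
  · refine Eventually.of_forall fun δ => Eventually.of_forall fun z => ?_
    rw [norm_mul, Real.norm_of_nonneg (by positivity)]
    exact mul_le_mul_of_nonneg_left (hC _) (by positivity)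
  · refine Eventually.of_forall fun z => ?_
    have hc : Continuous fun δ : ℝ => (1 + ‖z‖ ^ 2) ^ (-(N / 2 + 1 : ℝ)) * b (x + δ • z) := by
      fun_prop
    have := (hc.tendsto 0).mono_left (nhdsWithin_le_nhds (s := Ioi 0))
    simpa using this

section LocalRepresentation

variable {N : ℕ} [NeZero N] {x : EuclideanSpace ℝ (Fin N)}

theorem tendsto_comp_zmap {f : ℝ × ℝ → ℝ} {y : EuclideanSpace ℝ (Fin N)}
    (hf : ContinuousAt f (zmap x 0 y)) :
    Tendsto (fun d => f (zmap x d y)) (𝓝[>] 0) (𝓝 (f (zmap x 0 y))) := by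
  have hc : Continuous fun d : ℝ => zmap x d y := by unfold zmap; fun_prop
  exact ((ContinuousAt.comp (f := fun d : ℝ => zmap x d y) hf hc.continuousAt).tendsto).mono_left
    nhdsWithin_le_nhds

theorem tendsto_greenProf_zmap (n : ℕ) {s : ℝ} (hs : 0 ≤ s) {y : EuclideanSpace ℝ (Fin N)}
    (hx : 0 < x 0) (hy : 0 < y 0) (hne : y ≠ x) :
    Tendsto (fun d => greenProf n s (zmap x d y)) (𝓝[>] 0) (𝓝 (greenProf n s (zmap x 0 y))) :=
  tendsto_comp_zmap ((contDiffOn_greenProf n hs).continuousOn.continuousAt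
    (isOpen_kerDom.mem_nhds (zmap_mem_kerDom_of_mem_openHalf le_rfl hx hy hne)))

theorem tendsto_integral_greenProf_zmap_mul (n : ℕ) (hx : 0 < x 0)
    {b : EuclideanSpace ℝ (Fin N) → ℝ} (hb : Continuous b) (hbc : HasCompactSupport b)
    (hbU : tsupport b ⊆ openHalf N) :
    Tendsto (fun d => ∫ y, greenProf n (N / 2) (zmap x d y) * b y) (𝓝[>] 0)
      (𝓝 (∫ y, greenFun n x y * b y)) := by
  have hintg := (integrable_greenFun_mul n hx hb hbc hbU).norm
  refine tendsto_integral_filter_of_dominated_convergence _ ?_ ?_ hintg ?_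
  · filter_upwards [self_mem_nhdsWithin] with d hd
    exact ((contDiff_greenProf_zmap n (by positivity) x hd).continuous.mul hb).aestronglyMeasurable
  · filter_upwards [self_mem_nhdsWithin] with d hd
    filter_upwards [ae_ne x] with y hy
    by_cases hyb : y ∈ tsupport b
    · have hyH : 0 < y 0 := hbU hyb
      rw [norm_mul, norm_mul]
      refine mul_le_mul_of_nonneg_right ?_ (norm_nonneg _)
      rw [Real.norm_of_nonneg (greenFun_nonneg n hx hyH.le), Real.norm_of_nonneg]
      · exact greenProf_zmap_le n (le_of_lt hd) hx hyH hy
      · refine greenProf_nonneg (zmap_mem_kerDom_of_pos x y hd) ?_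
        simp only [zmap]; positivity
    · simp [image_eq_zero_of_notMem_tsupport hyb]
  · filter_upwards [ae_ne x] with y hy
    by_cases hyb : y ∈ tsupport b
    · exact (tendsto_greenProf_zmap n (by positivity) hx (hbU hyb) hy).mul_const _
    · simp [image_eq_zero_of_notMem_tsupport hyb]

theorem contDiffOn_pow_mul_reflPoisson (n : ℕ) (x : EuclideanSpace ℝ (Fin N)) :
    ContDiffOn ℝ ∞ (fun y => (4 * x 0 * y 0) ^ n * reflPoisson x y) {refl0 x}ᶜ := by
  have h2 : ContDiff ℝ ∞ fun y : EuclideanSpace ℝ (Fin N) => y 0 := by fun_prop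
  exact ((contDiff_const.mul h2).pow n).contDiffOn.mul (contDiffOn_reflPoisson x)

theorem openHalf_subset_compl_refl0 (hx : 0 < x 0) : openHalf N ⊆ {refl0 x}ᶜ :=
  fun _ hy => ne_refl0 hx (le_of_lt hy)

theorem integrable_pow_mul_reflPoisson_mul (n : ℕ) (hx : 0 < x 0)
    {b : EuclideanSpace ℝ (Fin N) → ℝ} (hb : Continuous b) (hbc : HasCompactSupport b)
    (hbU : tsupport b ⊆ openHalf N) :
    Integrable fun y => (4 * x 0 * y 0) ^ n * reflPoisson x y * b y :=
  (continuous_mul_of_continuousOn_of_tsupport_subset isOpen_openHalf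
    ((contDiffOn_pow_mul_reflPoisson n x).continuousOn.mono (openHalf_subset_compl_refl0 hx))
    hb hbU).integrable_of_hasCompactSupport hbc.mul_left

theorem integral_greenFun_succ_mul_lap (n : ℕ) (hx : 0 < x 0)
    {b : EuclideanSpace ℝ (Fin N) → ℝ} (hb : ContDiff ℝ 2 b) (hbc : HasCompactSupport b)
    (hbU : tsupport b ⊆ openHalf N) :
    ∫ y, greenFun (n + 1) x y * lap b y = -4 * (n + 1) ^ 2 * (∫ y, greenFun n x y * b y) +
      4 * (n + 1) * ∫ y, (4 * x 0 * y 0) ^ n * reflPoisson x y * b y := by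
  have hlb : Continuous (lap b) := by
    have := (contDiffOn_univ.2 hb).lap (n := 0) isOpen_univ (by simp)
    exact (contDiffOn_univ.1 this).continuous
  have hts := tsupport_lap_subset b
  have hL := tendsto_integral_greenProf_zmap_mul (n + 1) hx hlb (hbc.mono' (subset_closure.trans hts))
    (hts.trans hbU)
  have hi1 := integrable_greenFun_mul n hx hb.continuous hbc hbU
  have hi2 := integrable_pow_mul_reflPoisson_mul n hx hb.continuous hbc hbU
  obtain ⟨s, hs⟩ : ∃ s : ℝ, s = N / 2 := ⟨_, rfl⟩
  have hs0 : 0 ≤ s := by rw [hs]; positivity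
  rw [← integral_const_mul, ← integral_const_mul, ← integral_add (hi1.const_mul _)
    (hi2.const_mul _)]
  refine tendsto_nhds_unique hL ?_
  have hR : ∀ᶠ d : ℝ in 𝓝[>] 0, ∫ y, (-4 * (n + 1) ^ 2 * greenProf n s (zmap x d y) +
      4 * (n + 1) * ((zmap x d y).2 ^ n * (((zmap x d y).2 + 4 * x 0 ^ 2) *
        ((zmap x d y).1 + (zmap x d y).2) ^ (-s))) -
      4 * (s * (s + 1)) * (d * greenProf (n + 1) (s + 2) (zmap x d y))) * b y =
      ∫ y, greenProf (n + 1) (N / 2) (zmap x d y) * lap b y := by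
    filter_upwards [self_mem_nhdsWithin] with d hd
    rw [integral_mul_lap isOpen_univ
      ((contDiff_greenProf_zmap (n + 1) (by positivity) x hd).contDiffOn.of_le
        (natCast_le_infty 2)) hb hbc (subset_univ _)]
    refine integral_congr_ae (Eventually.of_forall fun y => ?_)
    simp only
    rw [lap_greenProf_zmap_succ n (zmap_mem_kerDom_of_pos x y hd), hs]
    ring
  refine Tendsto.congr' hR ?_
  refine tendsto_integral_filter_of_dominated_convergence
    (fun y => (4 * (n + 1) ^ 2 + 4 * (s * (s + 1))) * ‖greenFun n x y * b y‖ +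
      4 * (n + 1) * ‖(4 * x 0 * y 0) ^ n * reflPoisson x y * b y‖) ?_ ?_
    ((hi1.norm.const_mul _).add (hi2.norm.const_mul _)) ?_
  · filter_upwards [self_mem_nhdsWithin] with d hd
    refine Continuous.aestronglyMeasurable (Continuous.mul ?_ hb.continuous)
    have h1 := (contDiff_greenProf_zmap n hs0 x hd).continuous
    have h2 := (contDiff_greenProf_zmap (n + 1) (s := s + 2) (by linarith) x hd).continuous
    have h3 : Continuous (zmap x d) := (contDiff_zmap x d (n := 0)).continuous
    have h4 : Continuous fun y => ((zmap x d y).1 + (zmap x d y).2) ^ (-s) :=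
      (h3.fst.add h3.snd).rpow_const fun y => Or.inl (zmap_mem_kerDom_of_pos x y hd).2.ne'
    have h5 := h3.snd
    fun_prop
  · filter_upwards [self_mem_nhdsWithin] with d hd
    filter_upwards [ae_ne x] with y hy
    by_cases hyb : y ∈ tsupport b
    · have hyH : 0 < y 0 := hbU hyb
      have hd0 : 0 < d := hd
      have hz := zmap_mem_kerDom_of_pos x y hd0
      have hz2 : 0 ≤ (zmap x d y).2 := by simp only [zmap]; positivity
      have hw0 : 0 < ‖refl0 x - y‖ := norm_pos_iff.2 (sub_ne_zero.2 (ne_refl0 hx hyH.le).symm)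
      have g1 := greenProf_nonneg (n := n) (s := s) hz hz2
      have g2 := greenProf_zmap_le n hd0.le hx hyH hy
      have g3 := greenProf_nonneg (n := n + 1) (s := s + 2) hz hz2
      have g4 := mul_greenProf_zmap_le n hd0.le hx hyH hy
      rw [← hs] at g2 g4
      have g5 : (4 * x 0 * y 0) ^ n * ((4 * x 0 * y 0 + 4 * x 0 ^ 2) *
          (‖refl0 x - y‖ ^ 2 + d) ^ (-s)) ≤ (4 * x 0 * y 0) ^ n * reflPoisson x y := by
        unfold reflPoisson
        rw [← hs]
        have : (‖refl0 x - y‖ ^ 2 + d) ^ (-s) ≤ (‖refl0 x - y‖ ^ 2) ^ (-s) :=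
          Real.rpow_le_rpow_of_nonpos (by positivity) (by linarith) (by linarith)
        gcongr
      have g6 : 0 ≤ (4 * x 0 * y 0) ^ n * ((4 * x 0 * y 0 + 4 * x 0 ^ 2) *
          (‖refl0 x - y‖ ^ 2 + d) ^ (-s)) := by positivity
      rw [zmap_fst_add_snd, norm_mul, norm_mul (greenFun n x y), norm_mul (_ * reflPoisson x y)]
      have key : ∀ c₁ c₂ A B b : ℝ, c₁ * (A * b) + c₂ * (B * b) = (c₁ * A + c₂ * B) * b := by
        intros; ring
      rw [key]
      refine mul_le_mul_of_nonneg_right ?_ (norm_nonneg (b y))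
      rw [Real.norm_of_nonneg (g1.trans g2), Real.norm_of_nonneg (g6.trans g5), Real.norm_eq_abs]
      have e2 : (zmap x d y).2 = 4 * x 0 * y 0 := rfl
      rw [e2]
      have k1 : 4 * ((n : ℝ) + 1) ^ 2 * greenProf n s (zmap x d y) ≤
        4 * ((n : ℝ) + 1) ^ 2 * greenFun n x y := by gcongr
      have k2 := mul_le_mul_of_nonneg_left g5 (show 0 ≤ 4 * ((n : ℝ) + 1) by positivity)
      have k3 := mul_le_mul_of_nonneg_left g4 (show 0 ≤ 4 * (s * (s + 1)) by positivity)
      have k4 : 0 ≤ 4 * ((n : ℝ) + 1) ^ 2 * greenProf n s (zmap x d y) := by positivity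
      have k5 := mul_nonneg (show 0 ≤ 4 * ((n : ℝ) + 1) by positivity) g6
      have k6 : 0 ≤ 4 * (s * (s + 1)) * (d * greenProf (n + 1) (s + 2) (zmap x d y)) := by
        positivity
      rw [abs_le]
      constructor <;> linarith
    · simp [image_eq_zero_of_notMem_tsupport hyb]
  · filter_upwards [ae_ne x] with y hy
    by_cases hyb : y ∈ tsupport b
    · have hyH : 0 < y 0 := hbU hyb
      have hz := zmap_mem_kerDom_of_mem_openHalf le_rfl hx hyH hy
      have t1 := tendsto_greenProf_zmap n hs0 hx hyH hy
      have t2 := tendsto_greenProf_zmap (n + 1) (s := s + 2) (by linarith) hx hyH hy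
      have t3 : Tendsto (fun d : ℝ => d) (𝓝[>] 0) (𝓝 0) := tendsto_id.mono_left nhdsWithin_le_nhds
      have t4 : Tendsto (fun d => (zmap x d y).2 ^ n * (((zmap x d y).2 + 4 * x 0 ^ 2) *
          ((zmap x d y).1 + (zmap x d y).2) ^ (-s))) (𝓝[>] 0)
          (𝓝 ((zmap x 0 y).2 ^ n * (((zmap x 0 y).2 + 4 * x 0 ^ 2) *
          ((zmap x 0 y).1 + (zmap x 0 y).2) ^ (-s)))) := by
        refine tendsto_comp_zmap (f := fun z : ℝ × ℝ => z.2 ^ n * ((z.2 + 4 * x 0 ^ 2) *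
          (z.1 + z.2) ^ (-s))) ?_
        have : ContinuousAt (fun z : ℝ × ℝ => (z.1 + z.2) ^ (-s)) (zmap x 0 y) :=
          (hasFDerivAt_add_rpow hz).continuousAt
        fun_prop
      have e : (zmap x 0 y).2 ^ n * (((zmap x 0 y).2 + 4 * x 0 ^ 2) *
          ((zmap x 0 y).1 + (zmap x 0 y).2) ^ (-s)) = (4 * x 0 * y 0) ^ n * reflPoisson x y := by
        rw [zmap_fst_add_snd, reflPoisson, ← hs]; simp [zmap]
      rw [e] at t4
      have := (((t1.const_mul (-4 * (n + 1) ^ 2 : ℝ)).add (t4.const_mul (4 * (n + 1) : ℝ))).sub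
        ((t3.mul t2).const_mul (4 * (s * (s + 1))))).mul_const (b y)
      refine this.trans (le_of_eq ?_)
      congr 1
      simp only [greenFun, ← hs]
      ring
    · simp [image_eq_zero_of_notMem_tsupport hyb]

theorem massConst_pos : 0 < massConst N := by
  have hN : (1 : ℝ) ≤ N := one_le_cast_of_neZero
  refine mul_pos (by linarith) ?_
  rw [integral_pos_iff_support_of_nonneg (fun z => by positivity) (integrable_mass_kernel N)]
  have : Function.support (fun z : EuclideanSpace ℝ (Fin N) =>
      (1 + ‖z‖ ^ 2) ^ (-(N / 2 + 1 : ℝ))) = univ := by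
    ext z
    simp only [Function.mem_support, mem_univ, iff_true]
    positivity
  rw [this]
  simp

theorem integral_greenFun_zero_mul_lap (hx : 0 < x 0)
    {b : EuclideanSpace ℝ (Fin N) → ℝ} (hb : ContDiff ℝ 2 b) (hbc : HasCompactSupport b)
    (hbU : tsupport b ⊆ openHalf N) :
    ∫ y, greenFun 0 x y * lap b y = -(massConst N * b x) := by
  have hlb : Continuous (lap b) := by
    have := (contDiffOn_univ.2 hb).lap (n := 0) isOpen_univ (by simp)
    exact (contDiffOn_univ.1 this).continuous
  have hts := tsupport_lap_subset b
  have hL := tendsto_integral_greenProf_zmap_mul 0 hx hlb (hbc.mono' (subset_closure.trans hts))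
    (hts.trans hbU)
  have hsq : Tendsto (fun δ : ℝ => δ ^ 2) (𝓝[>] 0) (𝓝[>] 0) := by
    refine tendsto_nhdsWithin_of_tendsto_nhds_of_eventually_within _ ?_ ?_
    · have : Tendsto (fun δ : ℝ => δ ^ 2) (𝓝 0) (𝓝 (0 ^ 2)) := (continuous_pow 2).tendsto 0
      simpa using this.mono_left nhdsWithin_le_nhds
    · filter_upwards [self_mem_nhdsWithin] with δ hδ
      have : 0 < δ := hδ
      exact pow_pos this 2
  refine tendsto_nhds_unique (hL.comp hsq) ?_
  obtain ⟨s, hs⟩ : ∃ s : ℝ, s = N / 2 := ⟨_, rfl⟩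
  have hs0 : 0 ≤ s := by rw [hs]; positivity
  have hR : ∀ᶠ δ : ℝ in 𝓝[>] 0,
      -(4 * s * (∫ y, δ ^ 2 * (‖x - y‖ ^ 2 + δ ^ 2) ^ (-(s + 1)) * b y)) +
        4 * s * (δ ^ 2 * ∫ y, (‖refl0 x - y‖ ^ 2 + δ ^ 2) ^ (-(s + 1)) * b y) =
      ∫ y, greenProf 0 (N / 2) (zmap x (δ ^ 2) y) * lap b y := by
    filter_upwards [self_mem_nhdsWithin] with δ hδ
    have hδ0 : 0 < δ := hδ
    have hδ2 : 0 < δ ^ 2 := pow_pos hδ0 2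
    have hc : ∀ w : EuclideanSpace ℝ (Fin N),
        Continuous fun y => (‖w - y‖ ^ 2 + δ ^ 2) ^ (-(s + 1)) := fun w =>
      (by fun_prop : Continuous fun y => ‖w - y‖ ^ 2 + δ ^ 2).rpow_const
        fun z => Or.inl (by positivity)
    have hi1 : Integrable fun y => δ ^ 2 * (‖x - y‖ ^ 2 + δ ^ 2) ^ (-(s + 1)) * b y :=
      ((continuous_const.mul (hc x)).mul hb.continuous).integrable_of_hasCompactSupport hbc.mul_left
    have hi1' : Integrable fun y =>
        -(4 * s * (δ ^ 2 * (‖x - y‖ ^ 2 + δ ^ 2) ^ (-(s + 1)) * b y)) := (hi1.const_mul _).neg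
    have hi2 : Integrable fun y => (‖refl0 x - y‖ ^ 2 + δ ^ 2) ^ (-(s + 1)) * b y :=
      ((hc _).mul hb.continuous).integrable_of_hasCompactSupport hbc.mul_left
    rw [integral_mul_lap isOpen_univ
      ((contDiff_greenProf_zmap 0 (by positivity) x hδ2).contDiffOn.of_le
        (natCast_le_infty 2)) hb hbc (subset_univ _), ← integral_const_mul, ← integral_const_mul,
        ← integral_const_mul, ← integral_neg,
        ← integral_add hi1' ((hi2.const_mul _).const_mul _)]
    refine integral_congr_ae (Eventually.of_forall fun y => ?_)
    simp only
    rw [lap_greenProf_zmap_zero (zmap_mem_kerDom_of_pos x y hδ2), zmap_fst_add_snd, ← hs]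
    simp only [zmap]
    ring
  refine Tendsto.congr' hR ?_
  have t1 := tendsto_integral_concentrated_kernel x hb.continuous hbc
  have t3 : Tendsto (fun δ : ℝ => δ ^ 2) (𝓝[>] 0) (𝓝 0) := hsq.mono_right nhdsWithin_le_nhds
  have t2 : Tendsto (fun δ : ℝ => ∫ y, (‖refl0 x - y‖ ^ 2 + δ ^ 2) ^ (-(s + 1)) * b y) (𝓝[>] 0)
      (𝓝 (∫ y, (‖refl0 x - y‖ ^ 2 + 0) ^ (-(s + 1)) * b y)) := by
    have hintg : Integrable fun y => (‖refl0 x - y‖ ^ 2) ^ (-(s + 1)) * b y := by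
      refine (continuous_mul_of_continuousOn_of_tsupport_subset isOpen_openHalf ?_
        hb.continuous hbU).integrable_of_hasCompactSupport hbc.mul_left
      refine ContinuousOn.rpow_const (by fun_prop) fun y hy => Or.inl ?_
      have : 0 < ‖refl0 x - y‖ :=
        norm_pos_iff.2 (sub_ne_zero.2 (ne_refl0 hx (le_of_lt hy)).symm)
      positivity
    refine tendsto_integral_filter_of_dominated_convergence _ ?_ ?_ hintg.norm ?_
    · filter_upwards [self_mem_nhdsWithin] with δ hδ
      have hδ0 : 0 < δ := hδ
      have hc : Continuous fun y => (‖refl0 x - y‖ ^ 2 + δ ^ 2) ^ (-(s + 1)) :=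
        (by fun_prop : Continuous fun y => ‖refl0 x - y‖ ^ 2 + δ ^ 2).rpow_const
          fun z => Or.inl (by positivity)
      exact (hc.mul hb.continuous).aestronglyMeasurable
    · filter_upwards [self_mem_nhdsWithin] with δ hδ
      refine Eventually.of_forall fun y => ?_
      by_cases hyb : y ∈ tsupport b
      · have : 0 < ‖refl0 x - y‖ :=
          norm_pos_iff.2 (sub_ne_zero.2 (ne_refl0 hx (le_of_lt (hbU hyb))).symm)
        simp only [norm_mul]
        refine mul_le_mul_of_nonneg_right ?_ (norm_nonneg _)
        rw [Real.norm_of_nonneg (Real.rpow_nonneg (by positivity) _),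
          Real.norm_of_nonneg (Real.rpow_nonneg (by positivity) _)]
        exact Real.rpow_le_rpow_of_nonpos (by positivity) (by nlinarith) (by linarith)
      · simp [image_eq_zero_of_notMem_tsupport hyb]
    · refine Eventually.of_forall fun y => ?_
      by_cases hyb : y ∈ tsupport b
      · have : 0 < ‖refl0 x - y‖ :=
          norm_pos_iff.2 (sub_ne_zero.2 (ne_refl0 hx (le_of_lt (hbU hyb))).symm)
        exact ((t3.const_add _).rpow_const (Or.inl (by positivity))).mul_const _
      · simp [image_eq_zero_of_notMem_tsupport hyb]
  rw [← hs] at t1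
  have := (t1.const_mul (4 * s)).neg.add ((t3.mul t2).const_mul (4 * s))
  refine this.trans (le_of_eq ?_)
  congr 1
  rw [massConst, ← hs]
  ring

/-- The normalizing constant of `greenFun n`. -/
noncomputable def greenConst (N n : ℕ) : ℝ := massConst N * 4 ^ n * (n.factorial : ℝ) ^ 2

theorem greenConst_pos (n : ℕ) : 0 < greenConst N n := by
  have := massConst_pos (N := N)
  have h2 : 0 < (n.factorial : ℝ) := by exact_mod_cast n.factorial_pos
  unfold greenConst
  positivity

theorem integral_greenFun_mul_iterate_lap (n : ℕ) (hx : 0 < x 0)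
    {b : EuclideanSpace ℝ (Fin N) → ℝ} (hb : ContDiff ℝ (2 * (n + 1) : ℕ) b)
    (hbc : HasCompactSupport b) (hbU : tsupport b ⊆ openHalf N) :
    ∫ y, greenFun n x y * lap^[n + 1] b y = (-1) ^ (n + 1) * (greenConst N n * b x) := by
  induction n with
  | zero =>
    rw [zero_add, Function.iterate_one, integral_greenFun_zero_mul_lap hx hb hbc hbU]
    simp [greenConst]
  | succ n ih =>
    have hts := tsupport_iterate_lap_subset (n + 1) b
    have hl : ContDiff ℝ 2 (lap^[n + 1] b) := by
      rw [← contDiffOn_univ]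
      refine ContDiffOn.iterate_lap isOpen_univ ((contDiffOn_univ.2 hb).of_le ?_)
      norm_cast
      omega
    have hb' : ContDiff ℝ (2 * (n + 1) : ℕ) b := hb.of_le (by norm_cast; omega)
    have hc' := hbc.mono' (subset_closure.trans hts)
    rw [Function.iterate_succ_apply' lap, integral_greenFun_succ_mul_lap n hx hl hc' (hts.trans hbU),
      ih hb']
    have h0 : ∫ y, (4 * x 0 * y 0) ^ n * reflPoisson x y * lap^[n + 1] b y = 0 := by
      rw [integral_mul_iterate_lap isOpen_compl_singleton
        ((contDiffOn_pow_mul_reflPoisson n x).of_le (natCast_le_infty _)) hb' hbc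
        (hbU.trans (openHalf_subset_compl_refl0 hx))]
      have : ∀ y, lap^[n + 1] (fun y => (4 * x 0 * y 0) ^ n * reflPoisson x y) y * b y = 0 := by
        intro y
        by_cases hyb : y ∈ tsupport b
        · rw [iterate_lap_pow_mul_reflPoisson n (openHalf_subset_compl_refl0 hx (hbU hyb)), zero_mul]
        · rw [image_eq_zero_of_notMem_tsupport hyb, mul_zero]
      simp only [this, integral_zero]
    rw [h0]
    simp only [greenConst, Nat.factorial_succ]
    push_cast
    ring

end LocalRepresentation

section Commutator

variable {N : ℕ} {U : Set (EuclideanSpace ℝ (Fin N))} {θ θ' f f' : EuclideanSpace ℝ (Fin N) → ℝ}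
  {y : EuclideanSpace ℝ (Fin N)}

theorem iterate_lap_eq_of_eventuallyEq (j : ℕ) (h : f =ᶠ[𝓝 y] f') :
    lap^[j] f y = lap^[j] f' y := by
  obtain ⟨V, hV, hVo, hyV⟩ := eventually_nhds_iff.1 h
  exact iterate_lap_congr hVo (fun z hz => hV z hz) j hyV

/-- The commutator of the `j`-th power of the Laplacian with multiplication by `θ`. -/
noncomputable def lapComm (j : ℕ) (θ f : EuclideanSpace ℝ (Fin N) → ℝ)
    (y : EuclideanSpace ℝ (Fin N)) : ℝ :=
  lap^[j] (fun y => θ y * f y) y - θ y * lap^[j] f y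

theorem lapComm_eq_of_eventuallyEq (j : ℕ) (hθ : θ =ᶠ[𝓝 y] θ') (hf : f =ᶠ[𝓝 y] f') :
    lapComm j θ f y = lapComm j θ' f' y := by
  have h : (fun y => θ y * f y) =ᶠ[𝓝 y] fun y => θ' y * f' y := hθ.mul hf
  rw [lapComm, lapComm, iterate_lap_eq_of_eventuallyEq j h,
    iterate_lap_eq_of_eventuallyEq j hf, hθ.eq_of_nhds]

theorem lapComm_eq_zero_of_eventuallyEq_const (j : ℕ) {c : ℝ} (hθ : θ =ᶠ[𝓝 y] fun _ => c) :
    lapComm j θ f y = 0 := by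
  rw [lapComm_eq_of_eventuallyEq j hθ (EventuallyEq.refl _ f), lapComm, iterate_lap_const_mul,
    sub_self]

theorem continuousOn_lapComm (j : ℕ) (hU : IsOpen U) (hθ : ContDiffOn ℝ ∞ θ U)
    (hf : ContDiffOn ℝ ∞ f U) : ContinuousOn (lapComm j θ f) U :=
  ((hθ.mul hf).iterate_lap_infty j hU).continuousOn.sub
    (hθ.continuousOn.mul (hf.iterate_lap_infty j hU).continuousOn)

theorem lapComm_sub (j : ℕ) (hU : IsOpen U) (hθ : ContDiffOn ℝ ∞ θ U) (hθ' : ContDiffOn ℝ ∞ θ' U)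
    (hf : ContDiffOn ℝ ∞ f U) (hy : y ∈ U) :
    lapComm j (fun y => θ y - θ' y) f y = lapComm j θ f y - lapComm j θ' f y := by
  have h1 : (fun y => (θ y - θ' y) * f y) = fun y => θ y * f y + (-1) * (θ' y * f y) := by
    ext y; ring
  have hi := natCast_le_infty (2 * j)
  have h2 := iterate_lap_add (j := j) hU ((hθ.mul hf).of_le hi)
    ((contDiffOn_const (c := (-1 : ℝ))).mul ((hθ'.mul hf).of_le hi)) hy
  rw [lapComm, h1, h2, iterate_lap_const_mul, lapComm, lapComm]
  ring

end Commutator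

section CutoffIdentity

variable {N : ℕ} [NeZero N] {x : EuclideanSpace ℝ (Fin N)}

theorem integral_cutoff_mul_greenFun (n : ℕ) (hx : 0 < x 0)
    {u θ f : EuclideanSpace ℝ (Fin N) → ℝ} {U V : Set (EuclideanSpace ℝ (Fin N))}
    (hu : ContDiffOn ℝ (2 * (n + 1) : ℕ) u (openHalf N))
    (hθ : ContDiff ℝ ∞ θ) (hθc : HasCompactSupport θ) (hθH : tsupport θ ⊆ openHalf N)
    (hV : IsOpen V) (hxV : x ∈ V) (hθV : ∀ y ∈ V, θ y = 1)
    (hU : IsOpen U) (hHU : openHalf N ⊆ U) (hf : ContDiffOn ℝ ∞ f U)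
    (hfV : ∀ y ∉ V, f y = greenFun n x y) :
    Integrable (fun y => greenFun n x y * (θ y * lap^[n + 1] u y)) ∧
    ∫ y, greenFun n x y * (θ y * lap^[n + 1] u y) =
      (-1) ^ (n + 1) * (greenConst N n * u x) + ∫ y in openHalf N, u y * lapComm (n + 1) θ f y := by
  have hi := natCast_le_infty (2 * (n + 1))
  have hb : ContDiff ℝ (2 * (n + 1) : ℕ) fun y => u y * θ y :=
    contDiff_mul_of_contDiffOn_of_tsupport_subset isOpen_openHalf hu (hθ.of_le hi) hθH
  have hbc : HasCompactSupport fun y => u y * θ y := hθc.mul_left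
  have hts : tsupport (fun y => u y * θ y) ⊆ tsupport θ :=
    closure_mono fun y hy => by
      rw [Function.mem_support] at hy ⊢
      exact fun h => hy (by rw [h, mul_zero])
  have hmain := integral_greenFun_mul_iterate_lap n hx hb hbc (hts.trans hθH)
  set b : EuclideanSpace ℝ (Fin N) → ℝ := fun y => u y * θ y with hbdef
  have hlu : ContinuousOn (lap^[n + 1] u) (openHalf N) :=
    (ContDiffOn.iterate_lap (n := 0) isOpen_openHalf (by simpa using hu)).continuousOn
  have hlb : Continuous (lap^[n + 1] b) := by
    rw [← continuousOn_univ]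
    exact (ContDiffOn.iterate_lap (n := 0) isOpen_univ (by simpa using hb.contDiffOn)).continuousOn
  have hθlu : Continuous fun y => lap^[n + 1] u y * θ y :=
    continuous_mul_of_continuousOn_of_tsupport_subset isOpen_openHalf hlu hθ.continuous hθH
  have hθlu_ts : tsupport (fun y => lap^[n + 1] u y * θ y) ⊆ tsupport θ :=
    closure_mono fun y hy => by
      rw [Function.mem_support] at hy ⊢
      exact fun h => hy (by rw [h, mul_zero])
  have hlb_ts := (tsupport_iterate_lap_subset (n + 1) b).trans hts
  have hlbc : HasCompactSupport (lap^[n + 1] b) := hθc.mono' (subset_closure.trans hlb_ts)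
  have hintg1 := integrable_greenFun_mul n hx hlb hlbc (hlb_ts.trans hθH)
  have hintg2 := integrable_greenFun_mul n hx hθlu hθc.mul_left (hθlu_ts.trans hθH)
  have hfint1 : Integrable fun y => f y * lap^[n + 1] b y :=
    (continuous_mul_of_continuousOn_of_tsupport_subset hU hf.continuousOn hlb
      ((hlb_ts.trans hθH).trans hHU)).integrable_of_hasCompactSupport hlbc.mul_left
  have hfint2 : Integrable fun y => f y * (lap^[n + 1] u y * θ y) :=
    (continuous_mul_of_continuousOn_of_tsupport_subset hU hf.continuousOn hθlu
      ((hθlu_ts.trans hθH).trans hHU)).integrable_of_hasCompactSupport hθc.mul_left.mul_left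
  have hdiff : ∀ y, greenFun n x y * lap^[n + 1] b y - greenFun n x y * (lap^[n + 1] u y * θ y) =
      f y * lap^[n + 1] b y - f y * (lap^[n + 1] u y * θ y) := by
    intro y
    by_cases hy : y ∈ V
    · have : lap^[n + 1] b y = lap^[n + 1] u y * θ y := by
        rw [hθV y hy, mul_one]
        refine iterate_lap_eq_of_eventuallyEq _ ?_
        filter_upwards [hV.mem_nhds hy] with z hz
        simp [hbdef, hθV z hz]
      rw [this]; ring
    · rw [hfV y hy]
  have h1 : (∫ y, greenFun n x y * lap^[n + 1] b y) -
      (∫ y, greenFun n x y * (lap^[n + 1] u y * θ y)) =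
      (∫ y, f y * lap^[n + 1] b y) - ∫ y, f y * (lap^[n + 1] u y * θ y) := by
    rw [← integral_sub hintg1 hintg2, ← integral_sub hfint1 hfint2]
    simp only [hdiff]
  have h2 : ∫ y, f y * lap^[n + 1] b y = ∫ y in openHalf N, u y * (θ y * lap^[n + 1] f y) := by
    rw [integral_mul_iterate_lap hU (hf.of_le hi) hb hbc ((hts.trans hθH).trans hHU),
      ← setIntegral_eq_integral_of_forall_compl_eq_zero (s := openHalf N)]
    · exact integral_congr_ae (Eventually.of_forall fun y => by simp only [hbdef]; ring)
    · intro y hy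
      have : θ y = 0 := image_eq_zero_of_notMem_tsupport fun h => hy (hθH h)
      simp [hbdef, this]
  have hfθ : ContDiff ℝ ∞ fun y => f y * θ y :=
    contDiff_mul_of_contDiffOn_of_tsupport_subset hU hf hθ (hθH.trans hHU)
  have hfθ_ts : tsupport (fun y => f y * θ y) ⊆ tsupport θ :=
    closure_mono fun y hy => by
      rw [Function.mem_support] at hy ⊢
      exact fun h => hy (by rw [h, mul_zero])
  have hcomm : (fun y => f y * θ y) = fun y => θ y * f y := by ext y; ring
  have h3 : ∫ y, f y * (lap^[n + 1] u y * θ y) =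
      ∫ y in openHalf N, u y * lap^[n + 1] (fun y => θ y * f y) y := by
    have e := integral_mul_iterate_lap isOpen_openHalf hu (hfθ.of_le hi) hθc.mul_left
      (hfθ_ts.trans hθH)
    rw [← hcomm, setIntegral_eq_integral_of_forall_compl_eq_zero, e]
    · exact integral_congr_ae (Eventually.of_forall fun y => by ring)
    · intro y hy
      rw [image_eq_zero_of_notMem_tsupport
        fun h => hy (hθH (hfθ_ts (tsupport_iterate_lap_subset _ _ h))), mul_zero]
  have hlff : ContinuousOn (lap^[n + 1] f) U := (hf.iterate_lap_infty _ hU).continuousOn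
  have hi2 : IntegrableOn (fun y => u y * (θ y * lap^[n + 1] f y)) (openHalf N) := by
    have : Integrable fun y => (u y * lap^[n + 1] f y) * θ y :=
      (continuous_mul_of_continuousOn_of_tsupport_subset isOpen_openHalf
        (hu.continuousOn.mul (hlff.mono hHU)) hθ.continuous
        hθH).integrable_of_hasCompactSupport hθc.mul_left
    refine this.integrableOn.congr (Eventually.of_forall fun y => ?_)
    simp only; ring
  have hi3 : IntegrableOn (fun y => u y * lap^[n + 1] (fun y => θ y * f y) y) (openHalf N) := by
    have h4 := tsupport_iterate_lap_subset (n + 1) fun y => f y * θ y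
    have h5 : Continuous (lap^[n + 1] fun y => f y * θ y) := by
      rw [← continuousOn_univ]
      exact (hfθ.contDiffOn.iterate_lap_infty _ isOpen_univ).continuousOn
    have h6 : HasCompactSupport (lap^[n + 1] fun y => f y * θ y) :=
      hθc.mono' (subset_closure.trans (h4.trans hfθ_ts))
    rw [← hcomm]
    exact ((continuous_mul_of_continuousOn_of_tsupport_subset isOpen_openHalf
      hu.continuousOn h5 ((h4.trans hfθ_ts).trans hθH)).integrable_of_hasCompactSupport
      h6.mul_left).integrableOn
  have h7 : ∫ y in openHalf N, u y * lapComm (n + 1) θ f y =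
      (∫ y in openHalf N, u y * lap^[n + 1] (fun y => θ y * f y) y) -
        ∫ y in openHalf N, u y * (θ y * lap^[n + 1] f y) := by
    rw [← integral_sub hi3 hi2]
    refine integral_congr_ae (Eventually.of_forall fun y => ?_)
    simp only [lapComm]; ring
  have hsw : (fun y => greenFun n x y * (θ y * lap^[n + 1] u y)) =
      fun y => greenFun n x y * (lap^[n + 1] u y * θ y) := by
    ext y; ring
  rw [hsw]
  refine ⟨hintg2, ?_⟩
  rw [hθV x hxV, mul_one] at hmain
  rw [h7, ← h2, ← h3, ← hmain]
  linarith

end CutoffIdentity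

section RescaledBound

variable {N : ℕ} [NeZero N]

theorem exists_bound_of_eq_zero {a : ℝ → ℝ} (ha : Continuous a) (h0 : ∀ s > 2, a s = 0) :
    ∃ C, 0 ≤ C ∧ ∀ s, 0 ≤ s → |a s| ≤ C := by
  obtain ⟨C, hC⟩ := (isCompact_Icc (a := (0 : ℝ)) (b := 2)).exists_bound_of_continuousOn
    ha.continuousOn
  refine ⟨|C|, abs_nonneg C, fun s hs => ?_⟩
  by_cases h : s ≤ 2
  · exact (hC s ⟨hs, h⟩).trans (le_abs_self C)
  · rw [h0 s (not_le.1 h), abs_zero]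
    exact abs_nonneg C

theorem deriv_eq_zero_of_eq_zero {a : ℝ → ℝ} (h0 : ∀ s > 2, a s = 0) : ∀ s > 2, deriv a s = 0 := by
  intro s hs
  have : a =ᶠ[𝓝 s] fun _ => 0 := by
    filter_upwards [Ioi_mem_nhds hs] with z hz using h0 z hz
  rw [this.deriv_eq, deriv_const]

theorem contDiff_deriv_infty {a : ℝ → ℝ} (ha : ContDiff ℝ ∞ a) : ContDiff ℝ ∞ (deriv a) :=
  (contDiff_infty_iff_deriv.1 ha).2

theorem dirDeriv_comp_mul_coord {a : ℝ → ℝ} (ha : Differentiable ℝ a) (t : ℝ) (i : Fin N) :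
    dirDeriv (coordVec i) (fun y : EuclideanSpace ℝ (Fin N) => a (t * y 0)) =
      fun y => if i = 0 then t * deriv a (t * y 0) else 0 := by
  ext y
  have h1 : HasFDerivAt (fun y : EuclideanSpace ℝ (Fin N) => y 0)
      (EuclideanSpace.proj (𝕜 := ℝ) (0 : Fin N)) y :=
    (EuclideanSpace.proj (𝕜 := ℝ) (0 : Fin N)).hasFDerivAt
  have h2 := (ha (t * y 0)).hasDerivAt.comp_hasFDerivAt y (h1.const_mul t)
  have h3 : fderiv ℝ (fun y : EuclideanSpace ℝ (Fin N) => a (t * y 0)) y = _ := h2.fderiv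
  rw [dirDeriv, h3]
  by_cases hi : i = 0
  · subst hi; simp [coordVec, mul_comm]
  · simp [coordVec, hi, Ne.symm hi]

theorem contDiff_comp_mul_coord {a : ℝ → ℝ} {n : WithTop ℕ∞} (ha : ContDiff ℝ n a) (t : ℝ) :
    ContDiff ℝ n fun y : EuclideanSpace ℝ (Fin N) => a (t * y 0) :=
  ha.comp (by fun_prop)

theorem lap_comp_mul_coord {a : ℝ → ℝ} (ha : ContDiff ℝ ∞ a) (t : ℝ)
    (y : EuclideanSpace ℝ (Fin N)) :
    lap (fun y : EuclideanSpace ℝ (Fin N) => a (t * y 0)) y =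
      t ^ 2 * deriv (deriv a) (t * y 0) := by
  have hda := contDiff_deriv_infty ha
  rw [lap_eq_sum ((contDiff_comp_mul_coord ha t).contDiffAt.of_le (natCast_le_infty 2)),
    Finset.sum_eq_single 0]
  · rw [dirDeriv_comp_mul_coord (ha.differentiable (by simp))]
    simp only [if_true]
    rw [dirDeriv_const_mul, dirDeriv_comp_mul_coord (hda.differentiable (by simp))]
    simp only [if_true]
    ring
  · intro i _ hi
    rw [dirDeriv_comp_mul_coord (ha.differentiable (by simp))]
    simp [hi, dirDeriv]
  · simp

theorem exists_bound_iterate_lap_comp_mul_coord_mul {W K : Set (EuclideanSpace ℝ (Fin N))}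
    (hW : IsOpen W) (hK : IsCompact K) (hKW : K ⊆ W) (hK0 : ∀ y ∈ K, 0 ≤ y 0) (j : ℕ)
    {a : ℝ → ℝ} {g : EuclideanSpace ℝ (Fin N) → ℝ} (ha : ContDiff ℝ ∞ a) (ha0 : ∀ s > 2, a s = 0)
    (hg : ContDiffOn ℝ ∞ g W) :
    ∃ C, 0 ≤ C ∧ ∀ t : ℝ, 1 ≤ t → ∀ y ∈ K,
      |lap^[j] (fun y => a (t * y 0) * g y) y| ≤ C * t ^ (2 * j) := by
  induction j generalizing a g with
  | zero =>
    obtain ⟨A, hA0, hA⟩ := exists_bound_of_eq_zero ha.continuous ha0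
    obtain ⟨G, hG⟩ := hK.exists_bound_of_continuousOn (hg.continuousOn.mono hKW)
    refine ⟨A * |G|, by positivity, fun t ht y hy => ?_⟩
    simp only [Function.iterate_zero, id, mul_zero, pow_zero, mul_one, abs_mul]
    exact mul_le_mul (hA _ (mul_nonneg (by linarith) (hK0 y hy)))
      ((hG y hy).trans (le_abs_self G)) (abs_nonneg _) hA0
  | succ j ih =>
    have hda := contDiff_deriv_infty ha
    have hdda := contDiff_deriv_infty hda
    have hda0 := deriv_eq_zero_of_eq_zero ha0
    have hdg : ContDiffOn ℝ ∞ (dirDeriv (coordVec 0) g) W := hg.dirDeriv hW (by rfl)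
    have hlg : ContDiffOn ℝ ∞ (lap g) W := hg.lap hW (by rfl)
    obtain ⟨C1, h10, h1⟩ := ih hdda (deriv_eq_zero_of_eq_zero hda0) hg
    obtain ⟨C2, h20, h2⟩ := ih hda hda0 hdg
    obtain ⟨C3, h30, h3⟩ := ih ha ha0 hlg
    refine ⟨C1 + 2 * C2 + C3, by positivity, fun t ht y hy => ?_⟩
    have hE : EqOn (lap fun y => a (t * y 0) * g y) (fun y =>
        t ^ 2 * (deriv (deriv a) (t * y 0) * g y) +
          (2 * t * (deriv a (t * y 0) * dirDeriv (coordVec 0) g y) + a (t * y 0) * lap g y)) W := by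
      intro z hz
      rw [lap_mul ((contDiff_comp_mul_coord ha t).contDiffAt.of_le (natCast_le_infty 2))
        ((hg.contDiffAt (hW.mem_nhds hz)).of_le (natCast_le_infty 2)), lap_comp_mul_coord ha,
        Finset.sum_eq_single 0, dirDeriv_comp_mul_coord (ha.differentiable (by simp))]
      · simp only [if_true]
        ring
      · intro i _ hi
        rw [dirDeriv_comp_mul_coord (ha.differentiable (by simp))]
        simp [hi]
      · simp
    have hi := natCast_le_infty (2 * j)
    have s1 := (((contDiff_comp_mul_coord (N := N) hdda t).contDiffOn (s := W)).mul hg).of_le hi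
    have s2 := (((contDiff_comp_mul_coord (N := N) hda t).contDiffOn (s := W)).mul hdg).of_le hi
    have s3 := (((contDiff_comp_mul_coord (N := N) ha t).contDiffOn (s := W)).mul hlg).of_le hi
    have s2' := (contDiffOn_const (c := 2 * t)).mul s2
    rw [Function.iterate_succ_apply, iterate_lap_congr hW hE j (hKW hy),
      iterate_lap_add hW ((contDiffOn_const (c := t ^ 2)).mul s1) (s2'.add s3) (hKW hy)]
    beta_reduce
    rw [iterate_lap_add hW s2' s3 (hKW hy), iterate_lap_const_mul, iterate_lap_const_mul]
    have b1 := h1 t ht y hy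
    have b2 := h2 t ht y hy
    have b3 := h3 t ht y hy
    have ht0 : 0 ≤ t := by linarith
    have e1 := mul_le_mul_of_nonneg_left b1 (show 0 ≤ t ^ 2 by positivity)
    have e2 := mul_le_mul_of_nonneg_left b2 (show 0 ≤ 2 * t by positivity)
    have e4 : t ≤ t ^ 2 := by nlinarith
    have e5 : (1 : ℝ) ≤ t ^ 2 := by nlinarith
    have e6 : C2 * t ^ (2 * j) * t ≤ C2 * t ^ (2 * j) * t ^ 2 := by gcongr
    have e7 : C3 * t ^ (2 * j) * 1 ≤ C3 * t ^ (2 * j) * t ^ 2 := by gcongr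
    have e8 : t ^ (2 * (j + 1)) = t ^ (2 * j) * t ^ 2 := by ring
    refine (abs_add_le _ _).trans ((add_le_add_right (abs_add_le _ _) _).trans ?_)
    rw [abs_mul, abs_mul, abs_of_nonneg (show 0 ≤ t ^ 2 by positivity),
      abs_of_nonneg (show 0 ≤ 2 * t by positivity), e8]
    nlinarith

end RescaledBound

section BoundaryLayer

variable {N : ℕ} [NeZero N] {x : EuclideanSpace ℝ (Fin N)}

theorem notMem_ball_of_lt {z : EuclideanSpace ℝ (Fin N)} (hz : z 0 < x 0 / 2) :
    z ∉ Metric.ball x (x 0 / 2) := by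
  intro h
  rw [Metric.mem_ball, dist_eq_norm] at h
  have h1 := PiLp.norm_apply_le (z - x) 0
  rw [PiLp.sub_apply, Real.norm_eq_abs] at h1
  have := neg_le_abs (z 0 - x 0)
  linarith

theorem tendsto_integral_boundary_lapComm (n : ℕ) (hx : 0 < x 0)
    {u η f : EuclideanSpace ℝ (Fin N) → ℝ} {θ : ℝ → ℝ} {C : ℝ} (hC : 0 ≤ C)
    (hu : ContinuousOn u (openHalf N)) (huC : ∀ y, 0 < y 0 → |u y| ≤ C * y 0 ^ (n + 1))
    (hη : ContDiff ℝ ∞ η) (hηc : HasCompactSupport η) (hθ : ContDiff ℝ ∞ θ)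
    (hθ0 : ∀ s > 2, θ s = 0) (hf : ContDiffOn ℝ ∞ f {refl0 x}ᶜ)
    (hfx : ∀ y ∉ Metric.ball x (x 0 / 2), f y = greenFun n x y) :
    Tendsto (fun t : ℝ => ∫ y in openHalf N,
      u y * lapComm (n + 1) (fun y => η y * θ (t * y 0)) f y) atTop (𝓝 0) := by
  have hHU := openHalf_subset_compl_refl0 hx
  have hsm : ∀ t : ℝ, ContDiff ℝ ∞ fun y : EuclideanSpace ℝ (Fin N) => η y * θ (t * y 0) :=
    fun t => hη.mul (contDiff_comp_mul_coord hθ t)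
  have hzero : ∀ (t : ℝ) (y : EuclideanSpace ℝ (Fin N)), 2 < t * y 0 →
      lapComm (n + 1) (fun y => η y * θ (t * y 0)) f y = 0 := by
    intro t y hy
    refine lapComm_eq_zero_of_eventuallyEq_const _ (c := 0) ?_
    have : IsOpen {z : EuclideanSpace ℝ (Fin N) | 2 < t * z 0} :=
      isOpen_lt continuous_const (by fun_prop)
    filter_upwards [this.mem_nhds hy] with z hz
    rw [hθ0 _ hz, mul_zero]
  set K : Set (EuclideanSpace ℝ (Fin N)) :=
    tsupport η ∩ {y | 0 ≤ y 0 ∧ y 0 ≤ x 0 / 4} with hKdef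
  have hK : IsCompact K := by
    refine IsCompact.inter_right hηc ?_
    have hc : Continuous fun y : EuclideanSpace ℝ (Fin N) => y 0 := by fun_prop
    exact (isClosed_le continuous_const hc).inter (isClosed_le hc continuous_const)
  have hK0 : ∀ y ∈ K, 0 ≤ y 0 := fun y hy => hy.2.1
  have hKr : K ⊆ {refl0 x}ᶜ := fun y hy => ne_refl0 hx (hK0 y hy)
  have hKW : K ⊆ ({x}ᶜ ∩ {refl0 x}ᶜ : Set (EuclideanSpace ℝ (Fin N))) := by
    refine fun y hy => ⟨?_, hKr hy⟩
    rintro rfl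
    have := hy.2.2
    linarith
  have hW : IsOpen ({x}ᶜ ∩ {refl0 x}ᶜ : Set (EuclideanSpace ℝ (Fin N))) :=
    isOpen_compl_singleton.inter isOpen_compl_singleton
  have hg : ContDiffOn ℝ ∞ (fun y => η y * ((4 * x 0) ^ (n + 1) * kerInt n (N / 2) (zmap x 0 y)))
      ({x}ᶜ ∩ {refl0 x}ᶜ) := by
    refine hη.contDiffOn.mul (contDiffOn_const.mul ?_)
    exact (contDiffOn_kerInt n (by positivity)).comp (contDiff_zmap x 0).contDiffOn
      fun _ hy => zmap_mem_kerDom_of_ne le_rfl hy.1 hy.2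
  obtain ⟨C1, hC10, hC1⟩ := exists_bound_iterate_lap_comp_mul_coord_mul hW hK hKW hK0 (n + 1)
    (a := fun s => θ s * s ^ (n + 1)) (hθ.mul (by fun_prop))
    (fun s hs => by rw [hθ0 s hs, zero_mul]) hg
  obtain ⟨C2, hC20, hC2⟩ := exists_bound_of_eq_zero hθ.continuous hθ0
  obtain ⟨C3, hC3⟩ := hK.exists_bound_of_continuousOn (f := fun y => η y * lap^[n + 1] f y)
    (hη.continuous.continuousOn.mul
      ((hf.iterate_lap_infty (n + 1) isOpen_compl_singleton).continuousOn.mono hKr))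
  have hbound : ∀ t : ℝ, 1 ≤ t → 8 ≤ t * x 0 → ∀ y ∈ openHalf N,
      ‖u y * lapComm (n + 1) (fun y => η y * θ (t * y 0)) f y‖ ≤
        (tsupport η).indicator
          (fun _ => C * (C1 * 2 ^ (n + 1)) + C * (x 0 / 4) ^ (n + 1) * (C2 * |C3|)) y := by
    intro t ht ht8 y hy
    have hy0 : 0 < y 0 := hy
    have ht0 : 0 < t := by linarith
    by_cases hyη : y ∈ tsupport η
    swap
    · rw [indicator_of_notMem hyη, lapComm_eq_zero_of_eventuallyEq_const _ (c := 0), mul_zero,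
        norm_zero]
      filter_upwards [notMem_tsupport_iff_eventuallyEq.1 hyη] with z hz
      simp [hz]
    rw [indicator_of_mem hyη]
    by_cases hty : 2 < t * y 0
    · rw [hzero t y hty, mul_zero, norm_zero]
      positivity
    rw [not_lt] at hty
    have hy4 : y 0 ≤ x 0 / 4 := by nlinarith
    have hyK : y ∈ K := ⟨hyη, hy0.le, hy4⟩
    have hloc : (fun z => η z * θ (t * z 0) * f z) =ᶠ[𝓝 y] fun z => (t⁻¹) ^ (n + 1) *
        (θ (t * z 0) * (t * z 0) ^ (n + 1) *
          (η z * ((4 * x 0) ^ (n + 1) * kerInt n (N / 2) (zmap x 0 z)))) := by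
      have : IsOpen {z : EuclideanSpace ℝ (Fin N) | z 0 < x 0 / 2} :=
        isOpen_lt (by fun_prop) continuous_const
      filter_upwards [this.mem_nhds (show y 0 < x 0 / 2 by linarith)] with z hz
      rw [hfx z (notMem_ball_of_lt hz), greenFun, greenProf]
      have h1 : t⁻¹ ^ (n + 1) * t ^ (n + 1) = 1 := by
        rw [← mul_pow, inv_mul_cancel₀ ht0.ne', one_pow]
      have h2 : (zmap x 0 z).2 ^ (n + 1) = (4 * x 0) ^ (n + 1) * z 0 ^ (n + 1) := by
        rw [← mul_pow]; rfl
      rw [h2, mul_pow t]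
      linear_combination (-(η z * θ (t * z 0) * (4 * x 0) ^ (n + 1) * z 0 ^ (n + 1) *
        kerInt n (N / 2) (zmap x 0 z))) * h1
    have e1 : |lap^[n + 1] (fun z => η z * θ (t * z 0) * f z) y| ≤ C1 * t ^ (n + 1) := by
      rw [iterate_lap_eq_of_eventuallyEq _ hloc, iterate_lap_const_mul, abs_mul,
        abs_of_nonneg (by positivity)]
      refine (mul_le_mul_of_nonneg_left (hC1 t ht y hyK) (by positivity)).trans (le_of_eq ?_)
      have h1 : t⁻¹ ^ (n + 1) * t ^ (n + 1) = 1 := by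
        rw [← mul_pow, inv_mul_cancel₀ ht0.ne', one_pow]
      rw [two_mul, pow_add]
      linear_combination (C1 * t ^ (n + 1)) * h1
    have e2 : |η y * θ (t * y 0) * lap^[n + 1] f y| ≤ C2 * |C3| := by
      rw [show η y * θ (t * y 0) * lap^[n + 1] f y = θ (t * y 0) * (η y * lap^[n + 1] f y) by ring,
        abs_mul]
      exact mul_le_mul (hC2 _ (by positivity)) ((hC3 y hyK).trans (le_abs_self C3))
        (abs_nonneg _) hC20
    have e3 : |lapComm (n + 1) (fun y => η y * θ (t * y 0)) f y| ≤ C1 * t ^ (n + 1) + C2 * |C3| :=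
      (abs_sub _ _).trans (add_le_add e1 e2)
    rw [norm_mul, Real.norm_eq_abs, Real.norm_eq_abs]
    refine (mul_le_mul (huC y hy0) e3 (abs_nonneg _) (by positivity)).trans ?_
    have e4 : t ^ (n + 1) * y 0 ^ (n + 1) ≤ 2 ^ (n + 1) := by
      rw [← mul_pow]; gcongr
    have e5 : y 0 ^ (n + 1) ≤ (x 0 / 4) ^ (n + 1) := by gcongr
    calc C * y 0 ^ (n + 1) * (C1 * t ^ (n + 1) + C2 * |C3|)
        = C * (C1 * (t ^ (n + 1) * y 0 ^ (n + 1))) + C * y 0 ^ (n + 1) * (C2 * |C3|) := by ring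
      _ ≤ _ := by gcongr
  have h := tendsto_integral_filter_of_dominated_convergence (μ := volume.restrict (openHalf N))
    (l := (atTop : Filter ℝ)) (f := fun _ => 0)
    (F := fun t y => u y * lapComm (n + 1) (fun y => η y * θ (t * y 0)) f y)
    ((tsupport η).indicator
      (fun _ => C * (C1 * 2 ^ (n + 1)) + C * (x 0 / 4) ^ (n + 1) * (C2 * |C3|)))
    (Eventually.of_forall fun t => ?_) ?_ ?_ ?_
  · simpa using h
  · exact (hu.mul ((continuousOn_lapComm (n + 1) isOpen_compl_singleton (hsm t).contDiffOn
      hf).mono hHU)).aestronglyMeasurable isOpen_openHalf.measurableSet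
  · filter_upwards [eventually_ge_atTop 1, eventually_ge_atTop (8 / x 0)] with t ht ht8
    refine (ae_restrict_iff' isOpen_openHalf.measurableSet).2 (Eventually.of_forall ?_)
    exact hbound t ht ((div_le_iff₀ hx).1 ht8)
  · refine Integrable.integrableOn ?_
    rw [integrable_indicator_iff (isClosed_tsupport η).measurableSet]
    exact integrableOn_const hηc.measure_lt_top.ne
  · refine (ae_restrict_iff' isOpen_openHalf.measurableSet).2 (Eventually.of_forall ?_)
    intro y hy
    have hy0 : 0 < y 0 := hy
    refine tendsto_const_nhds.congr' ?_
    filter_upwards [eventually_gt_atTop (2 / y 0)] with t ht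
    rw [hzero t y ((div_lt_iff₀ hy0).1 ht), mul_zero]

end BoundaryLayer

section SliceLaplacian

variable {N : ℕ} {W : Set (ℝ × EuclideanSpace ℝ (Fin N))} {Φ : ℝ × EuclideanSpace ℝ (Fin N) → ℝ}
  {τ : ℝ} {z : EuclideanSpace ℝ (Fin N)}

/-- The Laplacian in the second variable, as an operator on functions of both variables. -/
noncomputable def sliceLap (Φ : ℝ × EuclideanSpace ℝ (Fin N) → ℝ)
    (p : ℝ × EuclideanSpace ℝ (Fin N)) : ℝ :=
  ∑ i, dirDeriv ((0 : ℝ), coordVec i) (dirDeriv ((0 : ℝ), coordVec i) Φ) p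

theorem contDiffOn_iterate_sliceLap (j : ℕ) (hW : IsOpen W) (hΦ : ContDiffOn ℝ ∞ Φ W) :
    ContDiffOn ℝ ∞ (sliceLap^[j] Φ) W := by
  induction j with
  | zero => exact hΦ
  | succ j ih =>
    rw [Function.iterate_succ_apply']
    exact ContDiffOn.sum fun i _ => (ih.dirDeriv (n := ∞) hW (by rfl)).dirDeriv hW (by rfl)

theorem dirDeriv_slice (hΦ : DifferentiableAt ℝ Φ (τ, z)) (v : EuclideanSpace ℝ (Fin N)) :
    dirDeriv v (fun z => Φ (τ, z)) z = dirDeriv ((0 : ℝ), v) Φ (τ, z) := by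
  have h1 : HasFDerivAt (fun z : EuclideanSpace ℝ (Fin N) => (τ, z))
      (ContinuousLinearMap.inr ℝ ℝ (EuclideanSpace ℝ (Fin N))) z := hasFDerivAt_prodMk_right τ z
  have h2 := hΦ.hasFDerivAt.comp z h1
  have h3 : fderiv ℝ (fun z => Φ (τ, z)) z = _ := h2.fderiv
  rw [dirDeriv, h3]
  simp [dirDeriv]

theorem iterate_lap_slice (j : ℕ) (hW : IsOpen W) (hΦ : ContDiffOn ℝ ∞ Φ W) (h : (τ, z) ∈ W) :
    lap^[j] (fun z => Φ (τ, z)) z = sliceLap^[j] Φ (τ, z) := by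
  have hV : IsOpen {z : EuclideanSpace ℝ (Fin N) | (τ, z) ∈ W} :=
    hW.preimage (by fun_prop : Continuous fun z : EuclideanSpace ℝ (Fin N) => (τ, z))
  induction j generalizing z with
  | zero => rfl
  | succ j ih =>
    have hs := contDiffOn_iterate_sliceLap j hW hΦ
    have hE : EqOn (lap^[j] fun z => Φ (τ, z)) (fun z => sliceLap^[j] Φ (τ, z))
      {z | (τ, z) ∈ W} := fun z hz => ih hz
    have hd : ∀ {Ψ : ℝ × EuclideanSpace ℝ (Fin N) → ℝ} {z}, ContDiffOn ℝ ∞ Ψ W → (τ, z) ∈ W →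
        DifferentiableAt ℝ Ψ (τ, z) := fun hΨ hz =>
      (hΨ.contDiffAt (hW.mem_nhds hz)).differentiableAt (by simp)
    have hc : ContDiffAt ℝ 2 (fun z => sliceLap^[j] Φ (τ, z)) z :=
      ((hs.contDiffAt (hW.mem_nhds h)).of_le (natCast_le_infty 2)).comp z (by fun_prop)
    rw [Function.iterate_succ_apply', Function.iterate_succ_apply', lap_congr hV hE h,
      lap_eq_sum hc, sliceLap]
    refine Finset.sum_congr rfl fun i _ => ?_
    have hE2 : EqOn (dirDeriv (coordVec i) fun z => sliceLap^[j] Φ (τ, z))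
        (fun z => dirDeriv ((0 : ℝ), coordVec i) (sliceLap^[j] Φ) (τ, z)) {z | (τ, z) ∈ W} :=
      fun z hz => dirDeriv_slice (hd hs hz) _
    rw [dirDeriv_congr hV hE2 h]
    exact dirDeriv_slice (Φ := dirDeriv ((0 : ℝ), coordVec i) (sliceLap^[j] Φ))
      (hd (hs.dirDeriv hW (by rfl)) h) _

theorem continuousOn_lapComm_slice (j : ℕ) {η : EuclideanSpace ℝ (Fin N) → ℝ} (hW : IsOpen W)
    (hη : ContDiff ℝ ∞ η) (hΦ : ContDiffOn ℝ ∞ Φ W) :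
    ContinuousOn (fun p : ℝ × EuclideanSpace ℝ (Fin N) => lapComm j η (fun z => Φ (p.1, z)) p.2)
      W := by
  have h1 : ContDiff ℝ ∞ fun p : ℝ × EuclideanSpace ℝ (Fin N) => η p.2 := hη.comp contDiff_snd
  have h2 := h1.contDiffOn.mul hΦ
  refine ((contDiffOn_iterate_sliceLap j hW h2).continuousOn.sub (h1.continuous.continuousOn.mul
    (contDiffOn_iterate_sliceLap j hW hΦ).continuousOn)).congr ?_
  rintro ⟨τ, z⟩ hp
  simp only [lapComm, Pi.sub_apply]
  rw [iterate_lap_slice j hW hΦ hp, ← iterate_lap_slice j hW h2 hp]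
  rfl

end SliceLaplacian

section Scaling

variable {N : ℕ}

theorem lap_comp_smul (R : ℝ) (f : EuclideanSpace ℝ (Fin N) → ℝ) :
    lap (fun z => f (R • z)) = fun z => R ^ 2 * lap f (R • z) := by
  ext z
  rw [lap, lap, Finset.mul_sum]
  refine Finset.sum_congr rfl fun i _ => ?_
  have h : (fun t : ℝ => f (R • (z + t • EuclideanSpace.single i (1 : ℝ)))) =
      fun t => (fun s : ℝ => f (R • z + s • EuclideanSpace.single i (1 : ℝ))) (R * t) := by
    ext t; rw [smul_add, smul_smul]
  have h2 : ∀ (g : ℝ → ℝ), deriv (fun t => g (R * t)) = fun t => R * deriv g (R * t) := by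
    intro g; ext t; rw [deriv_comp_mul_left]; simp
  rw [h]
  generalize (fun s : ℝ => f (R • z + s • EuclideanSpace.single i (1 : ℝ))) = g
  rw [iteratedDeriv_succ, iteratedDeriv_one, iteratedDeriv_succ, iteratedDeriv_one, h2]
  have h3 : ∀ (g : ℝ → ℝ) s, deriv (fun t => R * g t) s = R * deriv g s := by
    intro g s; rw [deriv_const_mul_field]
  rw [h3, h2]
  simp only [mul_zero]
  ring

theorem iterate_lap_comp_smul (j : ℕ) (R : ℝ) (f : EuclideanSpace ℝ (Fin N) → ℝ) :
    lap^[j] (fun z => f (R • z)) = fun z => R ^ (2 * j) * lap^[j] f (R • z) := by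
  induction j generalizing f with
  | zero => simp
  | succ j ih =>
    rw [Function.iterate_succ_apply, lap_comp_smul, iterate_lap_const_mul, ih,
      Function.iterate_succ_apply]
    ext z
    ring

theorem lapComm_const_mul (j : ℕ) (c : ℝ) (η f : EuclideanSpace ℝ (Fin N) → ℝ)
    (y : EuclideanSpace ℝ (Fin N)) :
    lapComm j η (fun y => c * f y) y = c * lapComm j η f y := by
  have h : (fun y => η y * (c * f y)) = fun y => c * (η y * f y) := by ext; ring
  rw [lapComm, h, iterate_lap_const_mul, iterate_lap_const_mul, lapComm]
  ring

theorem lapComm_comp_inv_smul (j : ℕ) {R : ℝ} (hR : R ≠ 0) (η f : EuclideanSpace ℝ (Fin N) → ℝ)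
    (z : EuclideanSpace ℝ (Fin N)) :
    lapComm j (fun y => η (R⁻¹ • y)) f (R • z) =
      (R ^ (2 * j))⁻¹ * lapComm j η (fun z => f (R • z)) z := by
  have h1 : (fun z => η z * f (R • z)) =
      fun z => (fun y => η (R⁻¹ • y) * f y) (R • z) := by
    ext z; simp only [inv_smul_smul₀ hR]
  rw [lapComm, lapComm, h1, iterate_lap_comp_smul j R fun y => η (R⁻¹ • y) * f y,
    iterate_lap_comp_smul j R f, inv_smul_smul₀ hR]
  have : R ^ (2 * j) ≠ 0 := pow_ne_zero _ hR
  field_simp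

theorem greenProf_smul (n : ℕ) {s c : ℝ} (hc : 0 < c) {z : ℝ × ℝ} (hz : z ∈ kerDom) :
    greenProf n s (c * z.1, c * z.2) = c ^ (n + 1) * c ^ (-s) * greenProf n s z := by
  have : kerInt n s (c * z.1, c * z.2) = c ^ (-s) * kerInt n s z := by
    rw [kerInt, kerInt, ← intervalIntegral.integral_const_mul]
    refine intervalIntegral.integral_congr fun t ht => ?_
    rw [uIcc_of_le zero_le_one] at ht
    have h := lt_add_mul_of_mem_Icc hz.1 hz.2 ht
    simp only
    rw [show c * z.1 + t * (c * z.2) = c * (z.1 + t * z.2) by ring, Real.mul_rpow hc.le h.le]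
    ring
  rw [greenProf, greenProf, this]
  ring

variable [NeZero N]

theorem greenFun_smul (n : ℕ) {R : ℝ} (hR : 0 < R) {x z : EuclideanSpace ℝ (Fin N)}
    (hz : zmap (R⁻¹ • x) 0 z ∈ kerDom) :
    greenFun n x (R • z) =
      (R ^ 2) ^ (n + 1) * (R ^ 2) ^ (-(N / 2 : ℝ)) * greenFun n (R⁻¹ • x) z := by
  rw [greenFun, greenFun, ← greenProf_smul n (by positivity) hz]
  congr 1
  have h1 : x - R • z = R • (R⁻¹ • x - z) := by
    rw [smul_sub, smul_inv_smul₀ hR.ne']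
  simp only [zmap, add_zero]
  rw [h1, norm_smul, mul_pow, Real.norm_eq_abs, sq_abs]
  simp only [PiLp.smul_apply, smul_eq_mul, Prod.mk.injEq, true_and]
  field_simp

theorem zmap_mem_kerDom_of_norm_lt {x z : EuclideanSpace ℝ (Fin N)} (h : ‖x‖ < ‖z‖) :
    zmap x 0 z ∈ kerDom := by
  refine zmap_mem_kerDom_of_ne le_rfl ?_ ?_
  · rintro rfl; exact lt_irrefl _ h
  · rintro rfl
    have h1 := norm_refl0_sub_sq x 0
    simp only [sub_zero, PiLp.zero_apply, mul_zero, add_zero] at h1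
    nlinarith [norm_nonneg x, norm_nonneg (refl0 x)]

theorem contDiff_zmap_smul (x : EuclideanSpace ℝ (Fin N)) {k : WithTop ℕ∞} :
    ContDiff ℝ k fun p : ℝ × EuclideanSpace ℝ (Fin N) => zmap (p.1 • x) 0 p.2 := by
  have h1 : ContDiff ℝ k fun p : ℝ × EuclideanSpace ℝ (Fin N) => ‖p.1 • x - p.2‖ ^ 2 :=
    ((contDiff_fst.smul contDiff_const).sub contDiff_snd).norm_sq ℝ
  have h2 : ContDiff ℝ k fun p : ℝ × EuclideanSpace ℝ (Fin N) => (p.1 • x) 0 := by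
    simp only [PiLp.smul_apply, smul_eq_mul]
    fun_prop
  have h3 : ContDiff ℝ k fun p : ℝ × EuclideanSpace ℝ (Fin N) => p.2 0 := by fun_prop
  exact (h1.add contDiff_const).prodMk ((contDiff_const.mul h2).mul h3)

theorem greenFun_zero_left (n : ℕ) (z : EuclideanSpace ℝ (Fin N)) : greenFun n 0 z = 0 := by
  simp [greenFun, greenProf, zmap]

theorem setIntegral_lapComm_comp_inv_smul (n : ℕ) {x : EuclideanSpace ℝ (Fin N)} (hx : 0 < x 0)
    {u η f : EuclideanSpace ℝ (Fin N) → ℝ} (hη1 : ∀ z, ‖z‖ ≤ 1 → η z = 1)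
    (hη2 : ∀ z, 2 ≤ ‖z‖ → η z = 0)
    (hfx : ∀ y ∉ Metric.ball x (x 0 / 2), f y = greenFun n x y) {R : ℝ} (hR : 4 * ‖x‖ ≤ R) :
    ∫ y in openHalf N, u y * lapComm (n + 1) (fun y => η (R⁻¹ • y)) f y =
      ∫ z in openHalf N ∩ (Metric.closedBall 0 2 ∩ {z | 1 ≤ ‖z‖}),
        u (R • z) * lapComm (n + 1) η (fun z => greenFun n (R⁻¹ • x) z) z := by
  symm
  have hxn : x 0 ≤ ‖x‖ := (le_abs_self _).trans (PiLp.norm_apply_le x 0)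
  have hx0 : 0 < ‖x‖ := hx.trans_le hxn
  set A : Set (EuclideanSpace ℝ (Fin N)) := Metric.closedBall 0 2 ∩ {z | 1 ≤ ‖z‖} with hA
  have hAc : IsCompact A :=
    (isCompact_closedBall 0 2).inter_right (isClosed_le continuous_const continuous_norm)
  have hHm : MeasurableSet (openHalf N) := isOpen_openHalf.measurableSet
  have hHAm : MeasurableSet (openHalf N ∩ A) := hHm.inter hAc.measurableSet
  have hR0 : 0 < R := by linarith
  have h1 := Measure.integral_comp_smul_of_nonneg (volume : Measure (EuclideanSpace ℝ (Fin N)))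
    ((openHalf N).indicator fun y => u y * lapComm (n + 1) (fun y => η (R⁻¹ • y)) f y) R
    (hR := hR0.le)
  rw [finrank_euclideanSpace, Fintype.card_fin, smul_eq_mul] at h1
  have hRN : R ^ N ≠ 0 := pow_ne_zero _ hR0.ne'
  rw [← integral_indicator hHAm, ← integral_indicator hHm]
  rw [eq_comm, inv_mul_eq_iff_eq_mul₀ hRN] at h1
  rw [h1, ← integral_const_mul]
  refine integral_congr_ae (Eventually.of_forall fun z => ?_)
  have hmem : R • z ∈ openHalf N ↔ z ∈ openHalf N := by
    simp only [openHalf, mem_ofPred_eq, PiLp.smul_apply, smul_eq_mul]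
    exact mul_pos_iff_of_pos_left hR0
  by_cases hzH : z ∈ openHalf N
  swap
  · simp only
    rw [indicator_of_notMem fun h => hzH h.1, indicator_of_notMem fun h => hzH (hmem.1 h),
      mul_zero]
  simp only
  rw [indicator_of_mem (hmem.2 hzH), lapComm_comp_inv_smul _ hR0.ne']
  by_cases hzA : z ∈ A
  · rw [indicator_of_mem (show z ∈ openHalf N ∩ A from ⟨hzH, hzA⟩)]
    have hloc : (fun z => f (R • z)) =ᶠ[𝓝 z] fun z =>
        (R ^ 2) ^ (n + 1) * (R ^ 2) ^ (-(N / 2 : ℝ)) * greenFun n (R⁻¹ • x) z := by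
      have hV : IsOpen {z : EuclideanSpace ℝ (Fin N) | 1 / 2 < ‖z‖} :=
        isOpen_lt continuous_const continuous_norm
      filter_upwards [hV.mem_nhds (show 1 / 2 < ‖z‖ from lt_of_lt_of_le (by norm_num) hzA.2)]
        with w hw
      have hw' : 1 / 2 < ‖w‖ := hw
      rw [hfx, greenFun_smul n hR0]
      · refine zmap_mem_kerDom_of_norm_lt ?_
        rw [norm_smul, Real.norm_of_nonneg (by positivity), inv_mul_lt_iff₀ hR0]
        nlinarith
      · intro hb
        rw [Metric.mem_ball, dist_eq_norm] at hb
        have h2 : ‖R • w‖ ≤ ‖R • w - x‖ + ‖x‖ := by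
          simpa using norm_add_le (R • w - x) x
        rw [norm_smul, Real.norm_of_nonneg hR0.le] at h2
        nlinarith
    have hpow : (R ^ 2) ^ (-(N / 2 : ℝ)) = (R ^ N)⁻¹ := by
      rw [← Real.rpow_natCast R 2, ← Real.rpow_mul hR0.le, ← Real.rpow_natCast R N,
        ← Real.rpow_neg hR0.le]
      congr 1; push_cast; ring
    rw [lapComm_eq_of_eventuallyEq _ (EventuallyEq.refl _ η) hloc, lapComm_const_mul, hpow]
    have hR2 : R ^ (2 * (n + 1)) = (R ^ 2) ^ (n + 1) := pow_mul R 2 (n + 1)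
    have hR3 : (R ^ 2) ^ (n + 1) ≠ 0 := by positivity
    rw [hR2]
    field_simp
  · rw [indicator_of_notMem fun h => hzA h.2]
    have h0 : lapComm (n + 1) η (fun z => f (R • z)) z = 0 := by
      by_cases hz1 : ‖z‖ < 1
      · refine lapComm_eq_zero_of_eventuallyEq_const _ (c := 1) ?_
        filter_upwards [(isOpen_lt continuous_norm continuous_const).mem_nhds hz1] with w hw
        exact hη1 w (le_of_lt hw)
      · have hz2 : 2 < ‖z‖ := by
          by_contra h
          exact hzA ⟨by simpa using h, not_lt.1 hz1⟩
        refine lapComm_eq_zero_of_eventuallyEq_const _ (c := 0) ?_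
        filter_upwards [(isOpen_lt continuous_const continuous_norm).mem_nhds hz2] with w hw
        exact hη2 w (le_of_lt hw)
    rw [h0]
    simp

theorem isOpen_zmap_smul_mem_kerDom (x : EuclideanSpace ℝ (Fin N)) :
    IsOpen {p : ℝ × EuclideanSpace ℝ (Fin N) | zmap (p.1 • x) 0 p.2 ∈ kerDom} :=
  isOpen_kerDom.preimage (contDiff_zmap_smul x (k := 0)).continuous

theorem continuousOn_lapComm_greenFun_smul (n : ℕ) (x : EuclideanSpace ℝ (Fin N))
    {η : EuclideanSpace ℝ (Fin N) → ℝ} (hη : ContDiff ℝ ∞ η) :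
    ContinuousOn (fun p : ℝ × EuclideanSpace ℝ (Fin N) =>
        lapComm (n + 1) η (fun z => greenFun n (p.1 • x) z) p.2)
      {p | zmap (p.1 • x) 0 p.2 ∈ kerDom} := by
  refine continuousOn_lapComm_slice (n + 1)
    (Φ := fun p : ℝ × EuclideanSpace ℝ (Fin N) => greenFun n (p.1 • x) p.2)
    (isOpen_zmap_smul_mem_kerDom x) hη ?_
  exact (contDiffOn_greenProf n (by positivity)).comp (contDiff_zmap_smul x).contDiffOn
    fun _ hp => hp

theorem tendsto_integral_infinity_lapComm (n : ℕ) {x : EuclideanSpace ℝ (Fin N)} (hx : 0 < x 0)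
    {u η f : EuclideanSpace ℝ (Fin N) → ℝ} {C : ℝ}
    (hu : ContinuousOn u (openHalf N)) (huC : ∀ y, 0 < y 0 → |u y| ≤ C)
    (hη : ContDiff ℝ ∞ η) (hη1 : ∀ z, ‖z‖ ≤ 1 → η z = 1) (hη2 : ∀ z, 2 ≤ ‖z‖ → η z = 0)
    (hfx : ∀ y ∉ Metric.ball x (x 0 / 2), f y = greenFun n x y) :
    Tendsto (fun R : ℝ => ∫ y in openHalf N,
      u y * lapComm (n + 1) (fun y => η (R⁻¹ • y)) f y) atTop (𝓝 0) := by
  have hxn : x 0 ≤ ‖x‖ := (le_abs_self _).trans (PiLp.norm_apply_le x 0)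
  have hx0 : 0 < ‖x‖ := hx.trans_le hxn
  set A : Set (EuclideanSpace ℝ (Fin N)) := Metric.closedBall 0 2 ∩ {z | 1 ≤ ‖z‖} with hA
  have hAc : IsCompact A :=
    (isCompact_closedBall 0 2).inter_right (isClosed_le continuous_const continuous_norm)
  obtain ⟨W, hWdef⟩ : ∃ W : Set (ℝ × EuclideanSpace ℝ (Fin N)),
      W = {p | zmap (p.1 • x) 0 p.2 ∈ kerDom} := ⟨_, rfl⟩
  have hW : IsOpen W := hWdef ▸ isOpen_zmap_smul_mem_kerDom x
  obtain ⟨G, hGdef⟩ : ∃ G : ℝ × EuclideanSpace ℝ (Fin N) → ℝ, ∀ p, G p =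
    lapComm (n + 1) η (fun z => greenFun n (p.1 • x) z) p.2 := ⟨_, fun _ => rfl⟩
  have hG : ContinuousOn G W := by
    rw [hWdef, funext hGdef]
    exact continuousOn_lapComm_greenFun_smul n x hη
  have hmemW : ∀ τ : ℝ, 0 ≤ τ → τ * ‖x‖ ≤ 1 / 4 → ∀ z : EuclideanSpace ℝ (Fin N), 1 / 2 < ‖z‖ →
      (τ, z) ∈ W := by
    intro τ hτ0 hτ z hz
    rw [hWdef]
    refine zmap_mem_kerDom_of_norm_lt ?_
    rw [norm_smul, Real.norm_of_nonneg hτ0]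
    linarith
  have hKW : Icc 0 (1 / (4 * ‖x‖)) ×ˢ A ⊆ W := by
    rintro ⟨τ, z⟩ ⟨hτ, hz⟩
    refine hmemW τ hτ.1 ?_ z (lt_of_lt_of_le (by norm_num) hz.2)
    have := mul_le_mul_of_nonneg_right hτ.2 hx0.le
    refine this.trans (le_of_eq ?_)
    field_simp
  obtain ⟨B, hB⟩ := (isCompact_Icc.prod hAc).exists_bound_of_continuousOn (hG.mono hKW)
  have hRτ : ∀ R : ℝ, 4 * ‖x‖ ≤ R → R⁻¹ ∈ Icc 0 (1 / (4 * ‖x‖)) := by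
    intro R hR
    refine ⟨inv_nonneg.2 (by linarith), ?_⟩
    rw [one_div]
    exact inv_anti₀ (by positivity) hR
  have hHm : MeasurableSet (openHalf N) := isOpen_openHalf.measurableSet
  have hHAm : MeasurableSet (openHalf N ∩ A) := hHm.inter hAc.measurableSet
  refine Tendsto.congr' ((eventually_ge_atTop (4 * ‖x‖)).mono fun R hR =>
    (setIntegral_lapComm_comp_inv_smul n hx hη1 hη2 hfx hR).symm) ?_
  simp only [← hGdef (_, _)]
  have hsm : ∀ R : ℝ, 0 < R → ∀ z ∈ openHalf N, R • z ∈ openHalf N := by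
    intro R hR z hz
    have hz0 : 0 < z 0 := hz
    simp only [openHalf, mem_ofPred_eq, PiLp.smul_apply, smul_eq_mul]
    positivity
  have h := tendsto_integral_filter_of_dominated_convergence
    (μ := volume.restrict (openHalf N ∩ A)) (l := (atTop : Filter ℝ)) (f := fun _ => 0)
    (F := fun R z => u (R • z) * G (R⁻¹, z)) (fun _ => C * B) ?_ ?_ ?_ ?_
  · simpa using h
  · filter_upwards [eventually_ge_atTop (4 * ‖x‖)] with R hR
    refine ContinuousOn.aestronglyMeasurable (ContinuousOn.mul ?_ ?_) hHAm
    · exact hu.comp (by fun_prop) fun z hz => hsm R (by linarith) z hz.1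
    · exact hG.comp (by fun_prop) fun z hz => hKW ⟨hRτ R hR, hz.2⟩
  · filter_upwards [eventually_ge_atTop (4 * ‖x‖)] with R hR
    refine (ae_restrict_iff' hHAm).2 (Eventually.of_forall fun z hz => ?_)
    have h1 := huC (R • z) (hsm R (by linarith) z hz.1)
    rw [norm_mul]
    exact mul_le_mul h1 (hB (R⁻¹, z) ⟨hRτ R hR, hz.2⟩) (norm_nonneg _) ((abs_nonneg _).trans h1)
  · exact integrableOn_const
      ((measure_mono inter_subset_right).trans_lt hAc.measure_lt_top).ne
  · refine (ae_restrict_iff' hHAm).2 (Eventually.of_forall fun z hz => ?_)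
    have hG0 : G (0, z) = 0 := by
      have : (fun z => greenFun n ((0 : ℝ) • x) z) = fun z => 0 * greenFun n x z := by
        ext z; rw [zero_smul, greenFun_zero_left, zero_mul]
      rw [hGdef]
      simp only
      rw [this, lapComm_const_mul, zero_mul]
    have hc : ContinuousAt G (0, z) :=
      hG.continuousAt (hW.mem_nhds (hKW ⟨⟨le_rfl, by positivity⟩, hz.2⟩))
    have ht : Tendsto (fun R : ℝ => (R⁻¹, z)) atTop (𝓝 ((0 : ℝ), z)) :=
      tendsto_inv_atTop_zero.prodMk_nhds tendsto_const_nhds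
    have ht2 : Tendsto (fun R : ℝ => C * ‖G (R⁻¹, z)‖) atTop (𝓝 0) := by
      have := ((hc.tendsto.comp ht).norm.const_mul C)
      rw [hG0, norm_zero, mul_zero] at this
      exact this
    refine squeeze_zero_norm' ?_ ht2
    filter_upwards [eventually_gt_atTop 0] with R hR
    rw [norm_mul]
    exact mul_le_mul_of_nonneg_right (huC _ (hsm R hR z hz.1)) (norm_nonneg _)

end Scaling

theorem integral_eq_of_tendsto_integral_mul {α : Type*} [MeasurableSpace α] {μ : Measure α}
    {g : α → ℝ} {Θ : ℕ → α → ℝ} {L : ℝ} (hg : 0 ≤ᵐ[μ] g) (hΘ0 : ∀ k y, 0 ≤ Θ k y)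
    (hΘ1 : ∀ k y, Θ k y ≤ 1) (hΘ : ∀ᵐ y ∂μ, Tendsto (fun k => Θ k y) atTop (𝓝 1))
    (hintg : ∀ k, Integrable (fun y => Θ k y * g y) μ)
    (hL : Tendsto (fun k => ∫ y, Θ k y * g y ∂μ) atTop (𝓝 L)) : ∫ y, g y ∂μ = L := by
  have hlim : ∀ᵐ y ∂μ, Tendsto (fun k => Θ k y * g y) atTop (𝓝 (g y)) := by
    filter_upwards [hΘ] with y hy
    simpa using hy.mul_const (g y)
  have hm : AEStronglyMeasurable g μ :=
    aestronglyMeasurable_of_tendsto_ae atTop (fun k => (hintg k).1) hlim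
  have hk0 : ∀ k, 0 ≤ᵐ[μ] fun y => Θ k y * g y := fun k => by
    filter_upwards [hg] with y hy using mul_nonneg (hΘ0 k y) hy
  have hfatou : ∫⁻ y, ENNReal.ofReal (g y) ∂μ ≤ ENNReal.ofReal L := by
    calc ∫⁻ y, ENNReal.ofReal (g y) ∂μ
        = ∫⁻ y, liminf (fun k => ENNReal.ofReal (Θ k y * g y)) atTop ∂μ := by
          refine lintegral_congr_ae ?_
          filter_upwards [hlim] with y hy
          exact ((ENNReal.continuous_ofReal.tendsto _).comp hy).liminf_eq.symm
      _ ≤ liminf (fun k => ∫⁻ y, ENNReal.ofReal (Θ k y * g y) ∂μ) atTop :=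
          lintegral_liminf_le' fun k => (hintg k).1.aemeasurable.ennreal_ofReal
      _ = liminf (fun k => ENNReal.ofReal (∫ y, Θ k y * g y ∂μ)) atTop := by
          congr 1
          ext k
          rw [ofReal_integral_eq_lintegral_ofReal (hintg k) (hk0 k)]
      _ = ENNReal.ofReal L := ((ENNReal.continuous_ofReal.tendsto _).comp hL).liminf_eq
  have hgi : Integrable g μ :=
    ⟨hm, (hasFiniteIntegral_iff_ofReal hg).2 (hfatou.trans_lt ENNReal.ofReal_lt_top)⟩
  refine tendsto_nhds_unique (tendsto_integral_of_dominated_convergence g (fun k => (hintg k).1)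
    hgi (fun k => ?_) hlim) hL
  filter_upwards [hg] with y hy
  rw [Real.norm_of_nonneg (mul_nonneg (hΘ0 k y) hy)]
  exact mul_le_of_le_one_left hy (hΘ1 k y)

section Representation

variable {N : ℕ} [NeZero N] {x : EuclideanSpace ℝ (Fin N)}

theorem integrableOn_mul_lapComm (j : ℕ) (hx : 0 < x 0) {u θ f : EuclideanSpace ℝ (Fin N) → ℝ}
    {C : ℝ} (hu : ContinuousOn u (openHalf N)) (huC : ∀ y, 0 < y 0 → |u y| ≤ C)
    (hθ : ContDiff ℝ ∞ θ) (hθc : HasCompactSupport θ) (hf : ContDiffOn ℝ ∞ f {refl0 x}ᶜ) :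
    IntegrableOn (fun y => u y * lapComm j θ f y) (openHalf N) := by
  have hc : Continuous fun y : EuclideanSpace ℝ (Fin N) => y 0 := by fun_prop
  have hl := continuousOn_lapComm j isOpen_compl_singleton hθ.contDiffOn hf
  have hK : IsCompact (tsupport θ ∩ {y : EuclideanSpace ℝ (Fin N) | 0 ≤ y 0}) :=
    hθc.isCompact.inter_right (isClosed_le continuous_const hc)
  obtain ⟨B, hB⟩ := hK.exists_bound_of_continuousOn (hl.mono fun y hy => ne_refl0 hx hy.2)
  have hHm : MeasurableSet (openHalf N) := isOpen_openHalf.measurableSet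
  have hm : MeasurableSet (openHalf N ∩ tsupport θ) := hHm.inter (isClosed_tsupport θ).measurableSet
  have hcont : ContinuousOn (fun y => u y * lapComm j θ f y) (openHalf N) :=
    hu.mul (hl.mono (openHalf_subset_compl_refl0 hx))
  have h1 : IntegrableOn (fun y => u y * lapComm j θ f y) (openHalf N ∩ tsupport θ) := by
    refine IntegrableOn.of_bound
      ((measure_mono inter_subset_right).trans_lt hθc.isCompact.measure_lt_top) ?_ (C * B) ?_
    · exact (hcont.mono inter_subset_left).aestronglyMeasurable hm
    · refine (ae_restrict_iff' hm).2 (Eventually.of_forall fun y hy => ?_)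
      have h1 := huC y hy.1
      rw [norm_mul]
      exact mul_le_mul h1 (hB y ⟨hy.2, (show 0 < y 0 from hy.1).le⟩) (norm_nonneg _) ((abs_nonneg _).trans h1)
  refine h1.of_forall_sdiff_eq_zero hHm fun y hy => ?_
  have hy' : y ∉ tsupport θ := fun h => hy.2 ⟨hy.1, h⟩
  rw [lapComm_eq_zero_of_eventuallyEq_const j (c := 0), mul_zero]
  exact notMem_tsupport_iff_eventuallyEq.1 hy'

theorem exists_contDiffOn_eq_greenFun (n : ℕ) (hx : 0 < x 0) :
    ∃ f : EuclideanSpace ℝ (Fin N) → ℝ, ContDiffOn ℝ ∞ f {refl0 x}ᶜ ∧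
      ∀ y ∉ Metric.ball x (x 0 / 2), f y = greenFun n x y := by
  let ζ : ContDiffBump x := ⟨x 0 / 8, x 0 / 4, by positivity, by linarith⟩
  refine ⟨fun y => (1 - ζ y) * greenFun n x y, ?_, ?_⟩
  · intro y hy
    by_cases hyx : y = x
    · subst hyx
      refine ContDiffAt.contDiffWithinAt ?_
      refine (contDiffAt_const (c := (0 : ℝ))).congr_of_eventuallyEq ?_
      filter_upwards [Metric.closedBall_mem_nhds y ζ.rIn_pos] with z hz
      rw [ζ.one_of_mem_closedBall hz, sub_self, zero_mul]
    · refine ContDiffAt.contDiffWithinAt ?_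
      have h := (contDiffOn_greenFun n x).contDiffAt
        ((isOpen_compl_singleton.inter isOpen_compl_singleton).mem_nhds ⟨hyx, hy⟩)
      exact (contDiffAt_const.sub ζ.contDiff.contDiffAt).mul h
  · intro y hy
    have h : ζ y = 0 := by
      refine ζ.zero_of_le_dist ?_
      rw [Metric.mem_ball, not_lt] at hy
      change x 0 / 4 ≤ dist y x
      linarith
    simp only [h, sub_zero, one_mul]

theorem integral_mul_cutoff (n : ℕ) (hx : 0 < x 0)
    {u η f : EuclideanSpace ℝ (Fin N) → ℝ} {θ : ℝ → ℝ} {C : ℝ}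
    (hu : ContDiffOn ℝ (2 * (n + 1) : ℕ) u (openHalf N)) (huC : ∀ y, 0 < y 0 → |u y| ≤ C)
    (hη : ContDiff ℝ ∞ η) (hηc : HasCompactSupport η) (hη1 : ∀ z, ‖z‖ ≤ 1 → η z = 1)
    (hθ : ContDiff ℝ ∞ θ) (hθ1 : ∀ s ≤ 1, θ s = 1) (hθ0 : ∀ s ≥ 2, θ s = 0)
    (hf : ContDiffOn ℝ ∞ f {refl0 x}ᶜ)
    (hfx : ∀ y ∉ Metric.ball x (x 0 / 2), f y = greenFun n x y)
    {R t : ℝ} (hR : 2 * ‖x‖ ≤ R) (ht : 4 / x 0 ≤ t) :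
    IntegrableOn (fun y => η (R⁻¹ • y) * (1 - θ (t * y 0)) * (greenFun n x y * polyLap (n + 1) u y))
      (openHalf N) ∧
    ∫ y in openHalf N,
        η (R⁻¹ • y) * (1 - θ (t * y 0)) * (greenFun n x y * polyLap (n + 1) u y) =
      greenConst N n * u x + (-1) ^ (n + 1) *
        ((∫ y in openHalf N, u y * lapComm (n + 1) (fun y => η (R⁻¹ • y)) f y) -
          ∫ y in openHalf N,
            u y * lapComm (n + 1) (fun y => η (R⁻¹ • y) * θ (t * y 0)) f y) := by
  have hc : Continuous fun y : EuclideanSpace ℝ (Fin N) => y 0 := by fun_prop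
  have hxn : x 0 ≤ ‖x‖ := (le_abs_self _).trans (PiLp.norm_apply_le x 0)
  have hR0 : 0 < R := by linarith
  have ht0 : 0 < t := lt_of_lt_of_le (by positivity) ht
  have htx : 4 ≤ t * x 0 := (div_le_iff₀ hx).1 ht
  have hηR : ContDiff ℝ ∞ fun y => η (R⁻¹ • y) := hη.comp (by fun_prop)
  have hηRc : HasCompactSupport fun y => η (R⁻¹ • y) :=
    hηc.comp_homeomorph (Homeomorph.smulOfNeZero R⁻¹ (inv_ne_zero hR0.ne'))
  have hηθ : ContDiff ℝ ∞ fun y : EuclideanSpace ℝ (Fin N) => η (R⁻¹ • y) * θ (t * y 0) :=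
    hηR.mul (contDiff_comp_mul_coord hθ t)
  have hηθc : HasCompactSupport fun y : EuclideanSpace ℝ (Fin N) => η (R⁻¹ • y) * θ (t * y 0) :=
    hηRc.mul_right
  set Θ : EuclideanSpace ℝ (Fin N) → ℝ := fun y => η (R⁻¹ • y) - η (R⁻¹ • y) * θ (t * y 0)
    with hΘdef
  have hΘ : ContDiff ℝ ∞ Θ := hηR.sub hηθ
  have hΘc : HasCompactSupport Θ := hηRc.sub hηθc
  have hΘsupp : tsupport Θ ⊆ {y | 1 ≤ t * y 0} := by
    refine closure_minimal (fun y hy => ?_) (isClosed_le continuous_const (by fun_prop))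
    by_contra h
    refine hy ?_
    simp only [hΘdef, hθ1 _ (not_le.1 h).le, mul_one, sub_self]
  have hΘH : tsupport Θ ⊆ openHalf N := fun y hy =>
    (mul_pos_iff_of_pos_left ht0).1 (lt_of_lt_of_le one_pos (hΘsupp hy))
  have hΘV : ∀ y ∈ Metric.ball x (x 0 / 2), Θ y = 1 := by
    intro y hy
    have hy1 : x 0 / 2 ≤ y 0 := by
      by_contra h
      exact notMem_ball_of_lt (not_le.1 h) hy
    have hyt : 2 ≤ t * y 0 := by nlinarith
    have hyn : ‖R⁻¹ • y‖ ≤ 1 := by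
      rw [Metric.mem_ball, dist_eq_norm] at hy
      have h2 : ‖y‖ ≤ ‖y - x‖ + ‖x‖ := by simpa using norm_add_le (y - x) x
      rw [norm_smul, norm_inv, Real.norm_of_nonneg hR0.le, inv_mul_le_iff₀ hR0]
      linarith
    simp only [hΘdef, hη1 _ hyn, hθ0 _ hyt, mul_zero, sub_zero]
  obtain ⟨hi, he⟩ := integral_cutoff_mul_greenFun n hx hu hΘ hΘc hΘH Metric.isOpen_ball
    (Metric.mem_ball_self (by positivity)) hΘV isOpen_compl_singleton
    (openHalf_subset_compl_refl0 hx) hf hfx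
  have hfun : (fun y : EuclideanSpace ℝ (Fin N) =>
      η (R⁻¹ • y) * (1 - θ (t * y 0)) * (greenFun n x y * polyLap (n + 1) u y)) =
      fun y => (-1) ^ (n + 1) * (greenFun n x y * (Θ y * lap^[n + 1] u y)) := by
    ext y
    simp only [hΘdef, polyLap]
    ring
  have hzero : ∀ y ∉ openHalf N, greenFun n x y * (Θ y * lap^[n + 1] u y) = 0 := by
    intro y hy
    rw [image_eq_zero_of_notMem_tsupport fun h => hy (hΘH h), zero_mul, mul_zero]
  have hu0 := hu.continuousOn
  have h1 := integrableOn_mul_lapComm (n + 1) hx hu0 huC hηR hηRc hf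
  have h2 := integrableOn_mul_lapComm (n + 1) hx hu0 huC hηθ hηθc hf
  have hsub : ∫ y in openHalf N, u y * lapComm (n + 1) Θ f y =
      (∫ y in openHalf N, u y * lapComm (n + 1) (fun y => η (R⁻¹ • y)) f y) -
          ∫ y in openHalf N,
            u y * lapComm (n + 1) (fun y => η (R⁻¹ • y) * θ (t * y 0)) f y := by
    rw [← integral_sub h1 h2]
    refine setIntegral_congr_fun isOpen_openHalf.measurableSet fun y hy => ?_
    simp only [hΘdef]
    rw [lapComm_sub (n + 1) isOpen_compl_singleton hηR.contDiffOn hηθ.contDiffOn hf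
      (openHalf_subset_compl_refl0 hx hy), mul_sub]
  have hsq : ((-1 : ℝ) ^ (n + 1)) * (-1) ^ (n + 1) = 1 := by
    rw [← mul_pow]; norm_num
  rw [hfun]
  refine ⟨(hi.const_mul _).integrableOn, ?_⟩
  rw [integral_const_mul, setIntegral_eq_integral_of_forall_compl_eq_zero hzero, he, hsub, mul_add,
    ← mul_assoc, hsq, one_mul]

theorem integral_greenFun_mul_polyLap (n : ℕ) (hx : 0 < x 0)
    {u : EuclideanSpace ℝ (Fin N) → ℝ} {C : ℝ} (hC : 0 ≤ C)
    (hu : ContDiffOn ℝ (2 * (n + 1) : ℕ) u (openHalf N)) (huC : ∀ y, 0 < y 0 → |u y| ≤ C)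
    (huC' : ∀ y, 0 < y 0 → |u y| ≤ C * y 0 ^ (n + 1))
    (hpos : ∀ y, 0 < y 0 → 0 ≤ polyLap (n + 1) u y) :
    ∫ y in openHalf N, greenFun n x y * polyLap (n + 1) u y = greenConst N n * u x := by
  obtain ⟨f, hf, hfx⟩ := exists_contDiffOn_eq_greenFun n hx
  let η : ContDiffBump (0 : EuclideanSpace ℝ (Fin N)) := ⟨1, 2, one_pos, one_lt_two⟩
  let θ : ℝ → ℝ := fun s => Real.smoothTransition (2 - s)
  have hη1 : ∀ z, ‖z‖ ≤ 1 → η z = 1 := fun z hz =>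
    η.one_of_mem_closedBall (by simpa using hz)
  have hη2 : ∀ z, 2 ≤ ‖z‖ → η z = 0 := fun z hz => η.zero_of_le_dist (by simpa using hz)
  have hθ : ContDiff ℝ ∞ θ := Real.smoothTransition.contDiff.comp (by fun_prop)
  have hθ1 : ∀ s ≤ 1, θ s = 1 := fun s hs => Real.smoothTransition.one_of_one_le (by linarith)
  have hθ0 : ∀ s ≥ 2, θ s = 0 := fun s hs => Real.smoothTransition.zero_of_nonpos (by linarith)
  have hu0 := hu.continuousOn
  have hA := tendsto_integral_infinity_lapComm n hx hu0 huC η.contDiff hη1 hη2 hfx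
  have hR : ∀ k : ℕ, ∃ R : ℝ, (k : ℝ) + 1 ≤ R ∧ 2 * ‖x‖ ≤ R ∧
      |∫ y in openHalf N, u y * lapComm (n + 1) (fun y => η (R⁻¹ • y)) f y| < 1 / (k + 1) := by
    intro k
    have h1 := hA.abs.eventually (gt_mem_nhds (by rw [abs_zero]; positivity :
      |(0 : ℝ)| < 1 / ((k : ℝ) + 1)))
    obtain ⟨R, h1, h2, h3⟩ := (h1.and ((eventually_ge_atTop ((k : ℝ) + 1)).and
      (eventually_ge_atTop (2 * ‖x‖)))).exists
    exact ⟨R, h2, h3, h1⟩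
  choose R hRk hRx hRA using hR
  have ht : ∀ k : ℕ, ∃ t : ℝ, (k : ℝ) + 1 ≤ t ∧ 4 / x 0 ≤ t ∧
      |∫ y in openHalf N, u y * lapComm (n + 1) (fun y => η ((R k)⁻¹ • y) * θ (t * y 0)) f y| <
        1 / (k + 1) := by
    intro k
    have hRk0 : R k ≠ 0 := (lt_of_lt_of_le (by positivity) (hRk k)).ne'
    have hB := tendsto_integral_boundary_lapComm n hx hC hu0 huC'
      (η := fun y => η ((R k)⁻¹ • y)) (η.contDiff.comp (by fun_prop))
      (η.hasCompactSupport.comp_homeomorph (Homeomorph.smulOfNeZero (R k)⁻¹ (inv_ne_zero hRk0)))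
      hθ (fun s hs => hθ0 s hs.le) hf hfx
    have h1 := hB.abs.eventually (gt_mem_nhds (by rw [abs_zero]; positivity :
      |(0 : ℝ)| < 1 / ((k : ℝ) + 1)))
    obtain ⟨R, h1, h2, h3⟩ := (h1.and ((eventually_ge_atTop ((k : ℝ) + 1)).and
      (eventually_ge_atTop (4 / x 0)))).exists
    exact ⟨R, h2, h3, h1⟩
  choose t htk htx htB using ht
  have hcut := fun k => integral_mul_cutoff n hx hu huC η.contDiff η.hasCompactSupport hη1
    hθ hθ1 hθ0 hf hfx (hRx k) (htx k)
  have hHm : MeasurableSet (openHalf N) := isOpen_openHalf.measurableSet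
  refine integral_eq_of_tendsto_integral_mul
    (Θ := fun k y => η ((R k)⁻¹ • y) * (1 - θ (t k * y 0))) ?_ ?_ ?_ ?_
    (fun k => (hcut k).1) ?_
  · exact (ae_restrict_iff' hHm).2 (Eventually.of_forall fun y hy =>
      mul_nonneg (greenFun_nonneg n hx (le_of_lt hy)) (hpos y hy))
  · exact fun k y => mul_nonneg η.nonneg (sub_nonneg.2 (Real.smoothTransition.le_one _))
  · exact fun k y => mul_le_one₀ η.le_one (sub_nonneg.2 (Real.smoothTransition.le_one _))
      (sub_le_self _ (Real.smoothTransition.nonneg _))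
  · refine (ae_restrict_iff' hHm).2 (Eventually.of_forall fun y hy => ?_)
    have hy0 : 0 < y 0 := hy
    refine tendsto_const_nhds.congr' ?_
    have h1 := tendsto_natCast_atTop_atTop (R := ℝ).eventually_ge_atTop ‖y‖
    have h2 := tendsto_natCast_atTop_atTop (R := ℝ).eventually_ge_atTop (2 / y 0)
    filter_upwards [h1, h2] with k h1 h2
    have hRk0 : 0 < R k := lt_of_lt_of_le (by positivity) (hRk k)
    have hyt : 2 ≤ t k * y 0 := (div_le_iff₀ hy0).1 (by linarith [htk k])
    have hyn : ‖(R k)⁻¹ • y‖ ≤ 1 := by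
      rw [norm_smul, norm_inv, Real.norm_of_nonneg hRk0.le, inv_mul_le_iff₀ hRk0]
      linarith [hRk k]
    rw [hη1 _ hyn, hθ0 _ hyt]
    norm_num
  · rw [tendsto_iff_norm_sub_tendsto_zero]
    have hlim : Tendsto (fun k : ℕ => 2 * (1 / ((k : ℝ) + 1))) atTop (𝓝 0) := by
      simpa using (tendsto_one_div_add_atTop_nhds_zero_nat (𝕜 := ℝ)).const_mul 2
    refine squeeze_zero (fun _ => norm_nonneg _) (fun k => ?_) hlim
    rw [(hcut k).2, add_sub_cancel_left, norm_mul, norm_pow, norm_neg, norm_one, one_pow, one_mul]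
    have h3 := norm_sub_le
      (∫ y in openHalf N, u y * lapComm (n + 1) (fun y => η ((R k)⁻¹ • y)) f y)
      (∫ y in openHalf N, u y * lapComm (n + 1) (fun y => η ((R k)⁻¹ • y) * θ (t k * y 0)) f y)
    rw [Real.norm_eq_abs, Real.norm_eq_abs, Real.norm_eq_abs] at h3
    rw [Real.norm_eq_abs]
    linarith [hRA k, htB k]

end Representation

section DirichletBound

variable {N : ℕ} [NeZero N]

theorem uniqueDiffOn_closedHalf : UniqueDiffOn ℝ {y : EuclideanSpace ℝ (Fin N) | 0 ≤ y 0} := by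
  have hc : Continuous fun y : EuclideanSpace ℝ (Fin N) => y 0 := by fun_prop
  refine uniqueDiffOn_convex ?_ ⟨e1 N, ?_⟩
  · intro a ha b hb s t hs ht _
    have ha' : 0 ≤ a 0 := ha
    have hb' : 0 ≤ b 0 := hb
    simp only [mem_ofPred_eq, PiLp.add_apply, PiLp.smul_apply, smul_eq_mul]
    positivity
  · refine interior_mono (s := {y : EuclideanSpace ℝ (Fin N) | 0 < y 0})
      (fun y (hy : 0 < y 0) => hy.le) ?_
    rw [(isOpen_lt continuous_const hc).interior_eq]
    simp [e1]

theorem hasDerivWithinAt_iteratedFDerivWithin {k j : ℕ} {u : EuclideanSpace ℝ (Fin N) → ℝ}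
    (hu : ContDiffOn ℝ k u {y : EuclideanSpace ℝ (Fin N) | 0 ≤ y 0}) (hj : j < k)
    {z : EuclideanSpace ℝ (Fin N)} (hz : z 0 = 0) {T t : ℝ} (ht : t ∈ Icc 0 T) :
    HasDerivWithinAt
      (fun t : ℝ => iteratedFDerivWithin ℝ j u {y : EuclideanSpace ℝ (Fin N) | 0 ≤ y 0}
        (z + t • e1 N) fun _ => e1 N)
      (iteratedFDerivWithin ℝ (j + 1) u {y : EuclideanSpace ℝ (Fin N) | 0 ≤ y 0}
        (z + t • e1 N) fun _ => e1 N) (Icc 0 T) t := by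
  have hmaps : MapsTo (fun t : ℝ => z + t • e1 N) (Icc 0 T)
      {y : EuclideanSpace ℝ (Fin N) | 0 ≤ y 0} := by
    intro s hs
    simpa [e1, hz] using hs.1
  have h1 := (hu.differentiableOn_iteratedFDerivWithin (by exact_mod_cast hj)
    uniqueDiffOn_closedHalf _ (hmaps ht)).hasFDerivWithinAt
  have h2 : HasDerivWithinAt (fun t : ℝ => z + t • e1 N) (e1 N) (Icc 0 T) t := by
    simpa using (((hasDerivAt_id t).smul_const (e1 N)).const_add z).hasDerivWithinAt
  have h3 := h1.comp_hasDerivWithinAt t h2 hmaps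
  have h4 := (ContinuousMultilinearMap.apply ℝ (fun _ : Fin j => EuclideanSpace ℝ (Fin N)) ℝ
    (fun _ => e1 N)).hasFDerivAt.comp_hasDerivWithinAt t h3
  rw [iteratedFDerivWithin_succ_apply_left]
  exact h4

theorem abs_le_mul_pow_of_dirichlet {m k : ℕ} (hmk : m ≤ k) {u : EuclideanSpace ℝ (Fin N) → ℝ}
    (hu : ContDiffOn ℝ k u {y : EuclideanSpace ℝ (Fin N) | 0 ≤ y 0}) {C : ℝ} (hC0 : 0 ≤ C)
    (hC : ∀ x : EuclideanSpace ℝ (Fin N), 0 ≤ x 0 →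
      ‖iteratedFDerivWithin ℝ m u {y : EuclideanSpace ℝ (Fin N) | 0 ≤ y 0} x‖ ≤ C)
    (h0 : ∀ j : ℕ, j < m → ∀ x : EuclideanSpace ℝ (Fin N), x 0 = 0 →
      iteratedFDerivWithin ℝ j u {y : EuclideanSpace ℝ (Fin N) | 0 ≤ y 0} x
        (fun _ => e1 N) = 0)
    {y : EuclideanSpace ℝ (Fin N)} (hy : 0 ≤ y 0) : |u y| ≤ C * y 0 ^ m := by
  set z := y - y 0 • e1 N with hzdef
  have hz : z 0 = 0 := by simp [hzdef, e1]
  have hyz : y = z + y 0 • e1 N := by simp [hzdef]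
  have key : ∀ i : ℕ, i ≤ m → ∀ T : ℝ, 0 ≤ T →
      ‖iteratedFDerivWithin ℝ (m - i) u {y : EuclideanSpace ℝ (Fin N) | 0 ≤ y 0} (z + T • e1 N)
        fun _ => e1 N‖ ≤ C * T ^ i := by
    intro i
    induction i with
    | zero =>
      intro _ T hT
      refine (ContinuousMultilinearMap.le_opNorm _ _).trans ?_
      have h1 : ‖e1 N‖ = 1 := by simp [e1]
      simp only [h1, Finset.prod_const_one, mul_one, pow_zero, Nat.sub_zero]
      exact hC _ (by simpa [e1, hz] using hT)
    | succ i ih =>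
      intro hi T hT
      have hsucc : m - (i + 1) + 1 = m - i := by omega
      have hd : ∀ t ∈ Icc 0 T, HasDerivWithinAt
          (fun t : ℝ => iteratedFDerivWithin ℝ (m - (i + 1)) u
            {y : EuclideanSpace ℝ (Fin N) | 0 ≤ y 0} (z + t • e1 N) fun _ => e1 N)
          (iteratedFDerivWithin ℝ (m - i) u {y : EuclideanSpace ℝ (Fin N) | 0 ≤ y 0}
            (z + t • e1 N) fun _ => e1 N) (Icc 0 T) t := by
        intro t ht
        rw [← hsucc]
        exact hasDerivWithinAt_iteratedFDerivWithin hu (by omega) hz ht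
      have hb := Convex.norm_image_sub_le_of_norm_hasDerivWithin_le (C := C * T ^ i) hd
        (fun t ht => (ih (by omega) t ht.1).trans (by
          have := ht.1
          have := ht.2
          gcongr)) (convex_Icc 0 T) (left_mem_Icc.2 hT) (right_mem_Icc.2 hT)
      rw [h0 _ (by omega) (z + (0 : ℝ) • e1 N) (by simpa using hz), sub_zero, sub_zero, Real.norm_of_nonneg hT] at hb
      refine hb.trans (le_of_eq ?_)
      ring
  have h := key m le_rfl (y 0) hy
  rw [← hyz, Nat.sub_self, iteratedFDerivWithin_zero_apply] at h
  exact h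

end DirichletBound

theorem greenHalf_eq {N : ℕ} [NeZero N] (n : ℕ) (k : ℝ) {x y : EuclideanSpace ℝ (Fin N)}
    (hx : 0 < x 0) (hy : 0 < y 0) (hyx : y ≠ x) :
    GreenHalf N (n + 1) k x y = k / 2 * greenFun n x y := by
  have hr : 0 < ‖x - y‖ := norm_pos_iff.2 (sub_ne_zero.2 hyx.symm)
  have hp : 0 < 4 * x 0 * y 0 := by positivity
  rw [GreenHalf, greenFun, greenProf, kerInt]
  simp only [zmap, psiInf, add_zero, Nat.add_sub_cancel]
  generalize 4 * x 0 * y 0 = p at hp ⊢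
  generalize ‖x - y‖ = r at hr ⊢
  have h1 := intervalIntegral.smul_integral_comp_mul_left (a := 0) (b := 1)
    (fun z : ℝ => z ^ n * (z + 1) ^ (-(N : ℝ) / 2)) (p / r ^ 2)
  rw [mul_zero, mul_one, smul_eq_mul] at h1
  rw [← h1, mul_assoc]
  congr 1
  have h2 : ∫ t in (0 : ℝ)..1, (p / r ^ 2 * t) ^ n * (p / r ^ 2 * t + 1) ^ (-(N : ℝ) / 2) =
      (p / r ^ 2) ^ n * r ^ (N : ℝ) *
        ∫ t in (0 : ℝ)..1, t ^ n * (r ^ 2 + t * p) ^ (-(N / 2 : ℝ)) := by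
    rw [← intervalIntegral.integral_const_mul]
    refine intervalIntegral.integral_congr fun t ht => ?_
    rw [uIcc_of_le zero_le_one] at ht
    have ht0 := ht.1
    have h3 : p / r ^ 2 * t + 1 = (r ^ 2 + t * p) / r ^ 2 := by
      field_simp
      ring
    have h4 : (r ^ 2) ^ (-(N : ℝ) / 2) = (r ^ (N : ℝ))⁻¹ := by
      rw [← Real.rpow_natCast r 2, ← Real.rpow_mul hr.le, ← Real.rpow_neg hr.le]
      congr 1
      push_cast
      ring
    rw [h3, Real.div_rpow (by positivity) (by positivity), h4, div_inv_eq_mul, mul_pow, neg_div]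
    ring
  rw [h2]
  have h5 : r ^ (2 * ((n + 1 : ℕ) : ℝ) - N) = (r ^ 2) ^ (n + 1) * (r ^ (N : ℝ))⁻¹ := by
    rw [Real.rpow_sub hr, div_eq_mul_inv, ← pow_mul, ← Real.rpow_natCast r (2 * (n + 1))]
    push_cast
    rfl
  have h6 : r ^ (N : ℝ) ≠ 0 := (Real.rpow_pos_of_pos hr _).ne'
  rw [h5, div_pow]
  generalize r ^ (N : ℝ) = A at h6 ⊢
  generalize (∫ t in (0 : ℝ)..1, t ^ n * (r ^ 2 + t * p) ^ (-(N / 2 : ℝ))) = I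
  field_simp
  ring

/-- Green representation formula on the half-space: there is a normalizing constant
`k = k_{N,m} > 0` such that every function `u` which is `C^{2m}` in the open half-space,
`C^{2m-1}` up to the boundary with all derivatives of order `≤ 2m-1` bounded, satisfies
the Dirichlet boundary conditions, and has `(-Δ)^m u ≥ 0`, is represented as
`u(x) = ∫_{ℝ^N_+} G_∞^+(x,y) (-Δ)^m u(y) dy`. -/
theorem stmt_5 {N m : ℕ} [NeZero N] (hm : 0 < m) :
    ∃ k : ℝ, 0 < k ∧
      ∀ u : EuclideanSpace ℝ (Fin N) → ℝ,
        ContDiffOn ℝ (2 * m : ℕ) u {x : EuclideanSpace ℝ (Fin N) | 0 < x 0} →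
        ContDiffOn ℝ (2 * m - 1 : ℕ) u {x : EuclideanSpace ℝ (Fin N) | 0 ≤ x 0} →
        (∀ j : ℕ, j ≤ 2 * m - 1 → ∃ C : ℝ, ∀ x : EuclideanSpace ℝ (Fin N), 0 ≤ x 0 →
          ‖iteratedFDerivWithin ℝ j u {y : EuclideanSpace ℝ (Fin N) | 0 ≤ y 0} x‖ ≤ C) →
        (∀ j : ℕ, j < m → ∀ x : EuclideanSpace ℝ (Fin N), x 0 = 0 →
          iteratedFDerivWithin ℝ j u {y : EuclideanSpace ℝ (Fin N) | 0 ≤ y 0} x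
            (fun _ => e1 N) = 0) →
        (∀ y : EuclideanSpace ℝ (Fin N), 0 < y 0 → 0 ≤ polyLap m u y) →
        ∀ x : EuclideanSpace ℝ (Fin N), 0 < x 0 →
          u x = ∫ y in {y : EuclideanSpace ℝ (Fin N) | 0 < y 0},
            GreenHalf N m k x y * polyLap m u y := by
  obtain ⟨n, rfl⟩ : ∃ n, m = n + 1 := ⟨m - 1, by omega⟩
  have hc := greenConst_pos (N := N) n
  refine ⟨2 / greenConst N n, by positivity, fun u hu huc hbd h0 hpos x hx => ?_⟩
  obtain ⟨C₀, hC₀⟩ := hbd 0 (Nat.zero_le _)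
  obtain ⟨C₁, hC₁⟩ := hbd (n + 1) (by omega)
  set C := max (max C₀ C₁) 0 with hCdef
  have hC : 0 ≤ C := le_max_right _ _
  have h1 : ∀ y : EuclideanSpace ℝ (Fin N), 0 < y 0 → |u y| ≤ C := by
    intro y hy
    have h := hC₀ y hy.le
    rw [norm_iteratedFDerivWithin_zero] at h
    exact h.trans ((le_max_left _ _).trans (le_max_left _ _))
  have h2 : ∀ y : EuclideanSpace ℝ (Fin N), 0 < y 0 → |u y| ≤ C * y 0 ^ (n + 1) := fun y hy =>
    abs_le_mul_pow_of_dirichlet (by omega) huc hC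
      (fun z hz => (hC₁ z hz).trans ((le_max_right _ _).trans (le_max_left _ _))) h0 hy.le
  have h3 := integral_greenFun_mul_polyLap n hx hC hu h1 h2 hpos
  have h4 : ∫ y in openHalf N, GreenHalf N (n + 1) (2 / greenConst N n) x y * polyLap (n + 1) u y =
      ∫ y in openHalf N, (greenConst N n)⁻¹ * (greenFun n x y * polyLap (n + 1) u y) := by
    refine setIntegral_congr_ae isOpen_openHalf.measurableSet ?_
    filter_upwards [ae_ne x] with y hyx hy
    rw [greenHalf_eq n _ hx hy hyx]
    ring
  change u x = ∫ y in openHalf N, _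
  rw [h4, integral_const_mul, h3, inv_mul_cancel_left₀ hc.ne']
end

section
/- Let N ≥ 1, m ≥ 1 be integers, k > 0 a constant, and let φ be the Kelvin-type map φ(y) = 2(y+e₁)/|y+e₁|² − e₁. Then for all distinct x, y in the open unit ball B one has G_∞^+(φ(x), φ(y)) = ( 2/(|x+e₁| |y+e₁|) )^{2m−N} · G₁(x,y). -/
/-- The Kelvin-type map `φ(y) = 2(y+e₁)/|y+e₁|² - e₁`. -/
noncomputable def kelvin (N : ℕ) [NeZero N] (y : EuclideanSpace ℝ (Fin N)) :
    EuclideanSpace ℝ (Fin N) :=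
  (2 / ‖y + e1 N‖ ^ 2) • (y + e1 N) - e1 N

/-- `ψ(x,y) = (1-|x|²)(1-|y|²)/|x-y|²`. -/
noncomputable def psiB {N : ℕ} (x y : EuclideanSpace ℝ (Fin N)) : ℝ :=
  (1 - ‖x‖ ^ 2) * (1 - ‖y‖ ^ 2) / ‖x - y‖ ^ 2

/-- Boggio's kernel on the unit ball with constant `k`. -/
noncomputable def G1 (N m : ℕ) (k : ℝ) (x y : EuclideanSpace ℝ (Fin N)) : ℝ :=
  k / 2 * ‖x - y‖ ^ (2 * (m : ℝ) - N) *
    ∫ z in (0 : ℝ)..(psiB x y), z ^ (m - 1) * (z + 1) ^ (-(N : ℝ) / 2)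

theorem norm_e1 (N : ℕ) [NeZero N] : ‖e1 N‖ = 1 := by
  simp [e1]

theorem add_e1_ne_zero {N : ℕ} [NeZero N] {x : EuclideanSpace ℝ (Fin N)} (hx : ‖x‖ < 1) :
    x + e1 N ≠ 0 := by
  intro h
  rw [eq_neg_of_add_eq_zero_left h, norm_neg, norm_e1] at hx
  exact lt_irrefl _ hx

theorem norm_add_e1_sq {N : ℕ} [NeZero N] (x : EuclideanSpace ℝ (Fin N)) :
    ‖x + e1 N‖ ^ 2 = ‖x‖ ^ 2 + 2 * x 0 + 1 := by
  rw [norm_add_sq_real, norm_e1]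
  simp [e1, EuclideanSpace.inner_single_right]

theorem kelvin_apply_zero {N : ℕ} [NeZero N] {x : EuclideanSpace ℝ (Fin N)}
    (hx : x + e1 N ≠ 0) : kelvin N x 0 = (1 - ‖x‖ ^ 2) / ‖x + e1 N‖ ^ 2 := by
  have h : kelvin N x 0 = 2 / ‖x + e1 N‖ ^ 2 * (x 0 + 1) - 1 := by
    simp [kelvin, e1, mul_add]
  have h0 : ‖x + e1 N‖ ^ 2 ≠ 0 := pow_ne_zero 2 (norm_ne_zero_iff.mpr hx)
  rw [h]
  field_simp
  rw [norm_add_e1_sq]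
  ring

theorem norm_kelvin_sub_kelvin {N : ℕ} [NeZero N] {x y : EuclideanSpace ℝ (Fin N)}
    (hx : x + e1 N ≠ 0) (hy : y + e1 N ≠ 0) :
    ‖kelvin N x - kelvin N y‖ = 2 / (‖x + e1 N‖ * ‖y + e1 N‖) * ‖x - y‖ := by
  have h := dist_div_norm_sq_smul hx hy (√2)
  simpa [div_pow, dist_eq_norm, kelvin] using h

theorem psiInf_kelvin {N : ℕ} [NeZero N] {x y : EuclideanSpace ℝ (Fin N)}
    (hx : x + e1 N ≠ 0) (hy : y + e1 N ≠ 0) (hxy : x ≠ y) :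
    psiInf (kelvin N x) (kelvin N y) = psiB x y := by
  have ha : ‖x + e1 N‖ ≠ 0 := norm_ne_zero_iff.mpr hx
  have hb : ‖y + e1 N‖ ≠ 0 := norm_ne_zero_iff.mpr hy
  have hd : ‖x - y‖ ≠ 0 := norm_ne_zero_iff.mpr (sub_ne_zero.mpr hxy)
  rw [psiInf, psiB, kelvin_apply_zero hx, kelvin_apply_zero hy, norm_kelvin_sub_kelvin hx hy]
  field_simp
  ring

/-- Conformal relation between the half-space kernel and Boggio's kernel:
`G_∞^+(φ(x),φ(y)) = (2/(|x+e₁||y+e₁|))^{2m-N} G₁(x,y)` for distinct `x, y` in the unit ball. -/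
theorem stmt_8 {N m : ℕ} [NeZero N] (hm : 0 < m) (k : ℝ) (hk : 0 < k)
    (x y : EuclideanSpace ℝ (Fin N)) (hx : ‖x‖ < 1) (hy : ‖y‖ < 1) (hxy : x ≠ y) :
    GreenHalf N m k (kelvin N x) (kelvin N y) =
      (2 / (‖x + e1 N‖ * ‖y + e1 N‖)) ^ (2 * (m : ℝ) - N) * G1 N m k x y := by
  have hx0 := add_e1_ne_zero hx
  have hy0 := add_e1_ne_zero hy
  rw [GreenHalf, G1, psiInf_kelvin hx0 hy0 hxy, norm_kelvin_sub_kelvin hx0 hy0,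
    Real.mul_rpow (by positivity) (by positivity)]
  ring
end
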